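/- The set 𝔊₁₄⁰ of isometry classes of unimodular hermitian 𝓞-lattices of rank 14 containing no vector of norm 1 is finite, and the mass Y₁₄ = Σ_{L ∈ 𝔊₁₄⁰} 1/|G(L)|, where G(L) is the automorphism group of L, equals 902121810728981 / (2²⁴·3¹⁴·5³·7²·11·13). -/

import Mathlib

noncomputable section
open Matrix Complex
open scoped ComplexOrder

/-- A primitive cube root of unity in `ℂ`. -/
def ω : ℂ := ⟨-1/2, Real.sqrt 3 / 2⟩

/-- The ring of Eisenstein integers `𝓞 = ℤ[ω]`, the ring of integers of `ℚ(√-3)`,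
realized as a subalgebra of `ℂ` (so that complex conjugation is available). -/
def 𝓞 : Subalgebra ℤ ℂ := Algebra.adjoin ℤ {ω}

/-- All entries of the matrix are Eisenstein integers. -/
def EntriesIn {n : ℕ} (H : Matrix (Fin n) (Fin n) ℂ) : Prop := ∀ i j, H i j ∈ 𝓞

/-- `U ∈ GLₙ(𝓞)`: entries in `𝓞`, with a two-sided inverse having entries in `𝓞`. -/
def InGL {n : ℕ} (U : Matrix (Fin n) (Fin n) ℂ) : Prop :=
  EntriesIn U ∧ ∃ V : Matrix (Fin n) (Fin n) ℂ, EntriesIn V ∧ U * V = 1 ∧ V * U = 1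

/-- `H` is the Gram matrix of a hermitian `𝓞`-lattice of rank `n`:
entries in `𝓞`, equal to its conjugate transpose, positive definite as a complex matrix. -/
def IsHermLattice {n : ℕ} (H : Matrix (Fin n) (Fin n) ℂ) : Prop :=
  EntriesIn H ∧ H.IsHermitian ∧ H.PosDef

/-- A unimodular hermitian `𝓞`-lattice: discriminant `det H = 1`. -/
def IsUnimodular {n : ℕ} (H : Matrix (Fin n) (Fin n) ℂ) : Prop :=
  IsHermLattice H ∧ H.det = 1

/-- Isometry of lattices given by Gram matrices: `H' = U * H * U*` for some `U ∈ GLₙ(𝓞)`. -/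
def LatIsometric {n : ℕ} (H H' : Matrix (Fin n) (Fin n) ℂ) : Prop :=
  ∃ U : Matrix (Fin n) (Fin n) ℂ, InGL U ∧ H' = U * H * Uᴴ

/-- A lattice is decomposable if it is isometric to one whose Gram matrix is block
diagonal with two blocks of smaller positive size. -/
def Decomposable {n : ℕ} (H : Matrix (Fin n) (Fin n) ℂ) : Prop :=
  ∃ H' : Matrix (Fin n) (Fin n) ℂ, LatIsometric H H' ∧ ∃ k : ℕ, 0 < k ∧ k < n ∧
    ∀ i j : Fin n, (((i : ℕ) < k ∧ ¬ (j : ℕ) < k) ∨ (¬ (i : ℕ) < k ∧ (j : ℕ) < k)) → H' i j = 0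

/-- The norm `x* H x` of a vector. -/
def latNorm {n : ℕ} (H : Matrix (Fin n) (Fin n) ℂ) (x : Fin n → ℂ) : ℂ :=
  star x ⬝ᵥ H.mulVec x

/-- A vector of `𝓞ⁿ`. -/
def IsLatVec {n : ℕ} (x : Fin n → ℂ) : Prop := ∀ i, x i ∈ 𝓞

/-- A root: a lattice vector of norm 2. -/
def IsRoot {n : ℕ} (H : Matrix (Fin n) (Fin n) ℂ) (x : Fin n → ℂ) : Prop :=
  IsLatVec x ∧ latNorm H x = 2

/-- The lattice contains no roots. -/
def RootFree {n : ℕ} (H : Matrix (Fin n) (Fin n) ℂ) : Prop :=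
  ∀ x : Fin n → ℂ, ¬ IsRoot H x

/-- The minimal norm of the lattice is `3`. -/
def MinNormThree {n : ℕ} (H : Matrix (Fin n) (Fin n) ℂ) : Prop :=
  (∀ x : Fin n → ℂ, IsLatVec x → x ≠ 0 → 3 ≤ (latNorm H x).re) ∧
  (∃ x : Fin n → ℂ, IsLatVec x ∧ latNorm H x = 3)

/-- The order of the automorphism group `{U ∈ GLₙ(𝓞) : U H U* = H}` of the lattice. -/
def autCard {n : ℕ} (H : Matrix (Fin n) (Fin n) ℂ) : ℕ :=
  Nat.card {U : Matrix (Fin n) (Fin n) ℂ // InGL U ∧ U * H * Uᴴ = H}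

/-- The lattice contains no vector of norm 1. -/
def NormOneFree {n : ℕ} (H : Matrix (Fin n) (Fin n) ℂ) : Prop :=
  ∀ x : Fin n → ℂ, IsLatVec x → latNorm H x ≠ 1

namespace EisLat

/-! ### The ring of Eisenstein integers -/

/-- A computable model of the Eisenstein integers: `⟨a, b⟩` stands for `a + b ω`. -/
abbrev E : Type := QuadraticAlgebra ℤ (-1) (-1)

lemma omega_sq : ω * ω = -1 - ω := by
  have h : (Real.sqrt 3) * (Real.sqrt 3) = 3 := Real.mul_self_sqrt (by norm_num)
  apply Complex.ext <;> simp [ω] <;> nlinarith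

lemma star_omega : star ω = -1 - ω := by
  apply Complex.ext <;> simp [ω]; norm_num

/-- The embedding of the Eisenstein integers into `ℂ`. -/
def φ : E →+* ℂ where
  toFun z := z.re + z.im * ω
  map_one' := by simp [QuadraticAlgebra.re_one, QuadraticAlgebra.im_one]
  map_zero' := by simp
  map_add' x y := by simp; ring
  map_mul' x y := by
    simp only [QuadraticAlgebra.re_mul, QuadraticAlgebra.im_mul]
    push_cast
    linear_combination (-(x.im : ℂ) * y.im) * omega_sq

lemma φ_apply (z : E) : φ z = z.re + z.im * ω := rfl

lemma φ_re (z : E) : (φ z).re = z.re - z.im / 2 := by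
  simp [φ_apply, ω]; ring

lemma φ_im (z : E) : (φ z).im = z.im * (Real.sqrt 3 / 2) := by
  simp [φ_apply, ω]

lemma φ_injective : Function.Injective φ := by
  rw [injective_iff_map_eq_zero]
  intro z hz
  have h1 := congrArg Complex.im hz
  have h2 := congrArg Complex.re hz
  rw [φ_im] at h1
  rw [φ_re] at h2
  have h3 : Real.sqrt 3 ≠ 0 := by positivity
  simp [h3] at h1
  simp [h1] at h2
  ext <;> simp [h1, h2]

lemma φ_star (z : E) : φ (star z) = star (φ z) := by
  rw [φ_apply, φ_apply, star_add, star_mul', star_omega]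
  simp [star_intCast]; ring

lemma φ_mem (z : E) : φ z ∈ 𝓞 := by
  rw [φ_apply]
  have : ω ∈ 𝓞 := Algebra.subset_adjoin rfl
  exact add_mem (intCast_mem _ _) (mul_mem (intCast_mem _ _) this)

lemma mem_O_iff (x : ℂ) : x ∈ 𝓞 ↔ ∃ z : E, φ z = x := by
  refine ⟨fun hx => ?_, fun ⟨z, hz⟩ => hz ▸ φ_mem z⟩
  have h : 𝓞 ≤ subalgebraOfSubring φ.range := by
    refine Algebra.adjoin_le ?_
    rintro _ rfl
    exact ⟨⟨0, 1⟩, by simp [φ_apply]⟩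
  exact h hx

instance : IsDomain E := φ_injective.isDomain φ

/-- The norm form `a² - ab + b²`. -/
abbrev nm (z : E) : ℤ := QuadraticAlgebra.norm z

lemma nm_eq (z : E) : nm z = z.re ^ 2 - z.re * z.im + z.im ^ 2 := by
  rw [nm, QuadraticAlgebra.norm_def]; ring

lemma nm_nonneg (z : E) : 0 ≤ nm z := by
  rw [nm_eq]; nlinarith [sq_nonneg (z.re - z.im), sq_nonneg z.re, sq_nonneg z.im]

lemma nm_eq_zero {z : E} : nm z = 0 ↔ z = 0 := by
  refine ⟨fun h => ?_, fun h => by simp [h]⟩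
  rw [nm_eq] at h
  have h1 : z.re = 0 := by nlinarith [sq_nonneg (2 * z.im - z.re), sq_nonneg z.re]
  have h2 : z.im = 0 := by nlinarith [sq_nonneg (2 * z.re - z.im), sq_nonneg z.im]
  ext <;> simp [h1, h2]

lemma nm_pos {z : E} (h : z ≠ 0) : 0 < nm z :=
  lt_of_le_of_ne (nm_nonneg z) (fun h' => h (nm_eq_zero.1 h'.symm))

lemma mul_star_eq (z : E) : z * star z = (nm z : E) := by
  have := QuadraticAlgebra.algebraMap_norm_eq_mul_star z
  rw [← this]; rfl

lemma normSq_φ (z : E) : Complex.normSq (φ z) = nm z := by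
  have h : (Real.sqrt 3) * (Real.sqrt 3) = 3 := Real.mul_self_sqrt (by norm_num)
  rw [Complex.normSq_apply, φ_re, φ_im, nm_eq]
  push_cast
  linear_combination ((z.im : ℝ) ^ 2 / 4) * h

lemma norm_φ_sq (z : E) : ‖φ z‖ ^ 2 = nm z := by
  rw [← normSq_φ, Complex.normSq_eq_norm_sq]

lemma isUnit_iff_nm {z : E} : IsUnit z ↔ nm z = 1 := by
  rw [QuadraticAlgebra.isUnit_iff_norm_isUnit, Int.isUnit_iff]
  have := nm_nonneg z
  constructor
  · rintro (h | h)
    · exact h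
    · unfold nm at this; omega
  · exact fun h => Or.inl h

lemma nm_finite (m : ℤ) : {z : E | nm z ≤ m}.Finite := by
  have : {z : E | nm z ≤ m} ⊆ (fun p : ℤ × ℤ => (⟨p.1, p.2⟩ : E)) ''
      ((Set.Icc (-(2 * m)) (2 * m)) ×ˢ (Set.Icc (-(2 * m)) (2 * m))) := by
    intro z hz
    have hz : nm z ≤ m := hz
    rw [nm_eq] at hz
    refine ⟨(z.re, z.im), ⟨⟨?_, ?_⟩, ⟨?_, ?_⟩⟩, rfl⟩ <;> dsimp only <;>
      nlinarith [sq_nonneg (2 * z.im - z.re), sq_nonneg (2 * z.re - z.im), sq_nonneg (z.re),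
        sq_nonneg (z.im), sq_nonneg (z.re - 1), sq_nonneg (z.im - 1),
        sq_nonneg (z.re + 1), sq_nonneg (z.im + 1)]
  exact Set.Finite.subset (((Set.finite_Icc _ _).prod (Set.finite_Icc _ _)).image _) this

/-- Division with remainder by a nonzero integer. -/
lemma exists_reduce_int (b : E) {a : ℤ} (ha : 0 < a) :
    ∃ k : E, 4 * nm (b - k * (a : E)) ≤ 3 * a ^ 2 := by
  have key : ∀ x : ℤ, ∃ k : ℤ, 2 * (x - k * a) ≤ a ∧ -a ≤ 2 * (x - k * a) := by
    intro x
    refine ⟨(2 * x + a) / (2 * a), ?_⟩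
    have h1 := Int.emod_add_mul_ediv (2 * x + a) (2 * a)
    have h2 := Int.emod_nonneg (2 * x + a) (show 2 * a ≠ 0 by omega)
    have h3 := Int.emod_lt_of_pos (2 * x + a) (show 0 < 2 * a by omega)
    set k := (2 * x + a) / (2 * a)
    constructor <;> nlinarith
  obtain ⟨k, hk1, hk2⟩ := key b.re
  obtain ⟨l, hl1, hl2⟩ := key b.im
  refine ⟨⟨k, l⟩, ?_⟩
  rw [nm_eq]
  simp only [QuadraticAlgebra.re_sub, QuadraticAlgebra.im_sub, QuadraticAlgebra.re_mul,
    QuadraticAlgebra.im_mul, QuadraticAlgebra.re_intCast, QuadraticAlgebra.im_intCast, Int.cast_id]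
  have e1 : b.re - (k * a + -1 * l * 0) = b.re - k * a := by ring
  have e2 : b.im - (k * 0 + l * a + -1 * l * 0) = b.im - l * a := by ring
  rw [e1, e2]
  set x := b.re - k * a
  set y := b.im - l * a
  nlinarith [mul_nonneg (sub_nonneg.2 hk1) (sub_nonneg.2 hl1),
    mul_nonneg (sub_nonneg.2 hk2) (sub_nonneg.2 hl2),
    mul_nonneg (sub_nonneg.2 hk2) (sub_nonneg.2 hk1),
    mul_nonneg (sub_nonneg.2 hl2) (sub_nonneg.2 hl1)]

lemma exists_quot_rem (x y : E) (hy : y ≠ 0) : ∃ k : E, nm (x - k * y) < nm y := by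
  obtain ⟨k, hk⟩ := exists_reduce_int (x * star y) (nm_pos hy)
  refine ⟨k, ?_⟩
  have h1 : x * star y - k * (nm y : E) = (x - k * y) * star y := by
    rw [← mul_star_eq]; ring
  rw [h1, nm, map_mul, QuadraticAlgebra.norm_star] at hk
  have := nm_pos hy
  unfold nm at *
  nlinarith

instance : IsPrincipalIdealRing E := by
  refine ⟨fun I => ?_⟩
  by_cases hI : I = ⊥
  · exact hI ▸ inferInstance
  obtain ⟨y, hyI, hy0⟩ := Submodule.exists_mem_ne_zero_of_ne_bot hI
  let S : Set ℕ := {k | ∃ z ∈ I, z ≠ 0 ∧ (nm z).toNat = k}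
  have hS : S.Nonempty := ⟨_, y, hyI, hy0, rfl⟩
  obtain ⟨z, hzI, hz0, hz⟩ := Nat.sInf_mem hS
  refine ⟨⟨z, le_antisymm (fun x hx => ?_) ?_⟩⟩
  · obtain ⟨k, hk⟩ := exists_quot_rem x z hz0
    have hr : x - k * z ∈ I := I.sub_mem hx (I.mul_mem_left _ hzI)
    by_cases h0 : x - k * z = 0
    · rw [sub_eq_zero] at h0
      exact Submodule.mem_span_singleton.2 ⟨k, h0.symm⟩
    · have := Nat.sInf_le (s := S) ⟨_, hr, h0, rfl⟩
      have h2 := nm_nonneg (x - k * z)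
      omega
  · exact (Submodule.span_singleton_le_iff_mem _ _).2 hzI

/-- `θ = √-3 = 1 + 2ω`. -/
def θ : E := ⟨1, 2⟩

lemma star_θ : star θ = -θ := by decide
lemma θ_mul_θ : θ * θ = -3 := by decide
lemma θ_ne_zero : θ ≠ 0 := by decide

/-- Reduction modulo `θ`. -/
def π : E →+* ZMod 3 where
  toFun z := ((z.re + z.im : ℤ) : ZMod 3)
  map_one' := by simp [QuadraticAlgebra.re_one, QuadraticAlgebra.im_one]
  map_zero' := by simp
  map_add' x y := by simp; ring
  map_mul' x y := by
    simp only [QuadraticAlgebra.re_mul, QuadraticAlgebra.im_mul]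
    push_cast
    have : (3 : ZMod 3) = 0 := rfl
    linear_combination (-(x.im : ZMod 3) * y.im) * this

lemma π_apply (z : E) : π z = ((z.re + z.im : ℤ) : ZMod 3) := rfl

lemma π_star (z : E) : π (star z) = π z := by
  rw [π_apply, π_apply, QuadraticAlgebra.re_star, QuadraticAlgebra.im_star]
  push_cast
  have : (3 : ZMod 3) = 0 := rfl
  linear_combination (-(z.im : ZMod 3)) * this

lemma π_θ : π θ = 0 := by decide

lemma π_eq_zero_iff {z : E} : π z = 0 ↔ ∃ w, z = θ * w := by
  constructor
  · intro h
    rw [π_apply, ZMod.intCast_zmod_eq_zero_iff_dvd] at h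
    obtain ⟨k, hk⟩ := h
    refine ⟨⟨z.im - k, z.im - 2 * k⟩, ?_⟩
    push_cast at hk
    ext <;> simp only [θ, QuadraticAlgebra.re_mul, QuadraticAlgebra.im_mul] <;> linarith
  · rintro ⟨w, rfl⟩
    simp [π_θ]

lemma π_int (k : ℤ) : π (k : E) = k := map_intCast π k

/-- A set-theoretic section of `π`. -/
def lift3 (u : ZMod 3) : E := (u.val : E)

lemma π_lift3 (u : ZMod 3) : π (lift3 u) = u := by
  rw [lift3, map_natCast, ZMod.natCast_zmod_val]

/-! ### Hermitian forms over the Eisenstein integers -/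

section Forms
variable {ι κ : Type*} [Fintype ι] [Fintype κ]

/-- The sesquilinear form attached to a Gram matrix (row vectors). -/
def h (H : Matrix ι ι E) (x y : ι → E) : E := x ⬝ᵥ H *ᵥ star y

/-- The norm of a row vector. -/
def q (H : Matrix ι ι E) (x : ι → E) : ℤ := (h H x x).re

/-- Positive definiteness. -/
def PD (H : Matrix ι ι E) : Prop := (H.map φ).PosDef

lemma h_add_left (H : Matrix ι ι E) (x y z : ι → E) : h H (x + y) z = h H x z + h H y z :=
  add_dotProduct _ _ _

lemma h_sub_left (H : Matrix ι ι E) (x y z : ι → E) : h H (x - y) z = h H x z - h H y z :=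
  sub_dotProduct _ _ _

lemma h_smul_left (H : Matrix ι ι E) (a : E) (x z : ι → E) : h H (a • x) z = a * h H x z :=
  smul_dotProduct _ _ _

lemma h_add_right (H : Matrix ι ι E) (x y z : ι → E) : h H x (y + z) = h H x y + h H x z := by
  simp [h, mulVec_add]

lemma h_sub_right (H : Matrix ι ι E) (x y z : ι → E) : h H x (y - z) = h H x y - h H x z := by
  simp [h, mulVec_sub]

lemma h_smul_right (H : Matrix ι ι E) (a : E) (x z : ι → E) :
    h H x (a • z) = star a * h H x z := by
  simp [h, mulVec_smul]

lemma h_zero_left (H : Matrix ι ι E) (z : ι → E) : h H 0 z = 0 := by simp [h]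
lemma h_zero_right (H : Matrix ι ι E) (z : ι → E) : h H z 0 = 0 := by simp [h]

lemma h_eq_vecMul (H : Matrix ι ι E) (x y : ι → E) : h H x y = (x ᵥ* H) ⬝ᵥ star y :=
  dotProduct_mulVec _ _ _

lemma h_single_right [DecidableEq ι] (H : Matrix ι ι E) (x : ι → E) (i : ι) :
    h H x (Pi.single i 1) = (x ᵥ* H) i := by
  rw [h_eq_vecMul]
  have : star (Pi.single i 1 : ι → E) = Pi.single i 1 := by
    rw [← Pi.single_star, star_one]
  rw [this, dotProduct_single, mul_one]

lemma h_mul (H : Matrix ι ι E) (B : Matrix κ ι E) (x y : κ → E) :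
    h H (x ᵥ* B) (y ᵥ* B) = h (B * H * Bᴴ) x y := by
  rw [h, h, star_vecMul, ← dotProduct_mulVec, mulVec_mulVec, mulVec_mulVec, Matrix.mul_assoc]

lemma h_row {κ : Type*} (H : Matrix ι ι E) (B : Matrix κ ι E) (i j : κ) :
    h H (B i) (B j) = (B * H * Bᴴ) i j := by
  simp only [h_eq_vecMul, Matrix.mul_apply, dotProduct, vecMul, conjTranspose_apply,
    Pi.star_apply]

lemma q_mul (H : Matrix ι ι E) (B : Matrix κ ι E) (x : κ → E) :
    q H (x ᵥ* B) = q (B * H * Bᴴ) x := by rw [q, q, h_mul]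

lemma star_h {H : Matrix ι ι E} (hH : H.IsHermitian) (x y : ι → E) :
    star (h H x y) = h H y x := by
  rw [h, ← star_dotProduct_star, h, star_mulVec, star_star, hH.eq, dotProduct_mulVec]

lemma eq_re_of_star {z : E} (hz : star z = z) : z = (z.re : E) := by
  have := congrArg QuadraticAlgebra.im hz
  rw [QuadraticAlgebra.im_star] at this
  ext
  · simp
  · simp; omega

lemma h_self {H : Matrix ι ι E} (hH : H.IsHermitian) (x : ι → E) : h H x x = (q H x : E) :=
  eq_re_of_star (star_h hH x x)

lemma q_smul {H : Matrix ι ι E} (hH : H.IsHermitian) (a : E) (x : ι → E) :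
    q H (a • x) = nm a * q H x := by
  have h1 : h H (a • x) (a • x) = ((nm a * q H x : ℤ) : E) := by
    rw [h_smul_left, h_smul_right, h_self hH, ← mul_assoc, mul_star_eq]; push_cast; rfl
  rw [q, h1]; simp

@[simp] lemma q_zero (H : Matrix ι ι E) : q H 0 = 0 := by simp [q, h_zero_left]

lemma PD.isHermitian {ι : Type*} {H : Matrix ι ι E} (hH : PD H) : H.IsHermitian := by
  have := Matrix.PosDef.isHermitian hH
  refine Matrix.ext fun i j => φ_injective ?_
  have h2 := congrFun (congrFun this i) j
  rw [conjTranspose_apply, φ_star]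
  exact h2

lemma map_φ_conjTranspose {ι κ : Type*} (B : Matrix κ ι E) : Bᴴ.map φ = (B.map φ)ᴴ := by
  ext i j; simp [conjTranspose_apply, φ_star]

lemma φ_h (H : Matrix ι ι E) (x y : ι → E) :
    φ (h H x y) = (φ ∘ x) ⬝ᵥ (H.map φ) *ᵥ star (φ ∘ y) := by
  simp only [h, dotProduct, mulVec, map_sum, map_mul, Function.comp_apply, map_apply,
    Pi.star_apply, φ_star]

lemma PD.q_pos {H : Matrix ι ι E} (hH : PD H) {x : ι → E} (hx : x ≠ 0) : 0 < q H x := by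
  have hx' : star (φ ∘ x) ≠ 0 := by
    intro h0
    apply hx
    have h0 := (star_eq_zero).1 h0
    ext1 i
    have := congrFun h0 i
    exact φ_injective (by simpa using this)
  have h1 := hH.dotProduct_mulVec_pos hx'
  rw [star_star, ← φ_h, h_self hH.isHermitian, map_intCast] at h1
  exact_mod_cast h1

lemma PD.q_nonneg {H : Matrix ι ι E} (hH : PD H) (x : ι → E) : 0 ≤ q H x := by
  by_cases hx : x = 0
  · simp [hx]
  · exact (hH.q_pos hx).le

lemma PD.mul_mul [DecidableEq ι] {H : Matrix ι ι E} (hH : PD H) {B : Matrix ι ι E}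
    (hB : B.det ≠ 0) : PD (B * H * Bᴴ) := by
  have hB' : IsUnit (B.map φ) := by
    rw [Matrix.isUnit_iff_isUnit_det, isUnit_iff_ne_zero]
    have : (B.map φ).det = φ B.det := (RingHom.map_det φ B).symm
    rw [this]
    exact fun h => hB (φ_injective (by simpa using h))
  unfold PD
  rw [Matrix.map_mul, Matrix.map_mul, map_φ_conjTranspose]
  exact hH.mul_mul_conjTranspose_same (Matrix.vecMul_injective_of_isUnit hB')

lemma PD.det_pos [DecidableEq ι] {H : Matrix ι ι E} (hH : PD H) : ∃ d : ℤ, 0 < d ∧ H.det = d := by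
  have h1 : star H.det = H.det := by
    rw [← det_conjTranspose, hH.isHermitian.eq]
  have h2 := Matrix.PosDef.det_pos hH
  refine ⟨_, ?_, eq_re_of_star h1⟩
  have : (H.map φ).det = φ H.det := (RingHom.map_det φ H).symm
  rw [this, eq_re_of_star h1, map_intCast] at h2
  exact_mod_cast h2

lemma PD.det_eq_one [DecidableEq ι] {H : Matrix ι ι E} (hH : PD H) (hu : IsUnit H.det) :
    H.det = 1 := by
  obtain ⟨d, hd, hd'⟩ := hH.det_pos
  rw [hd', isUnit_iff_nm, nm_eq] at hu
  simp at hu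
  have : d = 1 := by omega
  simp [hd', this]

lemma PD.cauchy_schwarz {H : Matrix ι ι E} (hH : PD H) (x y : ι → E) :
    nm (h H x y) ≤ q H x * q H y := by
  by_cases hy : y = 0
  · simp [hy, h_zero_right, nm]
  have hyp := hH.q_pos hy
  have h1 := hH.q_nonneg ((q H y : E) • x - h H x y • y)
  have h2 : h H ((q H y : E) • x - h H x y • y) ((q H y : E) • x - h H x y • y) =
      ((q H y * (q H x * q H y - nm (h H x y)) : ℤ) : E) := by
    have e1 := h_self hH.isHermitian x
    have e2 := h_self hH.isHermitian y
    have e3 := star_h hH.isHermitian x y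
    have e4 := mul_star_eq (h H x y)
    simp only [h_sub_left, h_sub_right, h_smul_left, h_smul_right, star_intCast]
    rw [e1, e2, ← e3]
    push_cast
    rw [← e4]
    ring
  rw [q, h2, QuadraticAlgebra.re_intCast, Int.cast_id] at h1
  nlinarith

lemma nm_sum_le {ι : Type*} (s : Finset ι) (f : ι → E) :
    nm (∑ i ∈ s, f i) ≤ s.card * ∑ i ∈ s, nm (f i) := by
  have h1 : (nm (∑ i ∈ s, f i) : ℝ) ≤ s.card * ∑ i ∈ s, (nm (f i) : ℝ) := by
    simp_rw [← norm_φ_sq]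
    rw [map_sum]
    calc ‖∑ i ∈ s, φ (f i)‖ ^ 2 ≤ (∑ i ∈ s, ‖φ (f i)‖) ^ 2 := by
          gcongr; exact norm_sum_le _ _
      _ ≤ _ := sq_sum_le_card_mul_sum_sq
  exact_mod_cast h1

/-- The norm form controls the coordinates. -/
lemma PD.exists_bound [DecidableEq ι] {H : Matrix ι ι E} (hH : PD H) (hu : IsUnit H.det) :
    ∃ K : ℤ, 0 < K ∧ ∀ x j, nm (x j) ≤ K * q H x := by
  have hq : ∀ i, 0 ≤ q H (Pi.single i 1) := fun i => hH.q_nonneg _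
  have hc : ∀ j, 0 ≤ ∑ i, q H (Pi.single i 1) * nm (H⁻¹ i j) := fun j =>
    Finset.sum_nonneg fun i _ => mul_nonneg (hq i) (nm_nonneg _)
  have hs : 0 ≤ ∑ j, ∑ i, q H (Pi.single i 1) * nm (H⁻¹ i j) :=
    Finset.sum_nonneg fun j _ => hc j
  refine ⟨Fintype.card ι * ∑ j, ∑ i, q H (Pi.single i 1) * nm (H⁻¹ i j) + 1, by positivity,
    fun x j => ?_⟩
  have hx : x = (x ᵥ* H) ᵥ* H⁻¹ := by
    rw [vecMul_vecMul, mul_nonsing_inv _ hu, vecMul_one]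
  have h1 : nm (x j) ≤ Fintype.card ι * ∑ i, nm ((x ᵥ* H) i * H⁻¹ i j) := by
    conv_lhs => rw [hx]
    exact nm_sum_le Finset.univ _
  have h2 : ∀ i, nm ((x ᵥ* H) i * H⁻¹ i j) ≤ q H x * (q H (Pi.single i 1) * nm (H⁻¹ i j)) := by
    intro i
    have := hH.cauchy_schwarz x (Pi.single i 1)
    rw [h_single_right] at this
    rw [nm, map_mul, ← mul_assoc]
    exact mul_le_mul_of_nonneg_right this (nm_nonneg _)
  have h3 := Finset.sum_le_sum fun i (_ : i ∈ Finset.univ) => h2 i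
  rw [← Finset.mul_sum] at h3
  have h4 := Finset.single_le_sum (fun j _ => hc j) (Finset.mem_univ j)
  have h5 := hH.q_nonneg x
  calc nm (x j) ≤ Fintype.card ι * ∑ i, nm ((x ᵥ* H) i * H⁻¹ i j) := h1
    _ ≤ Fintype.card ι * (q H x * ∑ j, ∑ i, q H (Pi.single i 1) * nm (H⁻¹ i j)) := by
        gcongr; exact h3.trans (mul_le_mul_of_nonneg_left h4 h5)
    _ ≤ _ := by nlinarith

lemma PD.finite_q_le [DecidableEq ι] {H : Matrix ι ι E} (hH : PD H) (hu : IsUnit H.det) (m : ℤ) :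
    {x | q H x ≤ m}.Finite := by
  obtain ⟨K, hK, hb⟩ := hH.exists_bound hu
  refine (Set.Finite.pi' fun _ : ι => nm_finite (K * m)).subset fun x hx i => ?_
  exact (hb x i).trans (mul_le_mul_of_nonneg_left hx hK.le)

end Forms

/-! ### Reduction theory: finiteness of the class number -/

lemma exists_matrix_of_functional {n : ℕ} (v : Fin (n + 1) → E) (f : (Fin (n + 1) → E) →ₗ[E] E)
    (hf : f v = 1) :
    ∃ U : Matrix (Fin (n + 1)) (Fin (n + 1)) E, IsUnit U.det ∧ U 0 = v ∧ ∀ i : Fin n,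
        f (U i.succ) = 0 := by
  have hsurj : Function.Surjective f := fun c => ⟨c • v, by simp [hf]⟩
  have hrank : Module.finrank E (LinearMap.ker f) = n := by
    have h1 := Submodule.finrank_quotient_add_finrank (LinearMap.ker f)
    rw [(f.quotKerEquivOfSurjective hsurj).finrank_eq] at h1
    simp at h1
    omega
  let b : Module.Basis (Fin n) E (LinearMap.ker f) :=
    (Module.finBasis E (LinearMap.ker f)).reindex (finCongr hrank)
  let B : Module.Basis (Fin (n + 1)) E (Fin (n + 1) → E) := Module.Basis.mkFinCons v b
    (fun c x hx h0 => by
      have := congrArg f h0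
      simpa [hf, LinearMap.mem_ker.1 hx] using this)
    (fun z => ⟨-f z, by simp [LinearMap.mem_ker, hf]⟩)
  have hB : (B : Fin (n + 1) → Fin (n + 1) → E) = Fin.cons v ((↑) ∘ b) :=
    Module.Basis.coe_mkFinCons _ _ _ _
  refine ⟨Matrix.of B, ?_, ?_, ?_⟩
  · have h1 := (Pi.basisFun E (Fin (n + 1))).isUnit_det B
    have h2 : (Pi.basisFun E (Fin (n + 1))).toMatrix B = (Matrix.of B)ᵀ := by
      refine Matrix.ext fun i j => ?_
      simp [Module.Basis.toMatrix_apply]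
    rwa [Module.Basis.det_apply, h2, det_transpose] at h1
  · change B 0 = v
    rw [hB]; rfl
  · intro i
    change f (B i.succ) = 0
    rw [hB]
    exact (b i).2

lemma exists_minimal {n : ℕ} {H : Matrix (Fin (n + 1)) (Fin (n + 1)) E} (hH : PD H) :
    ∃ v, v ≠ 0 ∧ ∀ x, x ≠ 0 → q H v ≤ q H x := by
  let S : Set ℕ := {k | ∃ x, x ≠ 0 ∧ (q H x).toNat = k}
  have hS : S.Nonempty := ⟨_, Pi.single 0 1, by simp, rfl⟩
  obtain ⟨v, hv0, hv⟩ := Nat.sInf_mem hS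
  refine ⟨v, hv0, fun x hx => ?_⟩
  have h1 := Nat.sInf_le (s := S) ⟨x, hx, rfl⟩
  have h2 := hH.q_pos hx
  omega

lemma exists_functional_of_minimal {n : ℕ} {H : Matrix (Fin n) (Fin n) E} (hH : PD H)
    {v : Fin n → E} (hv0 : v ≠ 0) (hv : ∀ x, x ≠ 0 → q H v ≤ q H x) :
    ∃ f : (Fin n → E) →ₗ[E] E, f v = 1 := by
  obtain ⟨g, hg⟩ := IsPrincipalIdealRing.principal (Ideal.span (Set.range v))
  have hg' : ∀ i, ∃ w, v i = w * g := by
    intro i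
    have : v i ∈ Ideal.span (Set.range v) := Ideal.subset_span ⟨i, rfl⟩
    rw [hg] at this
    obtain ⟨w, hw⟩ := Submodule.mem_span_singleton.1 this
    exact ⟨w, hw.symm⟩
  choose w hw using hg'
  have hvw : v = g • w := by ext1 i; simp [hw i, mul_comm]
  have hw0 : w ≠ 0 := fun h0 => hv0 (by simp [hvw, h0])
  have hg0 : g ≠ 0 := fun h0 => hv0 (by simp [hvw, h0])
  have h1 := hv w hw0
  rw [hvw, q_smul hH.isHermitian] at h1
  have h2 := hH.q_pos hw0
  have h3 := nm_pos hg0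
  have h4 : nm g = 1 := by nlinarith
  have hgu : IsUnit g := isUnit_iff_nm.2 h4
  have h1mem : (1 : E) ∈ Ideal.span (Set.range v) := by
    rw [hg]
    have : Ideal.span {g} = ⊤ := Ideal.span_singleton_eq_top.2 hgu
    rw [← Ideal.submodule_span_eq] at this
    rw [this]; trivial
  rw [Ideal.mem_span_range_iff_exists_fun] at h1mem
  obtain ⟨c, hc⟩ := h1mem
  refine ⟨Fintype.linearCombination E c, ?_⟩
  simp only [Fintype.linearCombination_apply, smul_eq_mul]
  rw [← hc]; exact Finset.sum_congr rfl fun i _ => mul_comm _ _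

section Schur
variable {n : ℕ} (H : Matrix (Fin (n + 1)) (Fin (n + 1)) E)

/-- Multiples of the basis vectors, made orthogonal to the first one. -/
def orthRows : Matrix (Fin n) (Fin (n + 1)) E :=
  Matrix.of fun i => Fin.cons (-(H i.succ 0)) (Pi.single i (H 0 0))

lemma vecMul_orthRows (x : Fin n → E) :
    x ᵥ* orthRows H = Fin.cons (-∑ i, x i * H i.succ 0) (H 0 0 • x) := by
  ext1 j
  refine Fin.cases ?_ (fun j => ?_) j
  · simp [orthRows, vecMul, dotProduct]
  · simp [orthRows, vecMul, dotProduct, Pi.single_apply, mul_comm]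

lemma h_single_zero (k : E) (x : Fin n → E) :
    h H (Fin.cons k x) (Pi.single 0 1) = k * H 0 0 + ∑ i, x i * H i.succ 0 := by
  rw [h_single_right, vecMul, dotProduct, Fin.sum_univ_succ]; simp

lemma h_orthRows_single (x : Fin n → E) : h H (x ᵥ* orthRows H) (Pi.single 0 1) = 0 := by
  rw [vecMul_orthRows, h_single_zero]
  simp [Finset.mul_sum, mul_comm, mul_left_comm]

variable {H}

lemma schur_identity (hH : H.IsHermitian) (k k' : E) (x x' : Fin n → E) :
    H 0 0 * H 0 0 * h H (Fin.cons k x) (Fin.cons k' x') =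
      h (orthRows H * H * (orthRows H)ᴴ) x x' + H 0 0 *
        (h H (Fin.cons k x) (Pi.single 0 1) * star (h H (Fin.cons k' x') (Pi.single 0 1))) := by
  have hs : star (H 0 0) = H 0 0 := hH.apply 0 0
  have hx : ∀ k x, H 0 0 • (Fin.cons k x : Fin (n + 1) → E) =
      x ᵥ* orthRows H + h H (Fin.cons k x) (Pi.single 0 1) • Pi.single 0 1 := by
    intro k x
    rw [vecMul_orthRows, h_single_zero]
    ext1 j
    refine Fin.cases ?_ (fun j => ?_) j
    · simp [mul_comm]
    · simp
  have h00 : h H (Pi.single 0 1) (Pi.single 0 1) = H 0 0 := by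
    rw [h_single_right]; simp
  have h0 : ∀ x, h H (Pi.single 0 1) (x ᵥ* orthRows H) = 0 := by
    intro x; rw [← star_h hH, h_orthRows_single, star_zero]
  have : H 0 0 * H 0 0 * h H (Fin.cons k x) (Fin.cons k' x') =
      h H (H 0 0 • Fin.cons k x) (H 0 0 • Fin.cons k' x') := by
    rw [h_smul_left, h_smul_right, hs]; ring
  rw [this, hx, hx, h_add_left, h_add_right, h_add_right, h_smul_left, h_smul_left, h_smul_right,
    h_smul_right, h0, h_orthRows_single, h_mul, h00]
  ring

lemma schur_PD (hH : PD H) : PD (orthRows H * H * (orthRows H)ᴴ) := by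
  have h00 : H 0 0 ≠ 0 := by
    have := hH.q_pos (x := Pi.single 0 1) (by simp)
    intro h0
    rw [q, h_single_right] at this
    simp [h0] at this
  unfold PD
  rw [Matrix.map_mul, Matrix.map_mul, map_φ_conjTranspose]
  refine hH.mul_mul_conjTranspose_same ?_
  intro x y hxy
  ext1 j
  have := congrFun hxy j.succ
  have h1 : φ (H 0 0) ≠ 0 := fun h => h00 (φ_injective (by simpa using h))
  simpa [orthRows, vecMul, dotProduct, Pi.single_apply, apply_ite φ, h1] using this

lemma schur_det (hH : H.IsHermitian) :
    H 0 0 * (orthRows H * H * (orthRows H)ᴴ).det = (H 0 0) ^ (2 * n) * H.det := by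
  have hs : star (H 0 0) = H 0 0 := hH.apply 0 0
  let T : Matrix (Fin (n + 1)) (Fin (n + 1)) E :=
    Matrix.of (Fin.cons (Pi.single 0 1) (orthRows H))
  have hT0 : ∀ j, T 0 j = (Pi.single 0 1 : Fin (n + 1) → E) j := fun j => rfl
  have hTs : ∀ i, T i.succ = orthRows H i := fun i => rfl
  have hT : T.det = H 0 0 ^ n := by
    rw [det_succ_row_zero, Finset.sum_eq_single 0]
    · have : T.submatrix Fin.succ (Fin.succAbove 0) = diagonal fun _ => H 0 0 := by
        refine Matrix.ext fun i j => ?_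
        rw [submatrix_apply, hTs]
        simp [orthRows, diagonal, Pi.single_apply, eq_comm]
      rw [this, det_diagonal, hT0]
      simp
    · intro j _ hj
      rw [hT0]
      simp [hj]
    · simp
  have h1 : (T * H * Tᴴ).det = H 0 0 * (orthRows H * H * (orthRows H)ᴴ).det := by
    rw [det_succ_row_zero, Finset.sum_eq_single 0]
    · have e1 : (T * H * Tᴴ) 0 0 = H 0 0 := by
        rw [← h_row]
        change h H (Pi.single 0 1) (Pi.single 0 1) = _
        rw [h_single_right]; simp
      have : (T * H * Tᴴ).submatrix Fin.succ (Fin.succAbove 0) =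
          orthRows H * H * (orthRows H)ᴴ := by
        refine Matrix.ext fun i j => ?_
        rw [submatrix_apply, ← h_row, ← h_row]
        simp only [Fin.succAbove_zero, hTs]
      rw [this, e1]; simp
    · intro j _ hj
      obtain ⟨j, rfl⟩ := Fin.exists_succ_eq.2 hj
      have : (T * H * Tᴴ) 0 j.succ = 0 := by
        rw [← h_row, ← star_h hH]
        change star (h H (orthRows H j) (Pi.single 0 1)) = 0
        have := h_orthRows_single H (Pi.single j 1)
        rw [single_one_vecMul] at this
        change h H (orthRows H j) (Pi.single 0 1) = 0 at this
        rw [this, star_zero]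
      rw [this]; simp
    · simp
  rw [← h1, det_mul, det_mul, det_conjTranspose, hT, star_pow, hs]
  ring

end Schur

lemma vecMul_ne_zero {n : ℕ} {U : Matrix (Fin n) (Fin n) E} (hU : U.det ≠ 0) {x : Fin n → E}
    (hx : x ≠ 0) : x ᵥ* U ≠ 0 := fun h0 => hx (Matrix.eq_zero_of_vecMul_eq_zero hU h0)

lemma exists_minimal_first {n : ℕ} {H : Matrix (Fin (n + 1)) (Fin (n + 1)) E} (hH : PD H) :
    ∃ U : Matrix (Fin (n + 1)) (Fin (n + 1)) E, IsUnit U.det ∧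
      ∀ x, x ≠ 0 → q (U * H * Uᴴ) (Pi.single 0 1) ≤ q (U * H * Uᴴ) x := by
  obtain ⟨v, hv0, hv⟩ := exists_minimal hH
  obtain ⟨f, hf⟩ := exists_functional_of_minimal hH hv0 hv
  obtain ⟨U, hU, hU0, -⟩ := exists_matrix_of_functional v f hf
  refine ⟨U, hU, fun x hx => ?_⟩
  rw [← q_mul, ← q_mul, single_one_vecMul]
  change q H (U 0) ≤ _
  rw [hU0]
  exact hv _ (vecMul_ne_zero hU.ne_zero hx)

lemma det_conj {n : ℕ} {U H : Matrix (Fin n) (Fin n) E} (hU : IsUnit U.det) :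
    (U * H * Uᴴ).det = H.det := by
  have h1 := mul_star_eq U.det
  rw [isUnit_iff_nm.1 hU] at h1
  rw [det_mul, det_mul, det_conjTranspose, mul_right_comm, h1]; simp

lemma q_single_zero {n : ℕ} {H : Matrix (Fin (n + 1)) (Fin (n + 1)) E} (hH : PD H) :
    H 0 0 = (q H (Pi.single 0 1) : E) := by
  rw [← h_self hH.isHermitian, h_single_right]; simp

lemma exists_lift {n : ℕ} {H : Matrix (Fin (n + 1)) (Fin (n + 1)) E} (hH : PD H)
    (x : Fin n → E) : ∃ k : E,
      4 * nm (h H (Fin.cons k x) (Pi.single 0 1)) ≤ 3 * q H (Pi.single 0 1) ^ 2 := by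
  obtain ⟨k, hk⟩ := exists_reduce_int (∑ i, x i * H i.succ 0)
    (hH.q_pos (x := Pi.single 0 1) (by simp))
  refine ⟨-k, ?_⟩
  rw [h_single_zero, q_single_zero hH]
  convert hk using 3
  ring

lemma schur_q {n : ℕ} {H : Matrix (Fin (n + 1)) (Fin (n + 1)) E} (hH : PD H) (k : E)
    (x : Fin n → E) : q H (Pi.single 0 1) ^ 2 * q H (Fin.cons k x) =
      q (orthRows H * H * (orthRows H)ᴴ) x + q H (Pi.single 0 1) *
        nm (h H (Fin.cons k x) (Pi.single 0 1)) := by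
  have := schur_identity hH.isHermitian k k x x
  rw [mul_star_eq, q_single_zero hH, h_self hH.isHermitian,
    h_self (schur_PD hH).isHermitian] at this
  have h2 : ((q H (Pi.single 0 1) ^ 2 * q H (Fin.cons k x) : ℤ) : E) =
    ((q (orthRows H * H * (orthRows H)ᴴ) x + q H (Pi.single 0 1) *
        nm (h H (Fin.cons k x) (Pi.single 0 1)) : ℤ) : E) := by
    push_cast
    rw [← this]; ring
  exact_mod_cast h2

lemma schur_det' {n : ℕ} {H : Matrix (Fin (n + 2)) (Fin (n + 2)) E} (hH : PD H) {d : ℤ}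
    (hd : H.det = d) : (orthRows H * H * (orthRows H)ᴴ).det =
      ((q H (Pi.single 0 1) ^ (2 * n + 1) * d : ℤ) : E) := by
  have h1 := schur_det hH.isHermitian
  have h0 := hH.q_pos (x := Pi.single 0 1) (by simp)
  rw [q_single_zero hH, hd] at h1
  have h2 : ((q H (Pi.single 0 1) : ℤ) : E) ≠ 0 := by exact_mod_cast h0.ne'
  apply mul_left_cancel₀ h2
  rw [h1]; push_cast; ring

/-- A weak form of Hermite's inequality. -/
lemma hermite_inequality (n : ℕ) : ∃ γ : ℤ, 0 < γ ∧
    ∀ H : Matrix (Fin (n + 1)) (Fin (n + 1)) E, PD H → ∀ d : ℤ, H.det = d → ∀ a : ℤ, 0 < a →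
      (∀ x, x ≠ 0 → a ≤ q H x) → a ^ (n + 1) ≤ γ * d := by
  induction n with
  | zero =>
    refine ⟨1, one_pos, fun H hH d hd a _ ha' => ?_⟩
    have h1 := ha' (Pi.single 0 1) (by simp)
    have h2 : (q H (Pi.single 0 1) : E) = d := by
      rw [← hd, ← q_single_zero hH]; simp
    have h3 : q H (Pi.single 0 1) = d := by exact_mod_cast h2
    simpa [h3] using h1
  | succ n ih =>
    obtain ⟨γ, hγ, ih⟩ := ih
    refine ⟨4 ^ (n + 1) * γ, by positivity, fun H₀ hH₀ d hd₀ b hb hb' => ?_⟩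
    obtain ⟨U, hU, hmin⟩ := exists_minimal_first hH₀
    have hH := hH₀.mul_mul hU.ne_zero
    have hd : (U * H₀ * Uᴴ).det = d := by rw [det_conj hU, hd₀]
    have hba : b ≤ q (U * H₀ * Uᴴ) (Pi.single 0 1) := by
      rw [← q_mul]
      exact hb' _ (vecMul_ne_zero hU.ne_zero (by simp))
    generalize U * H₀ * Uᴴ = H at hH hd hmin hba
    have hdet := schur_det' hH hd
    have ha0 := hH.q_pos (x := Pi.single 0 1) (by simp)
    set a := q H (Pi.single 0 1) with ha
    set L := orthRows H * H * (orthRows H)ᴴ with hLdef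
    have hL : PD L := schur_PD hH
    obtain ⟨v, hv0, hv⟩ := exists_minimal hL
    have h1 := ih L hL _ hdet (q L v) (hL.q_pos hv0) hv
    have h2 : a ^ 3 ≤ 4 * q L v := by
      obtain ⟨k, hk⟩ := exists_lift hH v
      have h3 := schur_q hH k v
      rw [← hLdef, ← ha] at h3
      rw [← ha] at hk
      have h4 := hmin (Fin.cons k v) (fun h0 => hv0 (by
        ext1 i; exact congrFun h0 i.succ))
      nlinarith [mul_le_mul_of_nonneg_left h4 (sq_nonneg a), mul_le_mul_of_nonneg_left hk ha0.le]
    have h5 : a ^ (2 * n + 1) * a ^ (n + 2) ≤ a ^ (2 * n + 1) * (4 ^ (n + 1) * γ * d) := by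
      calc a ^ (2 * n + 1) * a ^ (n + 2) = (a ^ 3) ^ (n + 1) := by ring
        _ ≤ (4 * q L v) ^ (n + 1) := by gcongr
        _ = 4 ^ (n + 1) * q L v ^ (n + 1) := by rw [mul_pow]
        _ ≤ 4 ^ (n + 1) * (γ * (a ^ (2 * n + 1) * d)) := by gcongr
        _ = _ := by ring
    exact (pow_le_pow_left₀ hb.le hba _).trans (le_of_mul_le_mul_left h5 (by positivity))

lemma nm_add_le (x y : E) : nm (x + y) ≤ 2 * nm x + 2 * nm y := by
  rw [nm_eq, nm_eq, nm_eq, QuadraticAlgebra.re_add, QuadraticAlgebra.im_add]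
  nlinarith [sq_nonneg (2 * (x.re - y.re) - (x.im - y.im)), sq_nonneg (x.im - y.im)]

lemma exists_bounded_form (n : ℕ) : ∀ D : ℤ, ∃ F : ℤ, ∀ H : Matrix (Fin n) (Fin n) E, PD H →
    ∀ d : ℤ, H.det = d → d ≤ D →
      ∃ U : Matrix (Fin n) (Fin n) E, IsUnit U.det ∧ ∀ i j, nm ((U * H * Uᴴ) i j) ≤ F := by
  induction n with
  | zero => exact fun D => ⟨0, fun H _ _ _ _ => ⟨1, by simp, fun i => i.elim0⟩⟩
  | succ n ih =>
    intro D
    obtain ⟨γ, hγ, hermite⟩ := hermite_inequality n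
    obtain ⟨F, hF⟩ := ih ((γ * D) ^ (2 * n) * D)
    refine ⟨2 * |F| + 2 * (γ * D) ^ 6 + (γ * D) ^ 2, fun H₀ hH₀ d hd₀ hdD => ?_⟩
    obtain ⟨V, hV, hmin⟩ := exists_minimal_first hH₀
    have hH := hH₀.mul_mul hV.ne_zero
    have hd : (V * H₀ * Vᴴ).det = d := by rw [det_conj hV, hd₀]
    suffices ∃ U : Matrix (Fin (n + 1)) (Fin (n + 1)) E, IsUnit U.det ∧
        ∀ i j, nm ((U * (V * H₀ * Vᴴ) * Uᴴ) i j) ≤ 2 * |F| + 2 * (γ * D) ^ 6 + (γ * D) ^ 2 by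
      obtain ⟨U, hU, hU'⟩ := this
      refine ⟨U * V, by rw [det_mul]; exact hU.mul hV, fun i j => ?_⟩
      rw [conjTranspose_mul]
      simpa only [Matrix.mul_assoc] using hU' i j
    generalize V * H₀ * Vᴴ = H at hH hd hmin
    have ha0 := hH.q_pos (x := Pi.single 0 1) (by simp)
    have hherm := hermite H hH d hd _ ha0 hmin
    have hd0 : 0 < d := by
      obtain ⟨d', hd', hd''⟩ := hH.det_pos
      rw [hd] at hd''
      have : d = d' := by exact_mod_cast hd''
      omega
    have haD : q H (Pi.single 0 1) ≤ γ * D := by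
      have h1 : q H (Pi.single 0 1) ≤ q H (Pi.single 0 1) ^ (n + 1) :=
        le_self_pow₀ (by omega) (by omega)
      nlinarith
    have hdet := schur_det hH.isHermitian
    rw [hd, q_single_zero hH] at hdet
    have hL : PD (orthRows H * H * (orthRows H)ᴴ) := schur_PD hH
    obtain ⟨e, he0, he⟩ := hL.det_pos
    have heD : e ≤ (γ * D) ^ (2 * n) * D := by
      rw [he] at hdet
      have h1 : q H (Pi.single 0 1) * e = q H (Pi.single 0 1) ^ (2 * n) * d := by
        exact_mod_cast hdet
      calc e ≤ q H (Pi.single 0 1) * e := by nlinarith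
        _ = q H (Pi.single 0 1) ^ (2 * n) * d := h1
        _ ≤ _ := by
          have h2 := pow_nonneg (ha0.le.trans haD) (2 * n)
          gcongr
    obtain ⟨U, hU, hUF⟩ := hF _ hL e he heD
    choose k hk using fun i => exists_lift hH (U i)
    set a := q H (Pi.single 0 1) with ha
    let W : Matrix (Fin (n + 1)) (Fin (n + 1)) E :=
      Matrix.of (Fin.cons (Pi.single 0 1) fun i => Fin.cons (k i) (U i))
    have hW0 : W 0 = Pi.single 0 1 := rfl
    have hWs : ∀ i, W i.succ = Fin.cons (k i) (U i) := fun i => rfl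
    have hγD : a ^ 2 ≤ (γ * D) ^ 2 := by gcongr
    have hγD6 : a ^ 6 ≤ (γ * D) ^ 6 := by gcongr
    have h6 : 0 ≤ (γ * D) ^ 6 := by positivity
    refine ⟨W, ?_, fun i j => ?_⟩
    · have : W.det = U.det := by
        rw [det_succ_row_zero, Finset.sum_eq_single 0]
        · have : W.submatrix Fin.succ (Fin.succAbove 0) = U := by
            refine Matrix.ext fun i j => ?_
            rw [submatrix_apply, hWs]; simp
          rw [this, hW0]; simp
        · intro j _ hj
          rw [hW0]; simp [hj]
        · simp
      rwa [this]
    · rw [← h_row]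
      have hF0 := abs_nonneg F
      have hF1 := le_abs_self F
      have h00 : nm (h H (Pi.single 0 1) (Pi.single 0 1)) = a ^ 2 := by
        rw [h_self hH.isHermitian, ← ha, nm_eq]; simp
      have ha2 : 0 ≤ a ^ 2 := sq_nonneg a
      have hstar : ∀ x, nm (h H (Pi.single 0 1) x) = nm (h H x (Pi.single 0 1)) := by
        intro x; rw [← star_h hH.isHermitian, nm, QuadraticAlgebra.norm_star]
      have hsq : ∀ i, nm (h H (Fin.cons (k i) (U i)) (Pi.single 0 1)) ≤ a ^ 2 := fun i => by
        have := hk i; linarith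
      refine Fin.cases ?_ (fun i => ?_) i <;> refine Fin.cases ?_ (fun j => ?_) j
      · rw [hW0, h00]
        linarith
      · rw [hW0, hWs, hstar]
        have := hsq j
        linarith
      · rw [hW0, hWs]
        have := hsq i
        linarith
      · rw [hWs, hWs]
        have h1 := schur_identity hH.isHermitian (k i) (k j) (U i) (U j)
        rw [q_single_zero hH, h_row] at h1
        have h2 := congrArg nm h1
        have h3 : nm ((q H (Pi.single 0 1) : E)) = a ^ 2 := by rw [nm_eq]; simp [ha]
        have h4 := nm_add_le ((U * (orthRows H * H * (orthRows H)ᴴ) * Uᴴ) i j)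
          ((q H (Pi.single 0 1) : E) * (h H (Fin.cons (k i) (U i)) (Pi.single 0 1) *
            star (h H (Fin.cons (k j) (U j)) (Pi.single 0 1))))
        rw [← h2] at h4
        simp only [nm, map_mul, QuadraticAlgebra.norm_star] at h4 h3 hsq
        rw [h3] at h4
        have h5 := hUF i j
        have h7 := mul_le_mul (hsq i) (hsq j) (nm_nonneg _) ha2
        have h8 := mul_le_mul_of_nonneg_left h7 ha2
        have h9 : QuadraticAlgebra.norm (h H (Fin.cons (k i) (U i)) (Fin.cons (k j) (U j))) ≤
            a ^ 2 * a ^ 2 * QuadraticAlgebra.norm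
              (h H (Fin.cons (k i) (U i)) (Fin.cons (k j) (U j))) := by
          refine le_mul_of_one_le_left (nm_nonneg _) ?_
          have : 1 ≤ a ^ 2 := one_le_pow₀ ha0
          nlinarith
        simp only [nm] at h5 h8 ⊢
        have : a ^ 2 * (a ^ 2 * a ^ 2) = a ^ 6 := by ring
        have : 0 ≤ (γ * D) ^ 2 := by positivity
        linarith

/-! ### Unimodular lattices, isometries and isometry classes -/

/-- Gram matrices of unimodular positive definite hermitian lattices. -/
structure Herm (n : ℕ) where
  mat : Matrix (Fin n) (Fin n) E
  det_eq : mat.det = 1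
  pd : PD mat

namespace Herm
variable {n : ℕ}

lemma isHermitian (H : Herm n) : H.mat.IsHermitian := H.pd.isHermitian

lemma isUnit_det (H : Herm n) : IsUnit H.mat.det := H.det_eq ▸ isUnit_one

@[ext] lemma ext' {H H' : Herm n} (h : H.mat = H'.mat) : H = H' := by
  cases H; cases H'; simp_all

/-- The isometries from the lattice `H'` onto the lattice `H`, as base changes. -/
@[ext] structure J (H H' : Herm n) where
  val : Matrix (Fin n) (Fin n) E
  eq : val * H.mat * valᴴ = H'.mat

lemma J.isUnit {H H' : Herm n} (U : J H H') : IsUnit U.val.det := by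
  have := congrArg Matrix.det U.eq
  rw [det_mul, det_mul, H.det_eq, H'.det_eq, mul_one] at this
  exact IsUnit.of_mul_eq_one _ this

lemma J.inv_eq {H H' : Herm n} (U : J H H') : U.val⁻¹ * H'.mat * U.val⁻¹ᴴ = H.mat := by
  have h1 : U.val⁻¹ * U.val = 1 := nonsing_inv_mul _ U.isUnit
  have h2 : U.valᴴ * U.val⁻¹ᴴ = 1 := by rw [← conjTranspose_mul, h1, conjTranspose_one]
  rw [← U.eq]
  calc _ = (U.val⁻¹ * U.val) * H.mat * (U.valᴴ * U.val⁻¹ᴴ) := by simp only [Matrix.mul_assoc]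
    _ = _ := by rw [h1, h2]; simp

lemma J.mul_eq {H H' H'' : Herm n} (U : J H H') (V : J H' H'') :
    (V.val * U.val) * H.mat * (V.val * U.val)ᴴ = H''.mat := by
  rw [conjTranspose_mul, ← V.eq, ← U.eq]; simp only [Matrix.mul_assoc]

instance (H H' : Herm n) : Finite (J H H') := by
  have : {U : Matrix (Fin n) (Fin n) E | U * H.mat * Uᴴ = H'.mat}.Finite := by
    refine (Set.Finite.pi' fun i : Fin n =>
      H.pd.finite_q_le H.isUnit_det (q H'.mat (Pi.single i 1))).subset
      fun (U : Matrix (Fin n) (Fin n) E) hU i => ?_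
    change q H.mat (U i) ≤ _
    have hU : U * H.mat * Uᴴ = H'.mat := hU
    rw [← hU, ← q_mul, single_one_vecMul]
    exact le_rfl
  have := this.to_subtype
  exact Finite.of_injective
    (fun U : J H H' => (⟨U.val, U.eq⟩ : {U : Matrix (Fin n) (Fin n) E | U * H.mat * Uᴴ = H'.mat}))
    fun _ _ h => J.ext (congrArg Subtype.val h)

instance (H H' : Herm n) : Fintype (J H H') := Fintype.ofFinite _

/-- The inverse isometry. -/
def J.symm {H H' : Herm n} : J H H' ≃ J H' H where
  toFun U := ⟨U.val⁻¹, U.inv_eq⟩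
  invFun U := ⟨U.val⁻¹, U.inv_eq⟩
  left_inv U := J.ext (nonsing_inv_nonsing_inv _ U.isUnit)
  right_inv U := J.ext (nonsing_inv_nonsing_inv _ U.isUnit)

/-- Translation by an isometry. -/
def J.comp {H H' : Herm n} (U : J H H') (H'' : Herm n) : J H' H'' ≃ J H H'' where
  toFun V := ⟨V.val * U.val, U.mul_eq V⟩
  invFun V := ⟨V.val * U.val⁻¹, (J.symm U).mul_eq V⟩
  left_inv V := J.ext (mul_nonsing_inv_cancel_right _ _ U.isUnit)
  right_inv V := J.ext (nonsing_inv_mul_cancel_right _ _ U.isUnit)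

/-- The identity isometry. -/
def J.refl (H : Herm n) : J H H := ⟨1, by simp⟩

instance setoid (n : ℕ) : Setoid (Herm n) where
  r H H' := Nonempty (J H H')
  iseqv := ⟨fun H => ⟨J.refl H⟩, fun ⟨U⟩ => ⟨J.symm U⟩, fun ⟨U⟩ ⟨V⟩ => ⟨J.comp U _ V⟩⟩

/-- Transport of structure along a base change. -/
def conj (H : Herm n) (U : Matrix (Fin n) (Fin n) E) (hU : IsUnit U.det) : Herm n :=
  ⟨U * H.mat * Uᴴ, by rw [det_conj hU, H.det_eq], H.pd.mul_mul hU.ne_zero⟩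

end Herm

open Herm

/-- Isometry classes of unimodular lattices of rank `n`. -/
def Cls (n : ℕ) : Type := Quotient (Herm.setoid n)

instance (n : ℕ) : Finite (Cls n) := by
  obtain ⟨F, hF⟩ := exists_bounded_form n 1
  have hfin : {M : Matrix (Fin n) (Fin n) E | ∀ i j, nm (M i j) ≤ F}.Finite :=
    Set.Finite.pi' fun i => Set.Finite.pi' fun j => nm_finite F
  have := hfin.to_subtype
  let S := {H : Herm n // ∀ i j, nm (H.mat i j) ≤ F}
  have hS : Finite S := Finite.of_injective
    (fun H : S => (⟨H.1.mat, H.2⟩ : {M : Matrix (Fin n) (Fin n) E | ∀ i j, nm (M i j) ≤ F}))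
    (fun H H' h => Subtype.ext (Herm.ext' (congrArg Subtype.val h)))
  refine Finite.of_surjective (fun H : S => (Quotient.mk (Herm.setoid n) H.1 : Cls n)) fun c => ?_
  obtain ⟨H, rfl⟩ := Quotient.exists_rep c
  obtain ⟨U, hU, hUF⟩ := hF H.mat H.pd 1 (by simp [H.det_eq]) le_rfl
  exact ⟨⟨H.conj U hU, hUF⟩, (Quotient.sound (s := Herm.setoid n) ⟨⟨U, rfl⟩⟩).symm⟩

instance (n : ℕ) : Fintype (Cls n) := Fintype.ofFinite _

/-- A representative of an isometry class. -/
def Cls.rep {n : ℕ} (c : Cls n) : Herm n := Quotient.out c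

/-- The isometry class of a lattice. -/
def Herm.cls {n : ℕ} (H : Herm n) : Cls n := Quotient.mk _ H

lemma Cls.rep_cls {n : ℕ} (c : Cls n) : c.rep.cls = c := Quotient.out_eq c

lemma Herm.cls_eq {n : ℕ} {H H' : Herm n} : H.cls = H'.cls ↔ Nonempty (J H H') :=
  Quotient.eq (r := Herm.setoid n)

/-- The order of the automorphism group. -/
def aut {n : ℕ} (H : Herm n) : ℕ := Fintype.card (J H H)

lemma aut_pos {n : ℕ} (H : Herm n) : 0 < aut H := Fintype.card_pos_iff.2 ⟨J.refl H⟩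

lemma aut_ne_zero {n : ℕ} (H : Herm n) : (aut H : ℚ) ≠ 0 := by exact_mod_cast (aut_pos H).ne'

lemma card_J_eq_right {n : ℕ} {H H' : Herm n} (U : J H H') : Fintype.card (J H H') = aut H' :=
  (Fintype.card_congr (U.comp H')).symm

lemma card_J_symm {n : ℕ} (H H' : Herm n) : Fintype.card (J H H') = Fintype.card (J H' H) :=
  Fintype.card_congr J.symm

lemma sum_card_J {n : ℕ} (H : Herm n) :
    ∑ c : Cls n, (Fintype.card (J H c.rep) : ℚ) / aut c.rep = 1 := by
  rw [Finset.sum_eq_single H.cls]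
  · obtain ⟨U⟩ := Herm.cls_eq.1 (Cls.rep_cls H.cls).symm
    rw [card_J_eq_right U, div_self (aut_ne_zero _)]
  · intro c _ hc
    have : IsEmpty (J H c.rep) := by
      rw [← not_nonempty_iff, ← Herm.cls_eq, Cls.rep_cls]
      exact fun h => hc h.symm
    simp
  · simp

lemma sum_card_J' {n : ℕ} (H : Herm n) :
    ∑ c : Cls n, (Fintype.card (J c.rep H) : ℚ) / aut c.rep = 1 := by
  simp_rw [card_J_symm _ H]; exact sum_card_J H

/-- A weighted count over isometry classes, fibred over a finite set with torsors as fibres. -/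
lemma sum_fibration {n : ℕ} {V : Type*} [Fintype V] {I : Cls n → Type*} [∀ c, Fintype (I c)]
    (p : ∀ c, I c → V) (hp : ∀ v, ∃ H : Herm n, ∀ c, Nonempty ({b : I c // p c b = v} ≃ J H c.rep))
    (g : V → ℚ) :
    ∑ c : Cls n, (∑ b : I c, g (p c b)) / aut c.rep = ∑ v, g v := by
  classical
  have h1 : ∀ c : Cls n, (∑ b : I c, g (p c b)) / aut c.rep =
      ∑ v, g v * ((Fintype.card {b : I c // p c b = v} : ℚ) / aut c.rep) := by
    intro c
    rw [← Finset.sum_fiberwise (s := Finset.univ) (g := p c) (f := fun b => g (p c b)),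
      Finset.sum_div]
    refine Finset.sum_congr rfl fun v _ => ?_
    rw [Finset.sum_congr rfl (g := fun _ => g v) (by simp +contextual), Finset.sum_const,
      Fintype.card_subtype]
    simp; ring
  simp_rw [h1]
  rw [Finset.sum_comm]
  refine Finset.sum_congr rfl fun v _ => ?_
  obtain ⟨H, hH⟩ := hp v
  rw [← Finset.mul_sum]
  simp_rw [fun c => Fintype.card_congr (hH c).some]
  rw [sum_card_J, mul_one]

/-- Vectors of given norm. -/
abbrev Vec {n : ℕ} (H : Herm n) (m : ℤ) : Type := {x : Fin n → E // q H.mat x = m}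

instance {n : ℕ} (H : Herm n) (m : ℤ) : Finite (Vec H m) :=
  ((H.pd.finite_q_le H.isUnit_det m).subset fun _ h => le_of_eq h :
    {x | q H.mat x = m}.Finite).to_subtype

instance {n : ℕ} (H : Herm n) (m : ℤ) : Fintype (Vec H m) := Fintype.ofFinite _

/-- The representation numbers. -/
def rep {n : ℕ} (H : Herm n) (m : ℤ) : ℕ := Fintype.card (Vec H m)

/-- Transport of vectors along an isometry. -/
def Herm.J.vec {n : ℕ} {H H' : Herm n} (U : J H H') (m : ℤ) : Vec H' m ≃ Vec H m where
  toFun x := ⟨x.1 ᵥ* U.val, by rw [q_mul, U.eq]; exact x.2⟩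
  invFun x := ⟨x.1 ᵥ* U.val⁻¹, by rw [q_mul, U.inv_eq]; exact x.2⟩
  left_inv x := Subtype.ext (by
    simp only [vecMul_vecMul, mul_nonsing_inv _ U.isUnit, vecMul_one])
  right_inv x := Subtype.ext (by
    simp only [vecMul_vecMul, nonsing_inv_mul _ U.isUnit, vecMul_one])

lemma rep_congr {n : ℕ} {H H' : Herm n} (U : J H H') (m : ℤ) : rep H m = rep H' m :=
  (Fintype.card_congr (U.vec m)).symm

/-- The average of an isometry invariant. -/
def avg (n : ℕ) (f : Herm n → ℚ) : ℚ := ∑ c : Cls n, f c.rep / aut c.rep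

/-! ### Splitting off vectors of norm one -/

section OneSum
variable {n : ℕ}

/-- The block matrix `1 ⊕ A`. -/
def oneSum (A : Matrix (Fin n) (Fin n) E) : Matrix (Fin (n + 1)) (Fin (n + 1)) E :=
  Matrix.of (Fin.cons (Pi.single 0 1) fun i => Fin.cons 0 (A i))

@[simp] lemma oneSum_zero_zero (A : Matrix (Fin n) (Fin n) E) : oneSum A 0 0 = 1 := rfl
@[simp] lemma oneSum_zero_succ (A : Matrix (Fin n) (Fin n) E) (j : Fin n) :
    oneSum A 0 j.succ = 0 := by simp [oneSum]
@[simp] lemma oneSum_succ_zero (A : Matrix (Fin n) (Fin n) E) (i : Fin n) :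
    oneSum A i.succ 0 = 0 := rfl
@[simp] lemma oneSum_succ_succ (A : Matrix (Fin n) (Fin n) E) (i j : Fin n) :
    oneSum A i.succ j.succ = A i j := rfl

lemma eq_oneSum {M : Matrix (Fin (n + 1)) (Fin (n + 1)) E} (h00 : M 0 0 = 1)
    (h0 : ∀ j : Fin n, M 0 j.succ = 0) (h1 : ∀ i : Fin n, M i.succ 0 = 0) :
    M = oneSum (M.submatrix Fin.succ Fin.succ) :=
  Matrix.ext fun i j => by
    refine Fin.cases ?_ (fun i => ?_) i <;> refine Fin.cases ?_ (fun j => ?_) j <;>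
      simp [h00, h0, h1]

lemma oneSum_injective : Function.Injective (oneSum (n := n)) := fun A B hAB =>
  Matrix.ext fun i j => by simpa using congrFun (congrFun hAB i.succ) j.succ

lemma oneSum_mul (A B : Matrix (Fin n) (Fin n) E) : oneSum A * oneSum B = oneSum (A * B) :=
  Matrix.ext fun i j => by
    refine Fin.cases ?_ (fun i => ?_) i <;> refine Fin.cases ?_ (fun j => ?_) j <;>
      simp [Matrix.mul_apply, Fin.sum_univ_succ]

lemma oneSum_conjTranspose (A : Matrix (Fin n) (Fin n) E) : (oneSum A)ᴴ = oneSum Aᴴ :=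
  Matrix.ext fun i j => by
    refine Fin.cases ?_ (fun i => ?_) i <;> refine Fin.cases ?_ (fun j => ?_) j <;>
      simp [Matrix.conjTranspose_apply]

lemma det_oneSum (A : Matrix (Fin n) (Fin n) E) : (oneSum A).det = A.det := by
  rw [det_succ_row_zero, Fin.sum_univ_succ]
  simp
  rfl

lemma h_oneSum (A : Matrix (Fin n) (Fin n) E) (a b : E) (x y : Fin n → E) :
    h (oneSum A) (Fin.cons a x) (Fin.cons b y) = a * star b + h A x y := by
  simp [h, dotProduct, mulVec, Fin.sum_univ_succ]

lemma q_oneSum (A : Matrix (Fin n) (Fin n) E) (a : E) (x : Fin n → E) :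
    q (oneSum A) (Fin.cons a x) = nm a + q A x := by
  rw [q, h_oneSum, mul_star_eq, QuadraticAlgebra.re_add]
  simp [q]

lemma PD_oneSum {A : Matrix (Fin n) (Fin n) E} (hA : PD A) : PD (oneSum A) := by
  refine Matrix.PosDef.of_dotProduct_mulVec_pos ?_ fun x hx => ?_
  · have := map_φ_conjTranspose (oneSum A)
    rw [oneSum_conjTranspose, hA.isHermitian.eq] at this
    exact this.symm
  · have h1 : star x ⬝ᵥ (oneSum A).map φ *ᵥ x = star (x 0) * x 0 +
        star (Fin.tail x) ⬝ᵥ A.map φ *ᵥ (Fin.tail x) := by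
      simp [dotProduct, mulVec, Fin.sum_univ_succ, Fin.tail]
    rw [h1]
    by_cases hx0 : Fin.tail x = 0
    · rw [hx0]
      have : x 0 ≠ 0 := by
        intro h0
        refine hx (funext fun i => Fin.cases h0 (fun i => congrFun hx0 i) i)
      simpa using star_mul_self_pos (isRegular_iff_ne_zero.2 this)
    · exact add_pos_of_nonneg_of_pos (star_mul_self_nonneg _) (hA.dotProduct_mulVec_pos hx0)

lemma PD_submatrix_succ {H : Matrix (Fin (n + 1)) (Fin (n + 1)) E} (hH : PD H) :
    PD (H.submatrix Fin.succ Fin.succ) :=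
  Matrix.PosDef.submatrix (M := H.map φ) hH (Fin.succ_injective n)

end OneSum

namespace Herm
variable {n : ℕ}

/-- The orthogonal sum of a lattice with the lattice of rank one. -/
def ext1 (K : Herm n) : Herm (n + 1) := ⟨oneSum K.mat, by rw [det_oneSum, K.det_eq], PD_oneSum K.pd⟩

lemma ext1_mat (K : Herm n) : K.ext1.mat = oneSum K.mat := rfl

lemma exists_ext1 (H : Herm (n + 1)) (v : Vec H 1) :
    ∃ (K : Herm n) (U : J H K.ext1), U.val 0 = v.1 := by
  let f : (Fin (n + 1) → E) →ₗ[E] E :=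
    { toFun := fun x => h H.mat x v.1
      map_add' := fun x y => h_add_left _ _ _ _
      map_smul' := fun a x => h_smul_left _ _ _ _ }
  have hf : f v.1 = 1 := by
    change h H.mat v.1 v.1 = 1
    rw [h_self H.isHermitian, v.2]; simp
  obtain ⟨U, hU, hU0, hUs⟩ := exists_matrix_of_functional v.1 f hf
  have hM := (H.conj U hU).isHermitian
  have h00 : (H.conj U hU).mat 0 0 = 1 := by
    change (U * H.mat * Uᴴ) 0 0 = 1
    rw [← h_row, hU0]; exact hf
  have h1 : ∀ i : Fin n, (H.conj U hU).mat i.succ 0 = 0 := by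
    intro i
    change (U * H.mat * Uᴴ) i.succ 0 = 0
    rw [← h_row, hU0]; exact hUs i
  have h2 : ∀ i : Fin n, (H.conj U hU).mat 0 i.succ = 0 := by
    intro i
    rw [← hM.apply, h1, star_zero]
  have h3 := eq_oneSum h00 h2 h1
  refine ⟨⟨(H.conj U hU).mat.submatrix Fin.succ Fin.succ, ?_, PD_submatrix_succ (H.conj U hU).pd⟩,
    ⟨U, h3⟩, hU0⟩
  rw [← det_oneSum, ← h3, (H.conj U hU).det_eq]

/-- The first basis vector of the image of an isometry onto `1 ⊕ K`. -/
def firstVec {H : Herm (n + 1)} {K : Herm n} (U : J H K.ext1) : Vec H 1 :=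
  ⟨U.val 0, by
    have := h_row H.mat U.val 0 0
    rw [U.eq, ext1_mat, oneSum_zero_zero] at this
    rw [q, this]; rfl⟩

/-- Isometries fixing the first basis vector. -/
def ext1Equiv (K K' : Herm n) :
    J K K' ≃ {W : J K.ext1 K'.ext1 // W.val 0 = Pi.single 0 1} :=
  Equiv.ofBijective
    (fun U => ⟨⟨oneSum U.val, by
      rw [ext1_mat, ext1_mat, oneSum_conjTranspose, oneSum_mul, oneSum_mul, U.eq]⟩, rfl⟩) <| by
    refine ⟨fun U V hUV => J.ext (oneSum_injective (congrArg (fun W => W.1.val) hUV)), ?_⟩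
    rintro ⟨W, hW⟩
    have h00 : W.val 0 0 = 1 := by rw [hW]; simp
    have h0 : ∀ j : Fin n, W.val 0 j.succ = 0 := fun j => by rw [hW]; simp
    have h1 : ∀ i : Fin n, W.val i.succ 0 = 0 := fun i => by
      have := h_row K.ext1.mat W.val i.succ 0
      rw [W.eq, hW, h_single_right, ext1_mat, ext1_mat, oneSum_succ_zero] at this
      simpa [vecMul, dotProduct, Fin.sum_univ_succ] using this
    have h3 := eq_oneSum h00 h0 h1
    have h4 := W.eq
    rw [h3, ext1_mat, ext1_mat, oneSum_conjTranspose, oneSum_mul, oneSum_mul] at h4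
    exact ⟨⟨_, oneSum_injective h4⟩, Subtype.ext (J.ext h3.symm)⟩

lemma firstVec_fibre (H : Herm (n + 1)) (v : Vec H 1) : ∃ K : Herm n, ∀ K' : Herm n,
    Nonempty ({U : J H K'.ext1 // firstVec U = v} ≃ J K K') := by
  obtain ⟨K, U, hU⟩ := H.exists_ext1 v
  refine ⟨K, fun K' => ⟨(Equiv.subtypeEquiv (U.comp K'.ext1) fun W => ?_).symm.trans
    (ext1Equiv K K').symm⟩⟩
  have he : firstVec (U.comp K'.ext1 W) = v ↔ (W.val * U.val) 0 = v.1 := Subtype.ext_iff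
  rw [he]
  have hinj : Function.Injective fun x => x ᵥ* U.val :=
    Matrix.vecMul_injective_of_isUnit ((Matrix.isUnit_iff_isUnit_det _).2 U.isUnit)
  rw [← hinj.eq_iff]
  have h1 : (Pi.single 0 1 : Fin (n + 1) → E) ᵥ* U.val = v.1 := by rw [single_one_vecMul, ← hU]; rfl
  have h2 : W.val 0 ᵥ* U.val = (W.val * U.val) 0 := rfl
  simp only [h1, h2]

end Herm

open Herm

lemma sum_card_J_ext1 {n : ℕ} (H : Herm (n + 1)) :
    ∑ c : Cls n, (Fintype.card (J H c.rep.ext1) : ℚ) / aut c.rep = rep H 1 := by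
  have := sum_fibration (n := n) (V := Vec H 1) (I := fun c => J H c.rep.ext1)
    (fun c U => firstVec U) (fun v => (firstVec_fibre H v).imp fun K hK c => hK c.rep) (fun _ => 1)
  simpa [rep] using this

lemma sum_mul_card_J {n : ℕ} {f : Herm n → ℚ} (hf : ∀ H H' : Herm n, Nonempty (J H H') → f H = f H')
    (K : Herm n) : ∑ c : Cls n, f c.rep * Fintype.card (J c.rep K) / aut c.rep = f K := by
  have h1 := congrArg (f K * ·) (sum_card_J' K)
  simp only [mul_one, Finset.mul_sum] at h1
  rw [← h1]
  refine Finset.sum_congr rfl fun c _ => ?_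
  by_cases h : Nonempty (J c.rep K)
  · rw [hf _ _ h, mul_div_assoc]
  · have := not_nonempty_iff.1 h
    simp

lemma avg_mul_rep_one {n : ℕ} {f : Herm (n + 1) → ℚ}
    (hf : ∀ H H' : Herm (n + 1), Nonempty (J H H') → f H = f H') :
    avg (n + 1) (fun H => f H * rep H 1) = avg n (fun K => f K.ext1) := by
  have h1 : ∀ c : Cls (n + 1), c.rep.cls = c := Cls.rep_cls
  have h2 : ∀ K : Herm n, f K.ext1 / aut K =
      ∑ c : Cls (n + 1), f c.rep * Fintype.card (J c.rep K.ext1) / aut c.rep / aut K := by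
    intro K
    rw [← Finset.sum_div, sum_mul_card_J hf]
  have h3 : ∀ H : Herm (n + 1), f H * rep H 1 / aut H =
      ∑ c : Cls n, f H * ((Fintype.card (J H c.rep.ext1) : ℚ) / aut c.rep) / aut H := by
    intro H
    rw [← Finset.sum_div, ← Finset.mul_sum, sum_card_J_ext1]
  simp only [avg, h2, h3]
  rw [Finset.sum_comm]
  refine Finset.sum_congr rfl fun c _ => Finset.sum_congr rfl fun d _ => ?_
  ring

lemma card_units : Nat.card {z : E // nm z = 1} = 6 := by
  have h1 : {z : E | nm z = 1} =
      (({⟨1, 0⟩, ⟨-1, 0⟩, ⟨0, 1⟩, ⟨0, -1⟩, ⟨1, 1⟩, ⟨-1, -1⟩} : Finset E) : Set E) := by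
    ext ⟨a, b⟩
    simp only [Set.mem_ofPred_eq, nm_eq, Finset.coe_insert, Finset.coe_singleton,
      Set.mem_insert_iff, Set.mem_singleton_iff, QuadraticAlgebra.mk.injEq]
    constructor
    · intro hab
      have ha : -1 ≤ a ∧ a ≤ 1 := by
        constructor <;> nlinarith [sq_nonneg (2 * b - a)]
      have hb : -1 ≤ b ∧ b ≤ 1 := by
        constructor <;> nlinarith [sq_nonneg (2 * a - b)]
      obtain ⟨ha1, ha2⟩ := ha
      obtain ⟨hb1, hb2⟩ := hb
      interval_cases a <;> interval_cases b <;> simp_all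
    · rintro (⟨rfl, rfl⟩ | ⟨rfl, rfl⟩ | ⟨rfl, rfl⟩ | ⟨rfl, rfl⟩ | ⟨rfl, rfl⟩ | ⟨rfl, rfl⟩) <;>
        norm_num
  change Nat.card ({z : E | nm z = 1} : Set E) = 6
  rw [h1, Nat.card_coe_set_eq, Set.ncard_coe_finset]
  decide

lemma rep_ext1 {n : ℕ} (K : Herm n) : rep K.ext1 1 = 6 + rep K 1 := by
  have key : ∀ (a : E) (x : Fin n → E), q K.ext1.mat (Fin.cons a x) = nm a + q K.mat x := q_oneSum _
  let F : {z : E // nm z = 1} ⊕ Vec K 1 → Vec K.ext1 1 := Sum.elim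
    (fun z => ⟨Fin.cons z.1 0, by rw [key, z.2, q_zero]; rfl⟩)
    (fun x => ⟨Fin.cons 0 x.1, by rw [key, x.2, nm_eq]; simp⟩)
  have hF : Function.Bijective F := by
    constructor
    · rintro (⟨z, hz⟩ | ⟨x, hx⟩) (⟨z', hz'⟩ | ⟨x', hx'⟩) h0 <;>
        have h1 := congrArg Subtype.val h0 <;>
        simp only [F, Sum.elim_inl, Sum.elim_inr, Fin.cons_inj] at h1
      · simp [h1.1]
      · rw [h1.1] at hz; simp at hz
      · rw [← h1.1] at hz'; simp at hz'
      · simp [h1.2]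
    · rintro ⟨y, hy⟩
      have h1 : y = Fin.cons (y 0) (Fin.tail y) := (Fin.cons_self_tail y).symm
      have h2 := hy
      rw [h1, key] at h2
      have h3 := nm_nonneg (y 0)
      have h4 := K.pd.q_nonneg (Fin.tail y)
      by_cases h5 : nm (y 0) = 0
      · refine ⟨Sum.inr ⟨Fin.tail y, by omega⟩, Subtype.ext ?_⟩
        change Fin.cons 0 (Fin.tail y) = y
        rw [← nm_eq_zero.1 h5, Fin.cons_self_tail]
      · have h6 : q K.mat (Fin.tail y) = 0 := by omega
        have h7 : Fin.tail y = 0 := by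
          by_contra h8
          exact (K.pd.q_pos h8).ne' h6
        refine ⟨Sum.inl ⟨y 0, by omega⟩, Subtype.ext ?_⟩
        change Fin.cons (y 0) 0 = y
        rw [← h7, Fin.cons_self_tail]
  have h1 := Nat.card_congr (Equiv.ofBijective F hF)
  have : Finite {z : E // nm z = 1} := Nat.finite_of_card_ne_zero (by rw [card_units]; norm_num)
  rw [Nat.card_sum, card_units] at h1
  simpa [rep] using h1.symm

lemma exists_rep_one_eq {n : ℕ} (H : Herm n) : ∃ k ≤ n, rep H 1 = 6 * k := by
  induction n with
  | zero =>
    refine ⟨0, le_rfl, Fintype.card_eq_zero_iff.2 ⟨fun x => ?_⟩⟩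
    have := x.2
    rw [Subsingleton.elim x.1 0, q_zero] at this
    omega
  | succ n ih =>
    by_cases h : Nonempty (Vec H 1)
    · obtain ⟨K, U, -⟩ := H.exists_ext1 h.some
      obtain ⟨k, hk, hk'⟩ := ih K
      exact ⟨k + 1, by omega, by rw [rep_congr U, rep_ext1, hk']; ring⟩
    · exact ⟨0, by omega, Fintype.card_eq_zero_iff.2 (not_nonempty_iff.1 h)⟩

lemma avg_prod {n : ℕ} (j : ℕ) (hj : j ≤ n) :
    avg n (fun H => ∏ i ∈ Finset.range j, ((rep H 1 : ℚ) - 6 * i)) = avg (n - j) fun _ => 1 := by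
  induction j generalizing n with
  | zero => simp
  | succ j ih =>
    obtain ⟨n, rfl⟩ : ∃ m, n = m + 1 := ⟨n - 1, by omega⟩
    rw [Nat.add_sub_add_right, ← ih (by omega)]
    have h1 := avg_mul_rep_one (n := n)
      (f := fun H => ∏ i ∈ Finset.range j, ((rep H 1 : ℚ) - 6 * (i + 1 : ℕ)))
      (fun H H' ⟨U⟩ => by rw [rep_congr U])
    simp only [rep_ext1] at h1
    convert h1 using 2
    · funext H; rw [Finset.prod_range_succ']; simp
    · funext H; refine Finset.prod_congr rfl fun i _ => ?_; push_cast; ring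

/-- The mass of the classes without vectors of norm one. -/
lemma avg_no_norm_one (n : ℕ) :
    avg n (fun H => if rep H 1 = 0 then 1 else 0) =
      ∑ j ∈ Finset.range (n + 1), (-1) ^ j / (6 ^ j * j.factorial) * avg (n - j) fun _ => 1 := by
  have h1 : ∀ H : Herm n, (if rep H 1 = 0 then (1 : ℚ) else 0) =
      ∑ j ∈ Finset.range (n + 1), (-1) ^ j / (6 ^ j * j.factorial) *
        ∏ i ∈ Finset.range j, ((rep H 1 : ℚ) - 6 * i) := by
    intro H
    obtain ⟨k, hk, hr⟩ := exists_rep_one_eq H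
    have h2 : ∀ j : ℕ, ∏ i ∈ Finset.range j, ((rep H 1 : ℚ) - 6 * i) =
        6 ^ j * j.factorial * k.choose j := by
      intro j
      have h3 : ∏ i ∈ Finset.range j, ((k : ℚ) - i) = j.factorial * k.choose j := by
        rw [← Nat.cast_mul, ← Nat.descFactorial_eq_factorial_mul_choose,
          ← descPochhammer_eval_eq_prod_range,
          descPochhammer_eval_eq_descFactorial]
      rw [mul_assoc, ← h3, hr, ← Finset.card_range j, ← Finset.prod_const, Finset.card_range,
        ← Finset.prod_mul_distrib]
      refine Finset.prod_congr rfl fun i _ => ?_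
      push_cast; ring
    have h4 := Int.alternating_sum_range_choose (n := k)
    rw [Finset.sum_subset (Finset.range_mono (Nat.succ_le_succ hk)) (fun j _ hj => by
      rw [Nat.choose_eq_zero_of_lt (by simpa using hj)]; simp)] at h4
    have h5 : (rep H 1 = 0) = (k = 0) := by rw [hr]; simp
    simp only [h5, h2]
    have h6 := congrArg (Int.cast : ℤ → ℚ) h4
    push_cast at h6
    rw [← h6]
    refine Finset.sum_congr rfl fun j _ => ?_
    have : ((j.factorial : ℕ) : ℚ) ≠ 0 := by exact_mod_cast j.factorial_ne_zero
    field_simp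
  simp only [avg, h1, Finset.sum_div]
  rw [Finset.sum_comm]
  refine Finset.sum_congr rfl fun j hj => ?_
  have := avg_prod (n := n) j (by simpa [Nat.lt_succ_iff] using hj)
  simp only [avg] at this
  rw [← this, Finset.mul_sum]
  refine Finset.sum_congr rfl fun c _ => ?_
  ring

/-! ### Counting isotropic vectors over the field with three elements -/

/-- The standard additive character of `𝔽₃`. -/
def χ : AddChar (ZMod 3) E where
  toFun a := if a = 0 then 1 else if a = 1 then ⟨0, 1⟩ else ⟨-1, -1⟩
  map_zero_eq_one' := by decide
  map_add_eq_mul' := by decide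

lemma one_add_χ (a : ZMod 3) : 1 + χ a + star (χ a) = if a = 0 then 3 else 0 := by
  revert a; decide

lemma sum_χ_mul_sq (d : ZMod 3) (hd : d ≠ 0) :
    ∑ a : ZMod 3, χ (d * a ^ 2) = if d = 1 then θ else -θ := by
  revert d; decide

section Form
variable {n : ℕ} {M : Matrix (Fin n) (Fin n) (ZMod 3)}

lemma card_filter_eq {ι : Type*} [Fintype ι] (p : ι → Prop) [DecidablePred p] (f : ι → ZMod 3) :
    (3 : E) * (Finset.univ.filter fun y => p y ∧ f y = 0).card =
      (Finset.univ.filter p).card + ∑ y with p y, χ (f y) + star (∑ y with p y, χ (f y)) := by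
  rw [← Finset.filter_filter, Finset.card_filter, Finset.card_eq_sum_ones, star_sum, Nat.cast_sum,
    Nat.cast_sum, ← Finset.sum_add_distrib, ← Finset.sum_add_distrib, Finset.mul_sum]
  refine Finset.sum_congr rfl fun y _ => ?_
  have := one_add_χ (f y)
  simp only [Nat.cast_one, this]
  split_ifs <;> simp

/-- The Gauss sum of a diagonal form. -/
lemma sum_χ_diagonal (d : Fin n → ZMod 3) (hd : ∏ i, d i = 1) :
    ∑ y : Fin n → ZMod 3, χ (∑ i, d i * y i ^ 2) = θ ^ n := by
  have h0 : ∀ i, d i ≠ 0 := fun i hi => by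
    rw [Finset.prod_eq_zero (Finset.mem_univ i) hi] at hd; exact absurd hd (by decide)
  have hχ : ∀ y : Fin n → ZMod 3, χ (∑ i, d i * y i ^ 2) = ∏ i, χ (d i * y i ^ 2) := by
    intro y
    induction (Finset.univ : Finset (Fin n)) using Finset.cons_induction with
    | empty => simp
    | cons i s hi ih => rw [Finset.sum_cons, Finset.prod_cons, AddChar.map_add_eq_mul, ih]
  simp_rw [hχ]
  rw [← Fintype.piFinset_univ, ← Finset.prod_univ_sum (f := fun i a => χ (d i * a ^ 2))]
  have h1 : ∀ a : ZMod 3, a ≠ 0 → (if a = 1 then θ else -θ) = θ * (a.valMinAbs : E) := by decide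
  have h2 : ∀ a b : ZMod 3, (a * b).valMinAbs = a.valMinAbs * b.valMinAbs := by decide
  have h3 : ∀ s : Finset (Fin n), (∏ i ∈ s, d i).valMinAbs = ∏ i ∈ s, (d i).valMinAbs := by
    intro s
    induction s using Finset.cons_induction with
    | empty => rw [Finset.prod_empty, Finset.prod_empty]; decide
    | cons i s hi ih => rw [Finset.prod_cons, Finset.prod_cons, h2, ih]
  rw [Finset.prod_congr rfl fun i _ => (sum_χ_mul_sq (d i) (h0 i)).trans (h1 _ (h0 i)),
    Finset.prod_mul_distrib, ← Int.cast_prod, ← h3, hd]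
  have : (1 : ZMod 3).valMinAbs = 1 := by decide
  simp [this]

lemma exists_diagonal (hM : Mᵀ = M) (hdet : M.det = 1) :
    ∃ (P : Matrix (Fin n) (Fin n) (ZMod 3)) (d : Fin n → ZMod 3), IsUnit P.det ∧
      P * M * Pᵀ = diagonal d ∧ ∏ i, d i = 1 := by
  have : Invertible (2 : ZMod 3) := ⟨2, by decide, by decide⟩
  obtain ⟨v, hv⟩ := LinearMap.BilinForm.exists_orthogonal_basis
    (B := Matrix.toBilin' M) ⟨fun x y => by
      simp only [toBilin'_apply', RingHom.id_apply]
      rw [← hM, dotProduct_mulVec, vecMul_transpose, hM, dotProduct_comm]⟩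
  have hfr : Module.finrank (ZMod 3) (Fin n → ZMod 3) = n := by simp
  let w := v.reindex (finCongr hfr)
  let P : Matrix (Fin n) (Fin n) (ZMod 3) := Matrix.of fun i => w i
  have hP : IsUnit P := by
    rw [← Matrix.linearIndependent_rows_iff_isUnit]
    exact w.linearIndependent
  have hPd := (Matrix.isUnit_iff_isUnit_det _).1 hP
  have hD : P * M * Pᵀ = diagonal fun i => (P * M * Pᵀ) i i := by
    ext i j
    by_cases hij : i = j
    · subst hij; simp
    · rw [diagonal_apply_ne _ hij]
      have h1 := hv (fun h => hij ((finCongr hfr).symm.injective h) :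
        (finCongr hfr).symm i ≠ (finCongr hfr).symm j)
      have h2 : Matrix.toBilin' M (w i) (w j) = 0 := by
        simpa [w, Module.Basis.reindex_apply] using h1
      rw [toBilin'_apply', dotProduct_mulVec] at h2
      exact h2
  refine ⟨P, _, hPd, hD, ?_⟩
  have h1 := congrArg Matrix.det hD
  rw [det_diagonal, det_mul, det_mul, hdet, det_transpose, mul_one] at h1
  rw [← h1]
  have : ∀ a : ZMod 3, a ≠ 0 → a * a = 1 := by decide
  exact this _ hPd.ne_zero

/-- The Gauss sum of a form of determinant one. -/
lemma gauss_sum (hM : Mᵀ = M) (hdet : M.det = 1) :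
    ∑ y : Fin n → ZMod 3, χ (y ⬝ᵥ M *ᵥ y) = θ ^ n := by
  obtain ⟨P, d, hP, hD, hd⟩ := exists_diagonal hM hdet
  rw [← sum_χ_diagonal d hd]
  have hbij : Function.Bijective fun y : Fin n → ZMod 3 => y ᵥ* P :=
    Finite.injective_iff_bijective.1
      (Matrix.vecMul_injective_of_isUnit ((Matrix.isUnit_iff_isUnit_det _).2 hP))
  rw [← hbij.sum_comp]
  refine Finset.sum_congr rfl fun y _ => congrArg χ ?_
  rw [dotProduct_mulVec, vecMul_vecMul, ← mulVec_transpose P, dotProduct_mulVec, vecMul_vecMul, hD,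
    dotProduct]
  refine Finset.sum_congr rfl fun i _ => by rw [vecMul_diagonal]; ring

lemma card_isotropic (hM : Mᵀ = M) (hdet : M.det = 1) :
    (3 : E) * (Finset.univ.filter fun y : Fin n → ZMod 3 => y ⬝ᵥ M *ᵥ y = 0).card =
      3 ^ n + θ ^ n + (-θ) ^ n := by
  have := card_filter_eq (fun _ : Fin n → ZMod 3 => True) (fun y => y ⬝ᵥ M *ᵥ y)
  simp only [true_and, Finset.filter_true, gauss_sum hM hdet, star_pow, star_θ] at this
  rw [this]
  simp

lemma sum_perp {R : Type*} [CommRing R] (x : Fin n → ZMod 3) (m : ZMod 3) (hx : x ⬝ᵥ M *ᵥ x = m)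
    (hm : m ≠ 0) (f : (Fin n → ZMod 3) → R) :
    ∑ y, f y = ∑ a : ZMod 3, ∑ y with x ⬝ᵥ M *ᵥ y = 0, f (a • x + y) := by
  have hmm : m * m = 1 := by clear hx; revert m; decide
  rw [← Finset.sum_fiberwise (s := Finset.univ) (g := fun y => m * (x ⬝ᵥ M *ᵥ y))]
  refine Finset.sum_congr rfl fun a _ => ?_
  refine Finset.sum_bij' (fun y _ => y - a • x) (fun y _ => a • x + y) ?_ ?_ ?_ ?_ ?_
  · simp only [Finset.mem_filter, Finset.mem_univ, true_and]
    rintro y rfl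
    rw [mulVec_sub, mulVec_smul, dotProduct_sub, dotProduct_smul, hx, smul_eq_mul]
    linear_combination (-(x ⬝ᵥ M *ᵥ y)) * hmm
  · simp only [Finset.mem_filter, Finset.mem_univ, true_and]
    intro y hy
    rw [mulVec_add, mulVec_smul, dotProduct_add, dotProduct_smul, hx, hy, smul_eq_mul]
    linear_combination a * hmm
  · intros; simp
  · intros; simp
  · intros; simp

lemma card_isotropic_perp (hM : Mᵀ = M) (hdet : M.det = 1) (x : Fin n → ZMod 3) (m : ZMod 3)
    (hx : x ⬝ᵥ M *ᵥ x = m) (hm : m ≠ 0) :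
    (9 : E) * (Finset.univ.filter fun y : Fin n → ZMod 3 =>
        x ⬝ᵥ M *ᵥ y = 0 ∧ y ⬝ᵥ M *ᵥ y = 0).card =
      3 ^ n + if m = 1 then -(θ ^ (n + 1) + (-θ) ^ (n + 1)) else θ ^ (n + 1) + (-θ) ^ (n + 1) := by
  have h1 := card_filter_eq (fun y : Fin n → ZMod 3 => x ⬝ᵥ M *ᵥ y = 0) (fun y => y ⬝ᵥ M *ᵥ y)
  set S := ∑ y with x ⬝ᵥ M *ᵥ y = 0, χ (y ⬝ᵥ M *ᵥ y)
  have h2 := sum_perp x m hx hm (fun _ => (1 : E))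
  have h3 := sum_perp x m hx hm (fun y => χ (y ⬝ᵥ M *ᵥ y))
  have h4 : ∀ a : ZMod 3, ∀ y, x ⬝ᵥ M *ᵥ y = 0 →
      (a • x + y) ⬝ᵥ M *ᵥ (a • x + y) = m * a ^ 2 + y ⬝ᵥ M *ᵥ y := by
    intro a y hy
    have hy' : y ⬝ᵥ M *ᵥ x = 0 := by
      rw [← hM, dotProduct_mulVec, vecMul_transpose, dotProduct_comm, hy]
    simp only [mulVec_add, mulVec_smul, dotProduct_add, add_dotProduct, dotProduct_smul,
      smul_dotProduct, hx, hy, hy', smul_eq_mul]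
    ring
  have h5 : ∀ a : ZMod 3, ∑ y with x ⬝ᵥ M *ᵥ y = 0, χ ((a • x + y) ⬝ᵥ M *ᵥ (a • x + y)) =
      χ (m * a ^ 2) * S := by
    intro a
    rw [Finset.mul_sum]
    refine Finset.sum_congr rfl fun y hy => ?_
    rw [h4 a y (by simpa using hy), AddChar.map_add_eq_mul]
  simp only [h5, ← Finset.sum_mul, sum_χ_mul_sq m hm, gauss_sum hM hdet] at h3
  simp only [Finset.sum_const, Finset.card_univ, nsmul_eq_mul, mul_one, Fintype.card_pi, ZMod.card,
    Finset.prod_const, Fintype.card_fin] at h2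
  have h6 : star S * star (if m = 1 then θ else -θ) = (-θ) ^ n := by
    rw [mul_comm, ← star_mul', ← h3, star_pow, star_θ]
  push_cast at h2
  have hθ := θ_mul_θ
  split_ifs at * with h
  · rw [star_θ] at h6
    rw [pow_succ, pow_succ, h3, ← h6, h2]
    linear_combination 3 * h1 + (S + star S) * hθ
  · rw [star_neg, star_θ, neg_neg] at h6
    rw [pow_succ, pow_succ, h3, ← h6, h2]
    linear_combination 3 * h1 + (S + star S) * hθ

end Form

/-! ### Neighbours at the prime `θ` -/

section Reduction
variable {n : ℕ}

/-- Reduction of vectors modulo `θ`. -/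
def red (x : Fin n → E) : Fin n → ZMod 3 := fun i => π (x i)

/-- Lifting of vectors over `𝔽₃`. -/
def lft (y : Fin n → ZMod 3) : Fin n → E := fun i => lift3 (y i)

@[simp] lemma red_lft (y : Fin n → ZMod 3) : red (lft y) = y := funext fun i => π_lift3 (y i)

lemma red_add (x y : Fin n → E) : red (x + y) = red x + red y := funext fun _ => map_add π _ _
lemma red_sub (x y : Fin n → E) : red (x - y) = red x - red y := funext fun _ => map_sub π _ _
lemma red_smul (a : E) (x : Fin n → E) : red (a • x) = π a • red x := funext fun _ => map_mul π _ _
lemma red_smul_θ (x : Fin n → E) : red (θ • x) = 0 := by rw [red_smul, π_θ, zero_smul]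

lemma red_eq_zero_iff {x : Fin n → E} : red x = 0 ↔ ∃ v, x = θ • v := by
  constructor
  · intro hx
    choose v hv using fun i => π_eq_zero_iff.1 (congrFun hx i)
    exact ⟨v, funext hv⟩
  · rintro ⟨v, rfl⟩
    exact red_smul_θ v

lemma π_h (H : Matrix (Fin n) (Fin n) E) (x y : Fin n → E) :
    π (h H x y) = red x ⬝ᵥ H.map π *ᵥ red y := by
  simp only [h, dotProduct, mulVec, map_sum, map_mul, red, map_apply, Pi.star_apply, π_star]

lemma smul_θ_injective : Function.Injective fun x : Fin n → E => θ • x := fun _ _ hxy =>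
  funext fun i => mul_left_cancel₀ θ_ne_zero (congrFun hxy i)

lemma q_smul_θ {H : Matrix (Fin n) (Fin n) E} (hH : H.IsHermitian) (x : Fin n → E) :
    q H (θ • x) = 3 * q H x := by
  rw [q_smul hH]; rfl

end Reduction

namespace Herm
variable {n : ℕ} (H : Herm n)

/-- The reduction of the form modulo `θ`. -/
def bar : Matrix (Fin n) (Fin n) (ZMod 3) := H.mat.map π

lemma π_h (x y : Fin n → E) : π (h H.mat x y) = red x ⬝ᵥ H.bar *ᵥ red y := EisLat.π_h _ x y

lemma bar_transpose : H.barᵀ = H.bar := by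
  ext i j
  change π (H.mat j i) = π (H.mat i j)
  rw [← H.isHermitian.apply, π_star]

lemma det_bar : H.bar.det = 1 := by
  have : H.bar.det = π H.mat.det := (RingHom.map_det π H.mat).symm
  rw [this, H.det_eq, map_one]

lemma π_q (x : Fin n → E) : ((q H.mat x : ℤ) : ZMod 3) = red x ⬝ᵥ H.bar *ᵥ red x := by
  rw [← H.π_h, h_self H.isHermitian, π_int]

lemma π_h_comm (x y : Fin n → E) : π (h H.mat x y) = π (h H.mat y x) := by
  rw [← star_h H.isHermitian, π_star]

lemma exists_h_eq (j : Fin n) : ∃ w, ∀ x, h H.mat w x = star (x j) := by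
  refine ⟨Pi.single j 1 ᵥ* H.mat⁻¹, fun x => ?_⟩
  rw [h_eq_vecMul, vecMul_vecMul, nonsing_inv_mul _ H.isUnit_det, vecMul_one]
  simp

lemma red_eq_zero_of_π_h {x : Fin n → E} (hx : ∀ v, π (h H.mat v x) = 0) : red x = 0 := by
  funext j
  obtain ⟨w, hw⟩ := H.exists_h_eq j
  have := hx w
  rwa [hw, π_star] at this

lemma exists_π_h_eq_one {x : Fin n → E} (hx : red x ≠ 0) : ∃ w, π (h H.mat w x) = 1 := by
  by_contra hcon
  refine hx (H.red_eq_zero_of_π_h fun v => ?_)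
  by_contra h0
  refine hcon ⟨lift3 (π (h H.mat v x)) • v, ?_⟩
  rw [h_smul_left, map_mul, π_lift3]
  generalize π (h H.mat v x) = a at h0
  revert a; decide

/-- The nonzero isotropic vectors modulo `θ`. -/
abbrev Iso : Type := {y : Fin n → ZMod 3 // y ≠ 0 ∧ y ⬝ᵥ H.bar *ᵥ y = 0}

variable {H}

lemma Iso.π_h (y : H.Iso) : EisLat.π (h H.mat (lft y.1) (lft y.1)) = 0 := by
  rw [H.π_h, red_lft, y.2.2]

/-- The (rescaled) neighbour attached to an isotropic line and a parameter. -/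
def nbr (y : H.Iso) (t : ZMod 3) : Submodule E (Fin n → E) where
  carrier := {z | ∃ a v, z = a • lft y.1 + θ • v ∧ π (h H.mat v (lft y.1)) = π a * t}
  zero_mem' := ⟨0, 0, by simp, by simp [h_zero_left]⟩
  add_mem' := by
    rintro _ _ ⟨a, v, rfl, hv⟩ ⟨b, w, rfl, hw⟩
    refine ⟨a + b, v + w, ?_, ?_⟩
    · rw [add_smul, smul_add]; abel
    · rw [h_add_left, map_add, map_add, hv, hw, add_mul]
  smul_mem' := by
    rintro c _ ⟨a, v, rfl, hv⟩
    refine ⟨c * a, c • v, ?_, ?_⟩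
    · rw [smul_add, smul_smul, smul_comm c θ]
    · rw [h_smul_left, map_mul, map_mul, hv, mul_assoc]

lemma mem_nbr_iff (y : H.Iso) (t : ZMod 3) (a : E) (v : Fin n → E) :
    a • lft y.1 + θ • v ∈ nbr y t ↔ π (h H.mat v (lft y.1)) = π a * t := by
  refine ⟨?_, fun hv => ⟨a, v, rfl, hv⟩⟩
  rintro ⟨b, w, hbw, hw⟩
  have h1 := congrArg red hbw
  simp only [red_add, red_smul, red_lft, π_θ, zero_smul, add_zero] at h1
  have h2 : π (a - b) = 0 := by
    rw [map_sub, sub_eq_zero]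
    obtain ⟨i, hi⟩ := Function.ne_iff.1 y.2.1
    exact mul_right_cancel₀ hi (congrFun h1 i)
  obtain ⟨s, hs⟩ := π_eq_zero_iff.1 h2
  have h3 : w = v + s • lft y.1 := by
    refine smul_θ_injective ?_
    have : θ • (s • lft y.1) = (a - b) • lft y.1 := by rw [hs, mul_smul]
    change θ • w = θ • (v + _)
    rw [smul_add, this, sub_smul, ← add_sub_assoc, add_comm (θ • v), hbw]; abel
  rw [h3, h_add_left, map_add, h_smul_left, map_mul, y.π_h, mul_zero, add_zero] at hw
  rw [hw, sub_eq_zero.1 ((map_sub π a b).symm.trans h2)]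

lemma three_dvd_h_of_mem {y : H.Iso} {t : ZMod 3} {z z' : Fin n → E} (hz : z ∈ nbr y t)
    (hz' : z' ∈ nbr y t) : ∃ c, h H.mat z z' = 3 * c := by
  obtain ⟨a, v, rfl, hv⟩ := hz
  obtain ⟨b, w, rfl, hw⟩ := hz'
  have h1 : π (star b * h H.mat v (lft y.1) - a * star (h H.mat w (lft y.1))) = 0 := by
    rw [map_sub, map_mul, map_mul, π_star, π_star, hv, hw]; ring
  obtain ⟨s, hs⟩ := π_eq_zero_iff.1 h1
  have h2 := y.π_h
  rw [h_self H.isHermitian, π_int, ZMod.intCast_zmod_eq_zero_iff_dvd] at h2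
  obtain ⟨k, hk⟩ := h2
  have h3 := h_self H.isHermitian (lft y.1)
  rw [hk] at h3
  push_cast at h3
  refine ⟨a * star b * k - s + h H.mat v w, ?_⟩
  simp only [h_add_left, h_add_right, h_smul_left, h_smul_right, h3, star_θ]
  rw [star_h H.isHermitian] at hs
  linear_combination θ * hs + (s - h H.mat v w) * θ_mul_θ

lemma mem_nbr_of_three_dvd {y : H.Iso} {t : ZMod 3} {x : Fin n → E}
    (hx : ∀ z ∈ nbr y t, ∃ c, h H.mat x z = 3 * c) : x ∈ nbr y t := by
  obtain ⟨w, hw⟩ := H.exists_π_h_eq_one (x := lft y.1) (by rw [red_lft]; exact y.2.1)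
  have h3 : (3 : E) = -(θ * θ) := by rw [θ_mul_θ]; ring
  have h1 : ∀ v, π (h H.mat v (lft y.1)) = 0 → π (h H.mat v x) = 0 := by
    intro v hv
    obtain ⟨c, hc⟩ := hx (θ • v) ⟨0, v, by simp, by simpa using hv⟩
    rw [H.π_h_comm, π_eq_zero_iff]
    refine ⟨c, mul_left_cancel₀ θ_ne_zero ?_⟩
    rw [h_smul_right, star_θ, h3] at hc
    linear_combination -hc
  have h2 : red (x - lift3 (π (h H.mat w x)) • lft y.1) = 0 := by
    refine H.red_eq_zero_of_π_h fun v => ?_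
    have h4 := h1 (v - lift3 (π (h H.mat v (lft y.1))) • w) (by
      rw [h_sub_left, h_smul_left, map_sub, map_mul, π_lift3, hw]; ring)
    rw [h_sub_left, h_smul_left, map_sub, map_mul, π_lift3] at h4
    rw [h_sub_right, h_smul_right, map_sub, map_mul, π_star, π_lift3]
    linear_combination h4
  obtain ⟨v, hv⟩ := red_eq_zero_iff.1 h2
  set a := lift3 (π (h H.mat w x))
  have hx' : x = a • lft y.1 + θ • v := by rw [← hv]; abel
  rw [hx', mem_nbr_iff]
  have hz : lft y.1 + θ • (lift3 t • w) ∈ nbr y t :=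
    ⟨1, lift3 t • w, by simp, by rw [h_smul_left, map_mul, π_lift3, hw, map_one]; ring⟩
  obtain ⟨c, hc⟩ := hx _ hz
  have h2 := y.π_h
  rw [h_self H.isHermitian, π_int, ZMod.intCast_zmod_eq_zero_iff_dvd] at h2
  obtain ⟨k, hk⟩ := h2
  have h4 := h_self H.isHermitian (lft y.1)
  rw [hk] at h4
  push_cast at h4
  have h5 : h H.mat v (lft y.1) - a * h H.mat (lft y.1) (lift3 t • w) =
      θ * (-c + a * k + h H.mat v (lift3 t • w)) := by
    refine mul_left_cancel₀ θ_ne_zero ?_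
    rw [hx'] at hc
    simp only [h_add_left, h_add_right, h_smul_left, h_smul_right _ θ, h4, star_θ] at hc
    linear_combination hc + (c - a * k) * θ_mul_θ
  have h6 := congrArg π h5
  rw [map_mul, π_θ, zero_mul, map_sub, map_mul, H.π_h_comm (lft y.1), h_smul_left, map_mul, hw,
    mul_one, π_lift3 t] at h6
  exact sub_eq_zero.1 h6

lemma three_smul_mem (y : H.Iso) (t : ZMod 3) (x : Fin n → E) : (3 : E) • x ∈ nbr y t := by
  refine ⟨0, (-θ) • x, ?_, ?_⟩
  · rw [smul_smul, mul_neg, θ_mul_θ]; simp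
  · rw [h_smul_left]; simp [π_θ]

/-- A basis of the neighbour, with its Gram matrix. -/
lemma exists_basis_nbr (y : H.Iso) (t : ZMod 3) : ∃ (G : Herm n) (B : Matrix (Fin n) (Fin n) E),
    B.det ≠ 0 ∧ B * H.mat * Bᴴ = (3 : E) • G.mat ∧ ∀ z, z ∈ nbr y t ↔ ∃ x, z = x ᵥ* B := by
  have h30 : (3 : E) ≠ 0 := by decide
  have hrank : Module.finrank E (nbr y t) = n := by
    refine le_antisymm ((Submodule.finrank_le _).trans_eq (by simp)) ?_
    let f : (Fin n → E) →ₗ[E] nbr y t :=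
      { toFun := fun x => ⟨(3 : E) • x, three_smul_mem y t x⟩
        map_add' := fun a b => Subtype.ext (smul_add _ _ _)
        map_smul' := fun a b => Subtype.ext (smul_comm _ _ _) }
    have := LinearMap.finrank_le_finrank_of_injective (f := f) fun a b hab =>
      funext fun i => mul_left_cancel₀ h30 (congrFun (congrArg Subtype.val hab) i)
    simpa using this
  let b : Module.Basis (Fin n) E (nbr y t) :=
    (Module.finBasis E (nbr y t)).reindex (finCongr hrank)
  let B : Matrix (Fin n) (Fin n) E := Matrix.of fun i => (b i : Fin n → E)
  have hB : ∀ z, z ∈ nbr y t ↔ ∃ x, z = x ᵥ* B := by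
    intro z
    constructor
    · intro hz
      refine ⟨b.repr ⟨z, hz⟩, ?_⟩
      have := congrArg Subtype.val (b.sum_repr ⟨z, hz⟩)
      refine (show _ = z from this).symm.trans ?_
      rw [vecMul_eq_sum, Submodule.coe_sum]
      rfl
    · rintro ⟨x, rfl⟩
      rw [vecMul_eq_sum]
      exact Submodule.sum_mem _ fun i _ => Submodule.smul_mem _ _ (b i).2
  have hrow : ∀ i, B i ∈ nbr y t := fun i => (b i).2
  choose D hD using fun i : Fin n => (hB _).1 (three_smul_mem y t (Pi.single i 1))
  have hDB : Matrix.of D * B = (3 : E) • (1 : Matrix (Fin n) (Fin n) E) := by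
    refine Matrix.ext fun i j => ?_
    have := congrFun (hD i) j
    rw [Matrix.smul_apply, one_apply, ← Pi.single_apply]
    change vecMul (D i) B j = _
    rw [← this, Pi.smul_apply, Pi.single_comm]
  have hBdet : B.det ≠ 0 := by
    intro h0
    have := congrArg Matrix.det hDB
    rw [det_mul, h0, mul_zero, det_smul, det_one, mul_one] at this
    exact pow_ne_zero _ h30 this.symm
  have hBD : B * Matrix.of D = (3 : E) • (1 : Matrix (Fin n) (Fin n) E) := by
    have h1 : (B * Matrix.of D - (3 : E) • (1 : Matrix (Fin n) (Fin n) E)) * B = 0 := by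
      rw [Matrix.sub_mul, Matrix.mul_assoc, hDB]; simp
    have h2 := congrArg (· * B.adjugate) h1
    simp only [Matrix.mul_assoc, mul_adjugate, Matrix.mul_smul, Matrix.mul_one,
      Matrix.zero_mul] at h2
    exact sub_eq_zero.1 ((smul_eq_zero.1 h2).resolve_left hBdet)
  choose G hG using fun i j => three_dvd_h_of_mem (hrow i) (hrow j)
  have hGB : B * H.mat * Bᴴ = (3 : E) • Matrix.of G := by
    refine Matrix.ext fun i j => ?_
    rw [← h_row, hG]; rfl
  have hX : ((Matrix.of D)ᴴ * H.mat⁻¹) * H.mat * Bᴴ = (3 : E) • (1 : Matrix (Fin n) (Fin n) E) := by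
    rw [Matrix.mul_assoc (Matrix.of D)ᴴ, nonsing_inv_mul _ H.isUnit_det, Matrix.mul_one,
      ← conjTranspose_mul, hBD, conjTranspose_smul, conjTranspose_one]
    congr 1
  generalize (Matrix.of D)ᴴ * H.mat⁻¹ = X at hX
  have hXmem : ∀ i, X i ∈ nbr y t := by
    intro i
    refine mem_nbr_of_three_dvd fun z hz => ?_
    obtain ⟨x, rfl⟩ := (hB z).1 hz
    refine ⟨star (x i), ?_⟩
    have h1 : X i = Pi.single i 1 ᵥ* X := by rw [single_one_vecMul]; rfl
    have h2 : h H.mat (X i) (x ᵥ* B) = (Pi.single i 1 ᵥ* (X * H.mat * Bᴴ)) ⬝ᵥ star x := by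
      rw [h_eq_vecMul, star_vecMul, dotProduct_mulVec, h1, vecMul_vecMul, vecMul_vecMul,
        Matrix.mul_assoc]
    rw [h2, hX, vecMul_smul, vecMul_one, smul_dotProduct]
    simp
  choose C hC using fun i => (hB _).1 (hXmem i)
  have hCX : X = Matrix.of C * B := Matrix.ext fun i j => congrFun (hC i) j
  have hCG : Matrix.of C * Matrix.of G = 1 := by
    rw [hCX, Matrix.mul_assoc, Matrix.mul_assoc, ← Matrix.mul_assoc B, hGB, Matrix.mul_smul] at hX
    exact smul_right_injective _ h30 hX
  have hGdet : IsUnit (Matrix.of G).det := by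
    have := congrArg Matrix.det hCG
    rw [det_mul, det_one, mul_comm] at this
    exact IsUnit.of_mul_eq_one _ this
  have hGpd : PD (Matrix.of G) := by
    have h1 := H.pd.mul_mul hBdet
    rw [hGB] at h1
    have h2 : (Matrix.of G).map φ = (3 : ℝ)⁻¹ • (((3 : E) • Matrix.of G).map φ) := by
      ext i j
      have : φ (3 : E) = 3 := map_ofNat φ 3
      simp only [map_apply, Matrix.smul_apply, smul_eq_mul, map_mul, this, real_smul]
      push_cast
      ring
    unfold PD
    rw [h2]
    exact Matrix.PosDef.smul h1 (by norm_num)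
  exact ⟨⟨Matrix.of G, hGpd.det_eq_one hGdet, hGpd⟩, B, hBdet, hGB, hB⟩

end Herm

namespace Herm
variable {n : ℕ}

/-- Similitudes of norm `3` whose reduction has rank one. -/
@[ext] structure Sim (H H' : Herm n) where
  val : Matrix (Fin n) (Fin n) E
  left : Fin n → ZMod 3
  right : Fin n → ZMod 3
  eq : val * H.mat * valᴴ = (3 : E) • H'.mat
  map_eq : val.map π = vecMulVec left right
  left_ne : left ≠ 0
  right_ne : right ≠ 0

variable {H H' : Herm n}

lemma smul_three_injective : Function.Injective fun M : Matrix (Fin n) (Fin n) E => (3 : E) • M :=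
  smul_right_injective _ (by decide)

namespace Sim

lemma row (S : Sim H H') (i : Fin n) : red (S.val i) = S.left i • S.right :=
  funext fun j => congrFun (congrFun S.map_eq i) j

/-- The adjoint similitude. -/
def adj (S : Sim H H') : Matrix (Fin n) (Fin n) E := H.mat * S.valᴴ * H'.mat⁻¹

lemma mul_adj (S : Sim H H') : S.val * S.adj = (3 : E) • (1 : Matrix (Fin n) (Fin n) E) := by
  rw [adj, ← Matrix.mul_assoc, ← Matrix.mul_assoc, S.eq, smul_mul, mul_nonsing_inv _ H'.isUnit_det]

lemma adj_mul (S : Sim H H') : S.adj * S.val = (3 : E) • (1 : Matrix (Fin n) (Fin n) E) := by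
  have h1 : (3 : E) • (S.adj * S.val) = (3 : E) • ((3 : E) • (1 : Matrix (Fin n) (Fin n) E)) := by
    have h30 : (S.val.det) ≠ 0 := by
      intro h0
      have := congrArg Matrix.det S.mul_adj
      rw [det_mul, h0, zero_mul, det_smul, det_one, mul_one] at this
      exact pow_ne_zero _ (by decide) this.symm
    congr 1
    have h2 : S.val * (S.adj * S.val - (3 : E) • (1 : Matrix (Fin n) (Fin n) E)) = 0 := by
      rw [Matrix.mul_sub, ← Matrix.mul_assoc, S.mul_adj]; simp
    have h3 := congrArg (S.val.adjugate * ·) h2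
    simp only [← Matrix.mul_assoc, adjugate_mul, Matrix.smul_mul, Matrix.one_mul,
      Matrix.mul_zero] at h3
    exact sub_eq_zero.1 ((smul_eq_zero.1 h3).resolve_left h30)
  exact smul_three_injective h1

lemma adj_eq (S : Sim H H') : S.adj * H'.mat * S.adjᴴ = (3 : E) • H.mat := by
  have h1 : S.adj * H'.mat = H.mat * S.valᴴ := by
    rw [adj, Matrix.mul_assoc, nonsing_inv_mul _ H'.isUnit_det, Matrix.mul_one]
  rw [h1, Matrix.mul_assoc, ← conjTranspose_mul, S.adj_mul, conjTranspose_smul, conjTranspose_one,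
    Matrix.mul_smul, Matrix.mul_one]
  rfl

lemma bar_mulVec_ne (H : Herm n) {x : Fin n → ZMod 3} (hx : x ≠ 0) : H.bar *ᵥ x ≠ 0 := by
  intro h0
  refine hx (Matrix.eq_zero_of_mulVec_eq_zero ?_ h0)
  rw [H.det_bar]; decide

lemma map_adj (S : Sim H H') : S.adj.map π =
    vecMulVec (H.bar *ᵥ S.right) (S.left ᵥ* H'.bar⁻¹) := by
  have h1 : S.adj * H'.mat = H.mat * S.valᴴ := by
    rw [adj, Matrix.mul_assoc, nonsing_inv_mul _ H'.isUnit_det, Matrix.mul_one]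
  have h2 := congrArg (fun M : Matrix (Fin n) (Fin n) E => M.map π) h1
  simp only [Matrix.map_mul] at h2
  have h3 : S.valᴴ.map π = (S.val.map π)ᵀ := by
    ext i j; exact π_star _
  rw [h3, S.map_eq, transpose_vecMulVec] at h2
  change S.adj.map π * H'.bar = H.bar * _ at h2
  have hu : IsUnit H'.bar.det := by rw [H'.det_bar]; exact isUnit_one
  have h4 := congrArg (· * H'.bar⁻¹) h2
  simp only [mul_nonsing_inv_cancel_right _ _ hu] at h4
  rw [h4, mul_vecMulVec, vecMulVec_mul]

/-- Passage to the adjoint. -/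
def dual (S : Sim H H') : Sim H' H where
  val := S.adj
  left := H.bar *ᵥ S.right
  right := S.left ᵥ* H'.bar⁻¹
  eq := S.adj_eq
  map_eq := S.map_adj
  left_ne := bar_mulVec_ne H S.right_ne
  right_ne := by
    intro h0
    have hu : IsUnit H'.bar.det := by rw [H'.det_bar]; exact isUnit_one
    have := congrArg (· ᵥ* H'.bar) h0
    simp only [vecMul_vecMul, nonsing_inv_mul _ hu, vecMul_one, zero_vecMul] at this
    exact S.left_ne this

lemma dual_injective : Function.Injective (dual (H := H) (H' := H')) := by
  intro S T hST
  have hu : IsUnit H.bar.det := by rw [H.det_bar]; exact isUnit_one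
  have hu' : IsUnit H'.bar.det := by rw [H'.det_bar]; exact isUnit_one
  have h1 : S.adj = T.adj := congrArg Sim.val hST
  have h2 : H.bar *ᵥ S.right = H.bar *ᵥ T.right := congrArg Sim.left hST
  have h3 : S.left ᵥ* H'.bar⁻¹ = T.left ᵥ* H'.bar⁻¹ := congrArg Sim.right hST
  refine Sim.ext ?_ ?_ ?_
  · have h4 : (3 : E) • S.val = (3 : E) • T.val := by
      have := congrArg (S.val * ·) T.adj_mul
      simp only [← h1, ← Matrix.mul_assoc, S.mul_adj] at this
      simpa using this.symm
    exact smul_three_injective h4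
  · have := congrArg (· ᵥ* H'.bar) h3
    simpa only [vecMul_vecMul, nonsing_inv_mul _ hu', vecMul_one] using this
  · have := congrArg (H.bar⁻¹ *ᵥ ·) h2
    simpa only [mulVec_mulVec, nonsing_inv_mul _ hu, one_mulVec] using this

instance : Finite (Sim H H') := by
  have : {U : Matrix (Fin n) (Fin n) E | U * H.mat * Uᴴ = (3 : E) • H'.mat}.Finite := by
    refine (Set.Finite.pi' fun i : Fin n =>
      H.pd.finite_q_le H.isUnit_det (q ((3 : E) • H'.mat) (Pi.single i 1))).subset
      fun (U : Matrix (Fin n) (Fin n) E) hU i => ?_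
    change q H.mat (U i) ≤ _
    have hU : U * H.mat * Uᴴ = (3 : E) • H'.mat := hU
    rw [← hU, ← q_mul, single_one_vecMul]
    exact le_rfl
  have := this.to_subtype
  exact Finite.of_injective
    (fun S : Sim H H' => ((⟨S.val, S.eq⟩, S.left, S.right) :
      {U : Matrix (Fin n) (Fin n) E | U * H.mat * Uᴴ = (3 : E) • H'.mat} ×
        (Fin n → ZMod 3) × (Fin n → ZMod 3)))
    fun S T h => Sim.ext (congrArg (fun x => x.1.1) h) (congrArg (fun x => x.2.1) h)
      (congrArg (fun x => x.2.2) h)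

instance : Fintype (Sim H H') := Fintype.ofFinite _

lemma card_comm (H H' : Herm n) : Fintype.card (Sim H H') = Fintype.card (Sim H' H) :=
  le_antisymm (Fintype.card_le_of_injective _ dual_injective)
    (Fintype.card_le_of_injective _ dual_injective)

lemma isotropic (S : Sim H H') : S.right ⬝ᵥ H.bar *ᵥ S.right = 0 := by
  obtain ⟨i, hi⟩ := Function.ne_iff.1 S.left_ne
  have h1 := H.π_h (S.val i) (S.val i)
  have h3 : π (3 : E) = 0 := by decide
  rw [h_row, S.eq, Matrix.smul_apply, smul_eq_mul, map_mul, h3, zero_mul, S.row, mulVec_smul,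
    smul_dotProduct, dotProduct_smul] at h1
  exact ((smul_eq_zero.1 ((smul_eq_zero.1 h1.symm).resolve_left hi)).resolve_left hi)

/-- The isotropic vector attached to a similitude. -/
def iso (S : Sim H H') : H.Iso := ⟨S.right, S.right_ne, S.isotropic⟩

lemma exists_decomp (S : Sim H H') (i : Fin n) :
    ∃ v, S.val i = lift3 (S.left i) • lft S.right + θ • v := by
  have : red (S.val i - lift3 (S.left i) • lft S.right) = 0 := by
    rw [red_sub, red_smul, π_lift3, red_lft, S.row, sub_self]
  obtain ⟨v, hv⟩ := red_eq_zero_iff.1 this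
  exact ⟨v, by rw [← hv]; abel⟩

lemma exists_unique_param (S : Sim H H') : ∃! t, ∀ i, S.val i ∈ nbr S.iso t := by
  choose v hv using S.exists_decomp
  have hmem : ∀ i t, S.val i ∈ nbr S.iso t ↔ π (h H.mat (v i) (lft S.right)) = S.left i * t := by
    intro i t
    have := mem_nbr_iff S.iso t (lift3 (S.left i)) (v i)
    rw [π_lift3] at this
    rw [hv]; exact this
  obtain ⟨k, hk⟩ := Function.ne_iff.1 S.left_ne
  have hkk : S.left k * S.left k = 1 := by
    revert hk; simp only [Pi.zero_apply]; generalize S.left k = a; revert a; decide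
  have hcr : ∀ i j, S.left j * π (h H.mat (v i) (lft S.right)) =
      S.left i * π (h H.mat (v j) (lft S.right)) := by
    intro i j
    have h1 : h H.mat (S.val i) (S.val j) = 3 * H'.mat i j := by rw [h_row, S.eq]; rfl
    have h2 := S.iso.π_h
    rw [h_self H.isHermitian, π_int, ZMod.intCast_zmod_eq_zero_iff_dvd] at h2
    obtain ⟨s, hs⟩ := h2
    have h3 := h_self H.isHermitian (lft S.right)
    rw [show q H.mat (lft S.right) = 3 * s from hs] at h3
    push_cast at h3
    rw [hv i, hv j] at h1
    simp only [h_add_left, h_add_right, h_smul_left, h_smul_right, h3, star_θ] at h1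
    have h4 : star (lift3 (S.left j)) * h H.mat (v i) (lft S.right) -
        lift3 (S.left i) * h H.mat (lft S.right) (v j) =
        θ * (-H'.mat i j + lift3 (S.left i) * star (lift3 (S.left j)) * s +
          h H.mat (v i) (v j)) := by
      refine mul_left_cancel₀ θ_ne_zero ?_
      linear_combination h1 + (H'.mat i j - lift3 (S.left i) * star (lift3 (S.left j)) * s) *
        θ_mul_θ
    have h5 := congrArg π h4
    rw [map_mul, π_θ, zero_mul, map_sub, map_mul, map_mul, π_star, π_lift3, π_lift3,
      H.π_h_comm (lft S.right)] at h5
    exact sub_eq_zero.1 h5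
  refine ⟨S.left k * π (h H.mat (v k) (lft S.right)), fun i => ?_, fun t ht => ?_⟩
  · rw [hmem, ← mul_assoc, mul_comm (S.left i), mul_assoc, ← hcr, ← mul_assoc, hkk, one_mul]
  · rw [(hmem k t).1 (ht k), ← mul_assoc, hkk, one_mul]

/-- The isotropic vector and the parameter attached to a similitude. -/
def point (S : Sim H H') : H.Iso × ZMod 3 := (S.iso, S.exists_unique_param.choose)

lemma mem_point (S : Sim H H') (i : Fin n) : S.val i ∈ nbr S.point.1 S.point.2 :=
  S.exists_unique_param.choose_spec.1 i

lemma point_eq_iff (S : Sim H H') (y : H.Iso) (t : ZMod 3) :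
    S.point = (y, t) ↔ S.right = y.1 ∧ ∀ i, S.val i ∈ nbr y t := by
  constructor
  · intro h0
    have h1 : y = S.point.1 := by rw [h0]
    have h2 : t = S.point.2 := by rw [h0]
    exact ⟨by rw [h1]; rfl, fun i => by rw [h1, h2]; exact S.mem_point i⟩
  · rintro ⟨h1, h2⟩
    have h3 : S.iso = y := Subtype.ext h1
    refine Prod.ext h3 ?_
    refine (S.exists_unique_param.unique S.exists_unique_param.choose_spec.1 ?_)
    rw [h3]; exact h2

end Sim

/-- The vectors of norm `3 * m` in a neighbour. -/
abbrev NbrVec (p : H.Iso × ZMod 3) (m : ℤ) : Type := {x : Vec H (3 * m) // x.1 ∈ nbr p.1 p.2}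

lemma point_fibre (p : H.Iso × ZMod 3) : ∃ G : Herm n, (∀ m, Nonempty (NbrVec p m ≃ Vec G m)) ∧
    ∀ H' : Herm n, Nonempty ({S : Sim H H' // S.point = p} ≃ J G H') := by
  obtain ⟨y, t⟩ := p
  obtain ⟨G, B, hB, hG, hmem⟩ := exists_basis_nbr y t
  have hrow : ∀ i, ∃ a : ZMod 3, red (B i) = a • y.1 := by
    intro i
    obtain ⟨a, v, hav, -⟩ := (hmem (B i)).2 ⟨Pi.single i 1, by rw [single_one_vecMul]; rfl⟩
    exact ⟨π a, by rw [hav, red_add, red_smul, red_lft, red_smul_θ, add_zero]⟩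
  choose c hc using hrow
  have hcmap : B.map π = vecMulVec c y.1 := by
    ext i j; exact congrFun (hc i) j
  have hc0 : c ≠ 0 := by
    rintro rfl
    obtain ⟨w, hw⟩ := H.exists_π_h_eq_one (x := lft y.1) (by rw [red_lft]; exact y.2.1)
    have h1 : lft y.1 + θ • (lift3 t • w) ∈ nbr y t :=
      ⟨1, lift3 t • w, by simp, by rw [h_smul_left, map_mul, π_lift3, hw, map_one]; ring⟩
    obtain ⟨x, hx⟩ := (hmem _).1 h1
    have h2 := congrArg red hx
    rw [red_add, red_smul_θ, red_lft, add_zero] at h2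
    refine y.2.1 (h2.trans (funext fun j => ?_))
    simp only [red, vecMul, dotProduct, map_sum, map_mul]
    refine Finset.sum_eq_zero fun i _ => ?_
    rw [show π (B i j) = 0 from (congrFun (hc i) j).trans (by simp), mul_zero]
  have hBU : ∀ U V : Matrix (Fin n) (Fin n) E, U * B = V * B → U = V := by
    intro U V hUV
    have h1 : (U - V) * B = 0 := by rw [Matrix.sub_mul, hUV, sub_self]
    have h2 := congrArg (· * B.adjugate) h1
    simp only [Matrix.mul_assoc, mul_adjugate, Matrix.mul_smul, Matrix.mul_one,
      Matrix.zero_mul] at h2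
    exact sub_eq_zero.1 ((smul_eq_zero.1 h2).resolve_left hB)
  have hconj : ∀ U : Matrix (Fin n) (Fin n) E,
      (U * B) * H.mat * (U * B)ᴴ = (3 : E) • (U * G.mat * Uᴴ) := by
    intro U
    rw [conjTranspose_mul, ← Matrix.smul_mul, ← Matrix.mul_smul, ← hG]
    simp only [Matrix.mul_assoc]
  have hq : ∀ z, q H.mat (z ᵥ* B) = 3 * q G.mat z := by
    intro z
    rw [q_mul, hG]
    have h3 : ((3 : E)).re = 3 ∧ ((3 : E)).im = 0 := ⟨rfl, rfl⟩
    simp [q, h, smul_mulVec, dotProduct_smul, h3.1, h3.2]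
  refine ⟨G, fun m => ⟨(Equiv.ofBijective (fun z : Vec G m => (⟨⟨z.1 ᵥ* B, by rw [hq, z.2]⟩,
    (hmem _).2 ⟨z.1, rfl⟩⟩ : NbrVec (y, t) m)) ⟨?_, ?_⟩).symm⟩,
        fun H' => ⟨(Equiv.ofBijective (fun U : J G H' =>
    (⟨⟨U.val * B, U.val.map π *ᵥ c, y.1, by rw [hconj, U.eq], by
      rw [Matrix.map_mul, hcmap, mul_vecMulVec], ?_, y.2.1⟩, ?_⟩ :
        {S : Sim H H' // S.point = (y, t)})) ⟨?_, ?_⟩).symm⟩⟩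
  · intro z w hzw
    have h1 : z.1 ᵥ* B = w.1 ᵥ* B := congrArg (fun x : NbrVec (y, t) m => x.1.1) hzw
    have h2 : (z.1 - w.1) ᵥ* B = 0 := by rw [sub_vecMul, h1, sub_self]
    exact Subtype.ext (sub_eq_zero.1 (Matrix.eq_zero_of_vecMul_eq_zero hB h2))
  · rintro ⟨⟨x, hx⟩, hx'⟩
    obtain ⟨z, rfl⟩ := (hmem x).1 hx'
    rw [hq] at hx
    exact ⟨⟨z, by linarith⟩, rfl⟩
  · intro h0
    refine hc0 (Matrix.eq_zero_of_mulVec_eq_zero ?_ h0)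
    have : (U.val.map π).det = π U.val.det := (RingHom.map_det π U.val).symm
    rw [this]
    exact (U.isUnit.map π).ne_zero
  · rw [Sim.point_eq_iff]
    exact ⟨rfl, fun i => (hmem _).2 ⟨U.val i, rfl⟩⟩
  · intro U V hUV
    exact J.ext (hBU _ _ (congrArg (fun S => S.1.val) hUV))
  · rintro ⟨S, hS⟩
    obtain ⟨h1, h2⟩ := (S.point_eq_iff y t).1 hS
    choose U hU using fun i => (hmem _).1 (h2 i)
    have hSU : S.val = Matrix.of U * B := Matrix.ext fun i j => congrFun (hU i) j
    have hUJ : Matrix.of U * G.mat * (Matrix.of U)ᴴ = H'.mat := by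
      refine smul_three_injective (?_ : (3 : E) • _ = (3 : E) • _)
      rw [← hconj, ← hSU, S.eq]
    refine ⟨⟨Matrix.of U, hUJ⟩, Subtype.ext (Sim.ext hSU.symm ?_ h1.symm)⟩
    have h3 := S.map_eq
    rw [hSU, Matrix.map_mul, hcmap, mul_vecMulVec, h1] at h3
    obtain ⟨j, hj⟩ := Function.ne_iff.1 y.2.1
    funext i
    exact mul_right_cancel₀ hj (congrFun (congrFun h3 i) j)

end Herm

namespace Herm
variable {n : ℕ} {H H' : Herm n}

lemma red_lift3_smul_lft (a : ZMod 3) (y : Fin n → ZMod 3) : red (lift3 a • lft y) = a • y := by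
  rw [red_smul, π_lift3, red_lft]

/-- The isotropic vector in the line of `x`. -/
def lineIso {x : Fin n → E} (hx : red x ≠ 0) {m : ℤ} (hq : q H.mat x = 3 * m) (u : (ZMod 3)ˣ) :
    H.Iso := ⟨(u : ZMod 3) • red x, smul_ne_zero u.ne_zero hx, by
  rw [mulVec_smul, smul_dotProduct, dotProduct_smul, ← H.π_q, hq]
  push_cast
  rw [show (3 : ZMod 3) = 0 from rfl]; simp⟩

lemma exists_unique_nbr {x : Fin n → E} {y : H.Iso} (u : (ZMod 3)ˣ)
    (hy : red x = (u : ZMod 3) • y.1) :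
    ∃! t, x ∈ nbr y t := by
  have : red (x - lift3 (u : ZMod 3) • lft y.1) = 0 := by
    rw [red_sub, red_lift3_smul_lft, hy, sub_self]
  obtain ⟨v, hv⟩ := red_eq_zero_iff.1 this
  have hxv : x = lift3 (u : ZMod 3) • lft y.1 + θ • v := by rw [← hv]; abel
  have hmem : ∀ t, x ∈ nbr y t ↔ π (h H.mat v (lft y.1)) = u * t := by
    intro t
    have := mem_nbr_iff y t (lift3 (u : ZMod 3)) v
    rw [π_lift3] at this
    rw [hxv]; exact this
  refine ⟨(u⁻¹ : (ZMod 3)ˣ) * π (h H.mat v (lft y.1)), (hmem _).2 ?_, fun t ht => ?_⟩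
  · rw [← mul_assoc, Units.mul_inv, one_mul]
  · rw [(hmem t).1 ht, ← mul_assoc, Units.inv_mul, one_mul]

instance (x : Fin n → E) : Fintype {p : H.Iso × ZMod 3 // x ∈ nbr p.1 p.2} := Fintype.ofFinite _

lemma card_nbr_primitive {x : Fin n → E} (hx : red x ≠ 0) {m : ℤ} (hq : q H.mat x = 3 * m) :
    Fintype.card {p : H.Iso × ZMod 3 // x ∈ nbr p.1 p.2} = 2 := by
  have hsq : ∀ u : (ZMod 3)ˣ, (u : ZMod 3) * u = 1 := by decide
  have hred : ∀ u : (ZMod 3)ˣ, red x = (u : ZMod 3) • (lineIso hx hq u).1 := fun u => by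
    rw [lineIso, smul_smul, hsq, one_smul]
  have h2 : Fintype.card (ZMod 3)ˣ = 2 := by decide
  rw [← h2]
  refine (Fintype.card_of_bijective (f := fun u : (ZMod 3)ˣ =>
    (⟨(lineIso hx hq u, (exists_unique_nbr u (hred u)).choose),
      (exists_unique_nbr u (hred u)).choose_spec.1⟩ :
        {p : H.Iso × ZMod 3 // x ∈ nbr p.1 p.2})) ⟨?_, ?_⟩).symm
  · intro u v huv
    have h1 : (u : ZMod 3) • red x = (v : ZMod 3) • red x :=
      congrArg (fun p : {p : H.Iso × ZMod 3 // x ∈ nbr p.1 p.2} => p.1.1.1) huv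
    exact Units.ext (smul_left_injective _ hx h1)
  · rintro ⟨⟨y, t⟩, hp⟩
    obtain ⟨a, v, hav, hv⟩ := hp
    have h1 : red x = π a • y.1 := by
      rw [hav, red_add, red_smul, red_lft, red_smul_θ, add_zero]
    have ha : π a ≠ 0 := by
      intro h0
      rw [h0, zero_smul] at h1
      exact hx h1
    let u := Units.mk0 (π a) ha
    have h3 : lineIso hx hq u = y := Subtype.ext (by
      change (u : ZMod 3) • red x = y.1
      rw [h1]
      change (u : ZMod 3) • (u : ZMod 3) • y.1 = y.1
      rw [smul_smul, hsq, one_smul])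
    refine ⟨u, Subtype.ext (Prod.ext h3 ?_)⟩
    refine (exists_unique_nbr u (hred u)).unique (exists_unique_nbr u (hred u)).choose_spec.1 ?_
    rw [h3]
    exact ⟨a, v, hav, hv⟩

lemma smul_θ_mem_nbr (x : Fin n → E) (y : H.Iso) (t : ZMod 3) :
    θ • x ∈ nbr y t ↔ red x ⬝ᵥ H.bar *ᵥ y.1 = 0 := by
  have := mem_nbr_iff y t 0 x
  rw [zero_smul, zero_add, map_zero, zero_mul, H.π_h, red_lft] at this
  exact this

lemma card_iso_filter (P : (Fin n → ZMod 3) → Prop) [DecidablePred P] (h0 : P 0) :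
    Fintype.card {y : H.Iso // P y.1} + 1 =
      (Finset.univ.filter fun y : Fin n → ZMod 3 => P y ∧ y ⬝ᵥ H.bar *ᵥ y = 0).card := by
  classical
  have h1 : (0 : Fin n → ZMod 3) ∈
      Finset.univ.filter fun y : Fin n → ZMod 3 => P y ∧ y ⬝ᵥ H.bar *ᵥ y = 0 := by
    simp [h0]
  rw [← Finset.card_erase_add_one h1, ← Fintype.card_coe]
  congr 1
  refine Fintype.card_congr ⟨fun y => ⟨y.1.1, ?_⟩, fun y => ⟨⟨y.1, ?_⟩, ?_⟩, fun _ => rfl,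
    fun _ => rfl⟩
  · simpa using ⟨y.1.2.1, y.2, y.1.2.2⟩
  · exact ⟨(Finset.mem_erase.1 y.2).1, (Finset.mem_filter.1 (Finset.mem_erase.1 y.2).2).2.2⟩
  · exact (Finset.mem_filter.1 (Finset.mem_erase.1 y.2).2).2.1

lemma card_nbr_smul_θ {x : Fin n → E} {m : ℤ} (hq : q H.mat x = m) (hm : (m : ZMod 3) ≠ 0)
    {Z : ℕ} (hZ : (9 : E) * Z = 3 ^ n + if (m : ZMod 3) = 1 then -(θ ^ (n + 1) + (-θ) ^ (n + 1))
      else θ ^ (n + 1) + (-θ) ^ (n + 1)) :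
    Fintype.card {p : H.Iso × ZMod 3 // θ • x ∈ nbr p.1 p.2} + 3 = 3 * Z := by
  classical
  have h1 : Fintype.card {p : H.Iso × ZMod 3 // θ • x ∈ nbr p.1 p.2} =
      Fintype.card ({y : H.Iso // red x ⬝ᵥ H.bar *ᵥ y.1 = 0} × ZMod 3) := by
    refine Fintype.card_congr ⟨fun p => (⟨p.1.1, (smul_θ_mem_nbr _ _ _).1 p.2⟩, p.1.2),
      fun p => ⟨(p.1.1, p.2), (smul_θ_mem_nbr _ _ _).2 p.1.2⟩, fun _ => rfl, fun _ => rfl⟩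
  have h2 := card_iso_filter (H := H) (fun y => red x ⬝ᵥ H.bar *ᵥ y = 0) (by simp)
  have h3 := card_isotropic_perp H.bar_transpose H.det_bar (red x) m (by rw [← H.π_q, hq]) hm
  rw [← hZ] at h3
  have h4 := mul_left_cancel₀ (by decide) h3
  have h5 : (Finset.univ.filter fun y : Fin n → ZMod 3 =>
      red x ⬝ᵥ H.bar *ᵥ y = 0 ∧ y ⬝ᵥ H.bar *ᵥ y = 0).card = Z := by exact_mod_cast h4
  rw [h1, Fintype.card_prod, ZMod.card]
  omega

lemma card_iso {Z : ℕ} (hZ : (3 : E) * Z = 3 ^ n + θ ^ n + (-θ) ^ n) :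
    Fintype.card H.Iso + 1 = Z := by
  classical
  have h2 := card_iso_filter (H := H) (fun _ => True) trivial
  have h3 := card_isotropic H.bar_transpose H.det_bar
  rw [← hZ] at h3
  have h4 := mul_left_cancel₀ (by decide) h3
  have h5 : (Finset.univ.filter fun y : Fin n → ZMod 3 => y ⬝ᵥ H.bar *ᵥ y = 0).card = Z := by
    exact_mod_cast h4
  simp only [true_and] at h2
  rw [← h5, ← h2]
  congr 1
  exact Fintype.card_congr (Equiv.Set.univ _).symm

/-- Division of the imprimitive vectors by `θ`. -/
def vecSmulθ (H : Herm n) (m : ℤ) : Vec H m ≃ {x : Vec H (3 * m) // red x.1 = 0} :=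
  Equiv.ofBijective (fun x => ⟨⟨θ • x.1, by rw [q_smul_θ H.isHermitian, x.2]⟩, red_smul_θ _⟩) ⟨
    fun x y hxy => Subtype.ext (smul_θ_injective
      (congrArg (fun z : {x : Vec H (3 * m) // red x.1 = 0} => z.1.1) hxy)), by
    rintro ⟨⟨x, hx⟩, hx'⟩
    obtain ⟨v, rfl⟩ := red_eq_zero_iff.1 hx'
    rw [q_smul_θ H.isHermitian] at hx
    exact ⟨⟨v, by linarith⟩, rfl⟩⟩

instance (p : H.Iso × ZMod 3) (m : ℤ) : Fintype (NbrVec p m) := Fintype.ofFinite _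

lemma sum_card_nbrVec (H : Herm n) {m : ℤ} (hm : (m : ZMod 3) ≠ 0)
    {Z : ℕ} (hZ : (9 : E) * Z = 3 ^ n + if (m : ZMod 3) = 1 then -(θ ^ (n + 1) + (-θ) ^ (n + 1))
      else θ ^ (n + 1) + (-θ) ^ (n + 1)) :
    ∑ p : H.Iso × ZMod 3, (Fintype.card (NbrVec p m) : ℚ) =
      2 * (rep H (3 * m) - rep H m) + (3 * Z - 3) * rep H m := by
  classical
  have h1 : ∑ p : H.Iso × ZMod 3, Fintype.card (NbrVec p m) =
      ∑ x : Vec H (3 * m), Fintype.card {p : H.Iso × ZMod 3 // x.1 ∈ nbr p.1 p.2} := by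
    rw [← Fintype.card_sigma, ← Fintype.card_sigma]
    exact Fintype.card_congr ⟨fun s => ⟨s.2.1, s.1, s.2.2⟩, fun s => ⟨s.2.1, s.1, s.2.2⟩,
      fun _ => rfl, fun _ => rfl⟩
  have hcard0 : (Finset.univ.filter fun x : Vec H (3 * m) => red x.1 = 0).card = rep H m := by
    rw [rep, Fintype.card_congr (vecSmulθ H m), Fintype.card_subtype]
  have hcard1 : (Finset.univ.filter fun x : Vec H (3 * m) => ¬ red x.1 = 0).card + rep H m =
      rep H (3 * m) := by
    rw [← hcard0, add_comm, Finset.card_filter_add_card_filter_not]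
    rfl
  have h2 : ∀ x : Vec H (3 * m), red x.1 = 0 →
      ((Fintype.card {p : H.Iso × ZMod 3 // x.1 ∈ nbr p.1 p.2} : ℕ) : ℚ) = 3 * Z - 3 := by
    intro x hx
    obtain ⟨v, hv⟩ := red_eq_zero_iff.1 hx
    have hq := x.2
    rw [hv, q_smul_θ H.isHermitian] at hq
    have h3 := card_nbr_smul_θ (H := H) (x := v) (m := m) (by linarith) hm hZ
    rw [eq_sub_iff_add_eq]
    simp_rw [hv]
    exact_mod_cast h3
  have h4 : (rep H (3 * m) : ℚ) = (Finset.univ.filter fun x : Vec H (3 * m) => ¬ red x.1 = 0).card +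
      rep H m := by exact_mod_cast hcard1.symm
  rw [← Nat.cast_sum, h1, Nat.cast_sum,
    ← Finset.sum_filter_add_sum_filter_not Finset.univ (fun x : Vec H (3 * m) => red x.1 = 0),
    Finset.sum_congr rfl (fun x hx => h2 x (Finset.mem_filter.1 hx).2),
    Finset.sum_congr rfl (fun x hx => by
      rw [card_nbr_primitive (Finset.mem_filter.1 hx).2 x.2] : ∀ x ∈ Finset.univ.filter
        (fun x : Vec H (3 * m) => ¬ red x.1 = 0), _ = ((2 : ℕ) : ℚ)),
    Finset.sum_const, Finset.sum_const, hcard0, h4]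
  simp only [nsmul_eq_mul]
  push_cast
  ring

lemma sum_card_sim (H : Herm n) :
    ∑ c : Cls n, (Fintype.card (Sim H c.rep) : ℚ) / aut c.rep = 3 * Fintype.card H.Iso := by
  have h1 := sum_fibration (n := n) (V := H.Iso × ZMod 3) (I := fun c => Sim H c.rep)
    (fun c S => S.point) (fun p => by
      obtain ⟨G, -, hG⟩ := point_fibre p
      exact ⟨G, fun c => hG c.rep⟩) (fun _ => 1)
  simpa [mul_comm] using h1

lemma sum_card_sim_mul_rep (H : Herm n) (m : ℤ) :
    ∑ c : Cls n, (Fintype.card (Sim H c.rep) : ℚ) * rep c.rep m / aut c.rep =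
      ∑ p : H.Iso × ZMod 3, (Fintype.card (NbrVec p m) : ℚ) := by
  have h1 := sum_fibration (n := n) (V := H.Iso × ZMod 3) (I := fun c => Sim H c.rep)
    (fun c S => S.point) (fun p => by
      obtain ⟨G, -, hG⟩ := point_fibre p
      exact ⟨G, fun c => hG c.rep⟩) (fun p => (Fintype.card (NbrVec p m) : ℚ))
  rw [← h1]
  refine Finset.sum_congr rfl fun c _ => ?_
  congr 1
  have h2 : ∀ S : Sim H c.rep, (Fintype.card (NbrVec S.point m) : ℚ) = rep c.rep m := by
    intro S
    obtain ⟨G, hV, hG⟩ := point_fibre S.point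
    obtain ⟨e⟩ := hG c.rep
    obtain ⟨e'⟩ := hV m
    rw [Fintype.card_congr e', ← rep_congr (e ⟨S, rfl⟩) m, rep]
  rw [Finset.sum_congr rfl fun S _ => h2 S, Finset.sum_const, nsmul_eq_mul, Finset.card_univ]

end Herm

open Herm

/-- The averaged representation numbers are eigenvectors of the neighbour operator. -/
lemma avg_rep_three_mul (n : ℕ) {m : ℤ} (hm : (m : ZMod 3) ≠ 0) {Z Z' : ℕ}
    (hZ : (3 : E) * Z = 3 ^ n + θ ^ n + (-θ) ^ n)
    (hZ' : (9 : E) * Z' = 3 ^ n + if (m : ZMod 3) = 1 then -(θ ^ (n + 1) + (-θ) ^ (n + 1))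
      else θ ^ (n + 1) + (-θ) ^ (n + 1)) :
    2 * avg n (fun H => rep H (3 * m)) = (2 + 3 * Z - 3 * Z') * avg n (fun H => rep H m) := by
  have h1 : ∑ c' : Cls n, (∑ c : Cls n,
      (Fintype.card (Sim c'.rep c.rep) : ℚ) * rep c.rep m / aut c.rep) / aut c'.rep =
      (3 * Z - 3) * avg n (fun H => rep H m) := by
    simp_rw [Finset.sum_div]
    rw [Finset.sum_comm, avg, Finset.mul_sum]
    refine Finset.sum_congr rfl fun c _ => ?_
    have h2 := sum_card_sim c.rep
    have h3 : (Fintype.card c.rep.Iso : ℚ) = Z - 1 := by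
      rw [← card_iso (H := c.rep) hZ]; push_cast; ring
    rw [h3] at h2
    rw [show (3 * (Z : ℚ) - 3) = 3 * (Z - 1) by ring, ← h2, Finset.sum_mul]
    refine Finset.sum_congr rfl fun c' _ => ?_
    rw [Sim.card_comm]
    ring
  simp_rw [sum_card_sim_mul_rep, sum_card_nbrVec _ hm hZ'] at h1
  simp only [avg] at h1 ⊢
  have h4 : ∑ c : Cls n, (2 * ((rep c.rep (3 * m) : ℚ) - rep c.rep m) +
      (3 * Z' - 3) * rep c.rep m) / aut c.rep =
      2 * ∑ c : Cls n, (rep c.rep (3 * m) : ℚ) / aut c.rep +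
      (3 * Z' - 5) * ∑ c : Cls n, (rep c.rep m : ℚ) / aut c.rep := by
    rw [Finset.mul_sum, Finset.mul_sum, ← Finset.sum_add_distrib]
    exact Finset.sum_congr rfl fun c _ => by ring
  rw [h4] at h1
  linarith

section Poisson
open MeasureTheory Set

variable {ι : Type*} [Fintype ι]

/-- Half-open unit cubes. -/
def cube (k : ι → ℤ) : Set (ι → ℝ) := {x | ∀ i, x i ∈ Ioc (k i : ℝ) (k i + 1)}

/-- Integral vectors as real vectors. -/
def intVec (k : ι → ℤ) : ι → ℝ := fun i => k i

lemma measurableSet_cube (k : ι → ℤ) : MeasurableSet (cube k) := by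
  have : cube k = Set.pi univ fun i => Ioc (k i : ℝ) (k i + 1) := by
    ext x; simp [cube]
  rw [this]
  exact MeasurableSet.univ_pi fun i => measurableSet_Ioc

lemma mem_cube_iff {ι : Type*} {k : ι → ℤ} {x : ι → ℝ} : x ∈ cube k ↔ ∀ i, ⌈x i⌉ = k i + 1 := by
  refine forall_congr' fun i => ?_
  rw [Int.ceil_eq_iff]
  push_cast
  simp

lemma disjoint_cube {ι : Type*} : Pairwise (Function.onFun Disjoint (cube (ι := ι))) := by
  intro k l hkl
  refine Set.disjoint_left.2 fun x hx hx' => hkl (funext fun i => ?_)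
  have h1 := mem_cube_iff.1 hx i
  have h2 := mem_cube_iff.1 hx' i
  omega

lemma iUnion_cube {ι : Type*} : ⋃ k, cube (ι := ι) k = univ :=
  Set.eq_univ_of_forall fun x => Set.mem_iUnion.2
    ⟨fun i => ⌈x i⌉ - 1, mem_cube_iff.2 fun i => by ring⟩

lemma setIntegral_cube {F : Type*} [NormedAddCommGroup F] [NormedSpace ℝ F] (f : (ι → ℝ) → F)
    (k : ι → ℤ) : ∫ x in cube k, f x = ∫ x in cube 0, f (x + intVec k) := by
  rw [← integral_indicator (measurableSet_cube k), ← integral_indicator (measurableSet_cube 0),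
    ← integral_add_right_eq_self _ (intVec k)]
  congr 1
  ext x
  have : x + intVec k ∈ cube k ↔ x ∈ cube 0 := by
    refine forall_congr' fun i => ?_
    simp only [Pi.add_apply, intVec, mem_Ioc, Pi.zero_apply, Int.cast_zero]
    constructor <;> rintro ⟨h1, h2⟩ <;> constructor <;> linarith
  by_cases hx : x ∈ cube 0
  · rw [indicator_of_mem hx, indicator_of_mem (this.2 hx)]
  · rw [indicator_of_notMem hx, indicator_of_notMem (mt this.1 hx)]

lemma hasSum_setIntegral_cube {F : Type*} [NormedAddCommGroup F] [NormedSpace ℝ F]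
    {f : (ι → ℝ) → F} (hf : Integrable f) :
    HasSum (fun k => ∫ x in cube 0, f (x + intVec k)) (∫ x, f x) := by
  have h1 := hasSum_integral_iUnion (f := f) (μ := volume) measurableSet_cube
    (disjoint_cube (ι := ι)) (by rw [iUnion_cube]; exact hf.integrableOn)
  rw [iUnion_cube, setIntegral_univ] at h1
  simpa only [setIntegral_cube f] using h1

lemma integral_eq_setIntegral_tsum {F : Type*} [NormedAddCommGroup F] [NormedSpace ℝ F]
    {f : (ι → ℝ) → F} (hf : Integrable f) :
    ∫ x, f x = ∫ x in cube 0, ∑' k, f (x + intVec k) := by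
  refine (hasSum_setIntegral_cube hf).unique (hasSum_integral_of_summable_integral_norm ?_ ?_)
  · intro k
    exact (hf.comp_add_right (intVec k)).integrableOn
  · exact (hasSum_setIntegral_cube hf.norm).summable

/-- The character with integral frequencies. -/
lemma mFourier_coe (k : ι → ℤ) (x : ι → ℝ) :
    UnitAddTorus.mFourier (-k) (fun i => (x i : UnitAddCircle)) =
      cexp (-2 * Real.pi * I * ∑ i, (k i : ℂ) * x i) := by
  simp only [UnitAddTorus.mFourier, ContinuousMap.coe_mk, fourier_coe_apply]
  rw [← Complex.exp_sum, Finset.mul_sum]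
  congr 1
  refine Finset.sum_congr rfl fun i _ => ?_
  simp
  ring

theorem poisson {f : (ι → ℝ) → ℂ} (hc : Continuous f) (hf : Integrable f)
    (hb : ∀ R : ℝ, ∃ u : (ι → ℤ) → ℝ, Summable u ∧ ∀ x, ‖x‖ ≤ R → ∀ k, ‖f (x + intVec k)‖ ≤ u k)
    (hF : Summable fun k : ι → ℤ => ∫ x, cexp (-2 * Real.pi * I * ∑ i, (k i : ℂ) * x i) * f x) :
    ∑' k, f (intVec k) = ∑' k : ι → ℤ, ∫ x,
      cexp (-2 * Real.pi * I * ∑ i, (k i : ℂ) * x i) * f x := by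
  set P : (ι → ℝ) → ℂ := fun x => ∑' k, f (x + intVec k) with hP
  have hPc : Continuous P := by
    refine continuous_iff_continuousAt.2 fun x => ?_
    obtain ⟨u, hu, hfu⟩ := hb (‖x‖ + 1)
    refine (continuousOn_tsum (s := Metric.closedBall 0 (‖x‖ + 1))
      (fun k => (hc.comp (continuous_add_const (intVec k))).continuousOn) hu
      fun k y hy => hfu y (by simpa using hy) k).continuousAt ?_
    refine Metric.closedBall_mem_nhds_of_mem ?_
    simp
  have hPp : ∀ x k, P (x + intVec k) = P x := by
    intro x k
    simp only [hP]
    rw [← (Equiv.addLeft k).tsum_eq fun l => f (x + intVec l)]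
    refine tsum_congr fun l => ?_
    congr 1
    ext i
    simp [intVec]
    ring
  let pr : C(ι → ℝ, UnitAddTorus ι) :=
    ⟨Pi.map fun _ : ι => ((↑) : ℝ → UnitAddCircle), by
      exact Continuous.piMap fun _ => AddCircle.continuous_mk' 1⟩
  have hpr : IsOpenQuotientMap pr :=
    IsOpenQuotientMap.piMap fun _ => QuotientAddGroup.isOpenQuotientMap_mk
  have hlift : ∀ x y, pr x = pr y → P x = P y := by
    intro x y hxy
    have : ∀ i, ∃ k : ℤ, y i = x i + k := by
      intro i
      have h1 : (x i : UnitAddCircle) = y i := congrFun hxy i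
      obtain ⟨k, hk⟩ := (QuotientAddGroup.eq.1 h1 : -x i + y i ∈ AddSubgroup.zmultiples (1 : ℝ))
      refine ⟨k, ?_⟩
      simp at hk
      linarith
    choose k hk using this
    rw [← hPp x k]
    congr 1
    ext i
    rw [hk]; rfl
  let g : C(UnitAddTorus ι, ℂ) := hpr.isQuotientMap.lift ⟨P, hPc⟩ hlift
  have hg : ∀ x, g (pr x) = P x := fun x =>
    congrFun (congrArg DFunLike.coe (hpr.isQuotientMap.lift_comp ⟨P, hPc⟩ hlift)) x
  have hcoeff : ∀ k : ι → ℤ, UnitAddTorus.mFourierCoeff g k =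
      ∫ x, cexp (-2 * Real.pi * I * ∑ i, (k i : ℂ) * x i) * f x := by
    intro k
    have hint : Integrable fun x => cexp (-2 * Real.pi * I * ∑ i, (k i : ℂ) * x i) * f x := by
      refine hf.bdd_mul (c := 1) ?_ ?_
      · exact (by fun_prop : Continuous fun x : ι → ℝ =>
          cexp (-2 * Real.pi * I * ∑ i, (k i : ℂ) * x i)).aestronglyMeasurable
      · refine Filter.Eventually.of_forall fun x => ?_
        rw [show -2 * (Real.pi : ℂ) * I * ∑ i, (k i : ℂ) * x i =
          ((-2 * Real.pi * ∑ i, (k i : ℝ) * x i : ℝ) : ℂ) * I by push_cast; ring,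
          Complex.norm_exp_ofReal_mul_I]
    rw [integral_eq_setIntegral_tsum hint, UnitAddTorus.mFourierCoeff_eq_integral g k 0]
    have : {x : ι → ℝ | ∀ i, x i ∈ Ioc ((0 : ι → ℝ) i) ((0 : ι → ℝ) i + 1)} = cube 0 := by
      simp [cube]
    rw [this]
    refine setIntegral_congr_fun (measurableSet_cube 0) fun x _ => ?_
    rw [show g (fun i => (x i : UnitAddCircle)) = P x from hg x, mFourier_coe, smul_eq_mul, hP,
      ← tsum_mul_left]
    refine tsum_congr fun l => ?_
    congr 1
    rw [Complex.exp_eq_exp_iff_exists_int]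
    refine ⟨∑ i, k i * l i, ?_⟩
    simp only [Pi.add_apply, intVec]
    push_cast
    simp only [mul_add, Finset.sum_add_distrib]
    ring
  have h1 := UnitAddTorus.hasSum_mFourier_series_apply_of_summable (f := g)
    (by simpa only [funext hcoeff] using hF) 0
  have h2 : g 0 = P 0 := hg 0
  rw [h2] at h1
  have h3 := h1.tsum_eq
  simp only [hP, zero_add] at h3
  rw [← h3]
  refine tsum_congr fun k => ?_
  rw [hcoeff]
  simp [UnitAddTorus.mFourier]

end Poisson

section Gaussian
open MeasureTheory

variable {ι : Type*} [Fintype ι] {V : Type*} [NormedAddCommGroup V] [InnerProductSpace ℝ V]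
  [FiniteDimensional ℝ V] [MeasurableSpace V] [BorelSpace V] (T : (ι → ℝ) ≃L[ℝ] V)

lemma exists_map_volume_eq : ∃ c : NNReal, Measure.map T volume = c • (volume : Measure V) :=
  ⟨_, Measure.isAddLeftInvariant_eq_smul _ _⟩

lemma integrable_comp_equiv {G : V → ℂ} (hG : Integrable G) : Integrable fun x => G (T x) := by
  obtain ⟨c, hc⟩ := exists_map_volume_eq T
  have h1 : Integrable G (Measure.map T volume) := by
    rw [hc]; exact hG.smul_measure ENNReal.coe_ne_top
  exact (integrable_map_equiv T.toHomeomorph.toMeasurableEquiv G).1 h1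

lemma exists_integral_comp_equiv : ∃ c : ℝ, ∀ G : V → ℂ, ∫ x, G (T x) = c * ∫ v, G v := by
  obtain ⟨c, hc⟩ := exists_map_volume_eq T
  refine ⟨c, fun G => ?_⟩
  refine (integral_map_equiv (μ := volume) T.toHomeomorph.toMeasurableEquiv G).symm.trans ?_
  change ∫ v, G v ∂(Measure.map T volume) = _
  rw [hc, integral_smul_nnreal_measure]
  rfl

lemma norm_cexp_neg_mul_sq (b : ℂ) (r : ℝ) : ‖cexp (-b * r ^ 2)‖ = Real.exp (-b.re * r ^ 2) := by
  rw [Complex.norm_exp, ← Complex.ofReal_pow, Complex.re_mul_ofReal]; simp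

lemma integrable_gaussian {b : ℂ} (hb : 0 < b.re) :
    Integrable fun x : ι → ℝ => cexp (-b * ‖T x‖ ^ 2) := by
  have := integrable_comp_equiv T (GaussianFourier.integrable_cexp_neg_mul_sq_norm_add hb 0 (0 : V))
  simpa using this

lemma norm_add_sq_le_two {V : Type*} [NormedAddCommGroup V] (u v : V) :
    ‖u + v‖ ^ 2 ≤ 2 * ‖u‖ ^ 2 + 2 * ‖v‖ ^ 2 := by
  nlinarith [norm_add_le u v, norm_nonneg (u + v), sq_nonneg (‖u‖ - ‖v‖), norm_nonneg u,
    norm_nonneg v]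

lemma summable_gaussian {a : ℝ} (ha : 0 < a) :
    Summable fun k : ι → ℤ => Real.exp (-a * ‖T (intVec k)‖ ^ 2) := by
  set K := ‖(T : (ι → ℝ) →L[ℝ] V)‖ with hK
  have hint : Integrable fun x : ι → ℝ => Real.exp (-(a / 2) * ‖T x‖ ^ 2) := by
    have := (integrable_gaussian T (b := (a / 2 : ℝ)) (by simpa using ha)).norm
    simpa only [norm_cexp_neg_mul_sq, Complex.ofReal_re] using this
  have hs := (hasSum_setIntegral_cube hint).summable
  refine Summable.of_nonneg_of_le (fun _ => (Real.exp_pos _).le) (fun k => ?_)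
    (hs.mul_left (Real.exp (a * K ^ 2)))
  have hvol : volume.real (cube (0 : ι → ℤ)) = 1 := by
    have : cube (0 : ι → ℤ) = Set.pi Set.univ fun i => Set.Ioc (0 : ℝ) 1 := by
      ext x; simp [cube]
    rw [this, Measure.real, Real.volume_pi_Ioc_toReal (fun _ => zero_le_one)]
    simp
  have hvol' : volume (cube (0 : ι → ℤ)) ≠ ⊤ := by
    intro h0; simp [Measure.real, h0] at hvol
  have h1 : Real.exp (-a * K ^ 2) * Real.exp (-a * ‖T (intVec k)‖ ^ 2) ≤
      ∫ x in cube (0 : ι → ℤ), Real.exp (-(a / 2) * ‖T (x + intVec k)‖ ^ 2) := by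
    calc _ = ∫ x in cube (0 : ι → ℤ),
          Real.exp (-a * K ^ 2) * Real.exp (-a * ‖T (intVec k)‖ ^ 2) := by
          rw [setIntegral_const, hvol, one_smul]
      _ ≤ _ := by
        refine setIntegral_mono_on (integrableOn_const hvol')
          (hint.comp_add_right (intVec k)).integrableOn (measurableSet_cube 0) fun x hx => ?_
        rw [← Real.exp_add]
        refine Real.exp_le_exp.2 ?_
        have hx1 : ‖x‖ ≤ 1 := (pi_norm_le_iff_of_nonneg zero_le_one).2 fun i => by
          have := hx i
          simp only [Pi.zero_apply, Int.cast_zero, Set.mem_Ioc] at this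
          rw [Real.norm_eq_abs, abs_of_pos this.1]; linarith
        have hTx : ‖T x‖ ≤ K := by
          refine ((T : (ι → ℝ) →L[ℝ] V).le_opNorm x).trans ?_
          nlinarith [norm_nonneg (T : (ι → ℝ) →L[ℝ] V)]
        have h2 := norm_add_sq_le_two (T x) (T (intVec k))
        rw [map_add]
        have h3 : ‖T x‖ ^ 2 ≤ K ^ 2 := by gcongr
        nlinarith
  calc _ = Real.exp (a * K ^ 2) * (Real.exp (-a * K ^ 2) * Real.exp (-a * ‖T (intVec k)‖ ^ 2)) := by
        rw [← mul_assoc, ← Real.exp_add]; simp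
    _ ≤ _ := by gcongr

lemma gaussian_poisson : ∃ c : ℝ, ∀ b : ℂ, 0 < b.re → ∀ w : (ι → ℤ) → V,
    (∀ k x, inner ℝ (w k) (T x) = ∑ i, (k i : ℝ) * x i) →
    Summable (fun k => cexp (-(Real.pi ^ 2 / b) * ‖w k‖ ^ 2)) →
    ∑' k, cexp (-b * ‖T (intVec k)‖ ^ 2) =
      c * (Real.pi / b) ^ (Module.finrank ℝ V / 2 : ℂ) *
        ∑' k, cexp (-(Real.pi ^ 2 / b) * ‖w k‖ ^ 2) := by
  obtain ⟨c, hc⟩ := exists_integral_comp_equiv T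
  refine ⟨c, fun b hb w hw hsum => ?_⟩
  set K := ‖(T : (ι → ℝ) →L[ℝ] V)‖ with hK
  have hF : ∀ k : ι → ℤ, ∫ x : ι → ℝ, cexp (-2 * Real.pi * I * ∑ i, (k i : ℂ) * x i) *
      cexp (-b * ‖T x‖ ^ 2) = c * (Real.pi / b) ^ (Module.finrank ℝ V / 2 : ℂ) *
        cexp (-(Real.pi ^ 2 / b) * ‖w k‖ ^ 2) := by
    intro k
    have h1 := GaussianFourier.integral_cexp_neg_mul_sq_norm_add hb (-2 * Real.pi * I) (w k)
    have h2 := hc fun v => cexp (-b * ‖v‖ ^ 2 + (-2 * Real.pi * I) * (inner ℝ (w k) v : ℝ))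
    rw [h1] at h2
    rw [show -((Real.pi : ℂ) ^ 2 / b) * ‖w k‖ ^ 2 =
      (-2 * Real.pi * I) ^ 2 * ‖w k‖ ^ 2 / (4 * b) by
        rw [mul_pow, I_sq]; field_simp; ring, mul_assoc (c : ℂ), ← h2]
    congr 1
    ext x
    rw [← Complex.exp_add, hw, add_comm]
    push_cast
    rfl
  rw [poisson (f := fun x => cexp (-b * ‖T x‖ ^ 2)) (by fun_prop) (integrable_gaussian T hb) ?_
    (by simp_rw [hF]; exact hsum.mul_left _)]
  · simp_rw [hF]; rw [tsum_mul_left]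
  · intro R
    refine ⟨fun k => Real.exp (b.re * (K * R) ^ 2) * Real.exp (-(b.re / 2) * ‖T (intVec k)‖ ^ 2),
      (summable_gaussian T (by positivity)).mul_left _, fun x hx k => ?_⟩
    simp only [norm_cexp_neg_mul_sq, ← Real.exp_add]
    refine Real.exp_le_exp.2 ?_
    have hTx : ‖T x‖ ≤ K * R :=
      ((T : (ι → ℝ) →L[ℝ] V).le_opNorm x).trans (by gcongr)
    have h2 := norm_add_sq_le_two (T (x + intVec k)) (-T x)
    rw [norm_neg, map_add, show T x + T (intVec k) + -T x = T (intVec k) by abel] at h2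
    have h3 : ‖T x‖ ^ 2 ≤ (K * R) ^ 2 := by gcongr
    rw [map_add]
    nlinarith

end Gaussian

lemma exists_eq_mul_conjTranspose {n : ℕ} {M : Matrix (Fin n) (Fin n) ℂ} (hM : M.PosDef) :
    ∃ B : Matrix (Fin n) (Fin n) ℂ, M = B * Bᴴ ∧ IsUnit B := by
  open scoped MatrixOrder Matrix.Norms.L2Operator in
  obtain ⟨B, hB⟩ := CStarAlgebra.nonneg_iff_eq_star_mul_self.mp hM.posSemidef.nonneg
  refine ⟨Bᴴ, by rw [conjTranspose_conjTranspose]; exact hB, ?_⟩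
  have h1 : IsUnit M := hM.isUnit
  rw [hB] at h1
  rw [Matrix.isUnit_iff_isUnit_det] at h1 ⊢
  rw [det_mul] at h1
  exact isUnit_of_mul_isUnit_left h1

section Theta
variable {n : ℕ}

/-- Real coordinates on `ℂⁿ` adapted to the Eisenstein integers. -/
def realMap (B : Matrix (Fin n) (Fin n) ℂ) :
    (Fin n ⊕ Fin n → ℝ) →ₗ[ℝ] EuclideanSpace ℂ (Fin n) where
  toFun x := WithLp.toLp 2 ((fun i => (x (.inl i) : ℂ) + x (.inr i) * ω) ᵥ* B)
  map_add' x y := by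
    rw [← WithLp.toLp_add, ← add_vecMul]
    congr 2
    ext i; simp; ring
  map_smul' a x := by
    rw [RingHom.id_apply, ← WithLp.toLp_smul, ← smul_vecMul]
    congr 2
    ext i; simp; ring

lemma ω_im_ne_zero : ω.im ≠ 0 := by
  simp [ω]

lemma realMap_injective {B : Matrix (Fin n) (Fin n) ℂ} (hB : IsUnit B) :
    Function.Injective (realMap B) := by
  refine (injective_iff_map_eq_zero _).2 fun x hx => ?_
  have h1 : (fun i => (x (.inl i) : ℂ) + x (.inr i) * ω) ᵥ* B = 0 :=
    congrArg WithLp.ofLp hx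
  have h2 := Matrix.vecMul_injective_of_isUnit hB (h1.trans (zero_vecMul B).symm)
  have h3 : ∀ i, x (.inr i) = 0 := fun i => by
    have := congrArg Complex.im (congrFun h2 i)
    simpa [ω_im_ne_zero] using this
  funext i
  rcases i with i | i
  · have := congrArg Complex.re (congrFun h2 i)
    simpa [h3 i] using this
  · exact h3 i

/-- The coordinate map as an equivalence. -/
def realEquiv {B : Matrix (Fin n) (Fin n) ℂ} (hB : IsUnit B) :
    (Fin n ⊕ Fin n → ℝ) ≃L[ℝ] EuclideanSpace ℂ (Fin n) :=
  (LinearEquiv.ofInjectiveOfFinrankEq (realMap B) (realMap_injective hB) (by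
    rw [Module.finrank_fintype_fun_eq_card, ← Module.finrank_mul_finrank ℝ ℂ,
      Complex.finrank_real_complex, finrank_euclideanSpace]
    simp; ring)).toContinuousLinearEquiv

lemma realEquiv_apply {B : Matrix (Fin n) (Fin n) ℂ} (hB : IsUnit B) (x : Fin n ⊕ Fin n → ℝ) :
    realEquiv hB x = WithLp.toLp 2 ((fun i => (x (.inl i) : ℂ) + x (.inr i) * ω) ᵥ* B) := rfl

/-- Integral coordinates of a vector of Eisenstein integers. -/
def coord : (Fin n → E) ≃ (Fin n ⊕ Fin n → ℤ) where
  toFun v := Sum.elim (fun i => (v i).re) fun i => (v i).im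
  invFun k i := ⟨k (.inl i), k (.inr i)⟩
  left_inv _ := rfl
  right_inv k := by ext (i | i) <;> rfl

lemma realEquiv_coord {B : Matrix (Fin n) (Fin n) ℂ} (hB : IsUnit B) (v : Fin n → E) :
    realEquiv hB (intVec (coord v)) = WithLp.toLp 2 ((φ ∘ v) ᵥ* B) := by
  have : φ ∘ v = fun i => (intVec (coord v) (.inl i) : ℂ) + intVec (coord v) (.inr i) * ω := by
    funext i
    simp [intVec, coord, φ_apply]
    rfl
  rw [realEquiv_apply, this]

lemma norm_toLp_sq {H : Herm n} {B : Matrix (Fin n) (Fin n) ℂ} (hHB : H.mat.map φ = B * Bᴴ)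
    (v : Fin n → E) : ‖(WithLp.toLp 2 ((φ ∘ v) ᵥ* B) : EuclideanSpace ℂ (Fin n))‖ ^ 2 =
      (q H.mat v : ℝ) := by
  have h1 := φ_h H.mat v v
  rw [h_self H.isHermitian, map_intCast, hHB, ← mulVec_mulVec, dotProduct_mulVec,
    mulVec_conjTranspose, star_star] at h1
  rw [EuclideanSpace.norm_sq_eq]
  apply Complex.ofReal_injective
  push_cast
  rw [h1, dotProduct]
  refine Finset.sum_congr rfl fun i _ => ?_
  rw [Pi.star_apply, ← Complex.mul_conj']
  rfl

lemma norm_realEquiv_coord_sq {H : Herm n} {B : Matrix (Fin n) (Fin n) ℂ} (hB : IsUnit B)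
    (hHB : H.mat.map φ = B * Bᴴ) (v : Fin n → E) :
    ‖realEquiv hB (intVec (coord v))‖ ^ 2 = (q H.mat v : ℝ) := by
  rw [realEquiv_coord, norm_toLp_sq hHB]

/-- Coordinates on the dual lattice. -/
def dualCoord (H : Herm n) : (Fin n → E) ≃ (Fin n ⊕ Fin n → ℤ) where
  toFun v := Sum.elim (fun i => ((v ᵥ* H.mat) i).im) fun i => -((v ᵥ* H.mat) i).re
  invFun k := (fun i => (⟨-k (.inr i), k (.inl i)⟩ : E)) ᵥ* H.mat⁻¹
  left_inv v := by
    have : (fun i => (⟨- -((v ᵥ* H.mat) i).re, ((v ᵥ* H.mat) i).im⟩ : E)) = v ᵥ* H.mat := by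
      ext i <;> simp
    simp only [Sum.elim_inl, Sum.elim_inr]
    rw [this, vecMul_vecMul, mul_nonsing_inv _ H.isUnit_det, vecMul_one]
  right_inv k := by
    simp only [vecMul_vecMul, nonsing_inv_mul _ H.isUnit_det, vecMul_one]
    ext (i | i) <;> simp

lemma re_dual (x y : ℝ) (a : E) :
    ((starRingEnd ℂ (2 / φ θ * φ a)) * ((x : ℂ) + y * ω)).re = a.im * x + -a.re * y := by
  have h3 : Real.sqrt 3 * Real.sqrt 3 = 3 := Real.mul_self_sqrt (by norm_num)
  have hθ : φ θ = Real.sqrt 3 * I := by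
    apply Complex.ext <;> simp [φ_re, φ_im, θ]
    ring
  have h0 : ((Real.sqrt 3 : ℝ) : ℂ) ≠ 0 := by
    exact_mod_cast (by positivity : Real.sqrt 3 ≠ 0)
  have h3' : ((Real.sqrt 3 : ℝ) : ℂ) * (Real.sqrt 3 : ℝ) = 3 := by exact_mod_cast h3
  obtain ⟨r, hr⟩ : ∃ r : ℝ, r * Real.sqrt 3 = -2 := ⟨-2 / Real.sqrt 3, by field_simp⟩
  have hr' : (r : ℂ) * (Real.sqrt 3 : ℝ) = -2 := by exact_mod_cast hr
  have hinv : 2 / φ θ = (r : ℂ) * I := by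
    rw [hθ, div_eq_iff (mul_ne_zero h0 I_ne_zero)]
    linear_combination -I ^ 2 * hr' + 2 * I_sq
  rw [hinv]
  simp [φ_re, φ_im, ω]
  linear_combination (1 / 2 * (a.re : ℝ) * y - 1 / 2 * (a.im : ℝ) * x) * hr

lemma inner_dual {H : Herm n} {B : Matrix (Fin n) (Fin n) ℂ} (hB : IsUnit B)
    (hHB : H.mat.map φ = B * Bᴴ) (v : Fin n → E) (x : Fin n ⊕ Fin n → ℝ) :
    inner ℝ ((2 / φ θ) • (WithLp.toLp 2 ((φ ∘ v) ᵥ* B) : EuclideanSpace ℂ (Fin n)))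
      (realEquiv hB x) = ∑ i, (dualCoord H v i : ℝ) * x i := by
  set z : Fin n → ℂ := fun i => (x (.inl i) : ℂ) + x (.inr i) * ω with hz
  have hv : (φ ∘ v) ᵥ* (B * Bᴴ) = φ ∘ (v ᵥ* H.mat) := by
    rw [← hHB]; ext i
    simp [vecMul, dotProduct, map_sum]
  have h1 : z ᵥ* B ⬝ᵥ star ((2 / φ θ) • ((φ ∘ v) ᵥ* B)) =
      ∑ i, starRingEnd ℂ (2 / φ θ * φ ((v ᵥ* H.mat) i)) * z i := by
    have h2 : star ((2 / φ θ) • ((φ ∘ v) ᵥ* (B * Bᴴ))) =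
        B *ᵥ star ((2 / φ θ) • ((φ ∘ v) ᵥ* B)) := by
      rw [← vecMul_vecMul, ← smul_vecMul, star_vecMul, conjTranspose_conjTranspose]
    rw [← dotProduct_mulVec, ← h2, hv, dotProduct]
    refine Finset.sum_congr rfl fun i _ => ?_
    rw [mul_comm]
    rfl
  rw [Fintype.sum_sum_type, ← Finset.sum_add_distrib, PiLp.inner_apply]
  have h3 := congrArg Complex.re h1
  rw [Complex.re_sum] at h3
  simp only [hz, re_dual] at h3
  refine Eq.trans ?_ (h3.trans ?_)
  · rw [dotProduct, Complex.re_sum]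
    refine Finset.sum_congr rfl fun i _ => ?_
    rw [Complex.inner]
    rfl
  · refine Finset.sum_congr rfl fun i _ => ?_
    simp [dualCoord]

/-- The theta series of a hermitian lattice. -/
def theta (H : Herm n) (z : ℂ) : ℂ := ∑' v : Fin n → E, cexp (2 * Real.pi * I * z * q H.mat v)

lemma theta_eq_gaussian {H : Herm n} {B : Matrix (Fin n) (Fin n) ℂ} (hB : IsUnit B)
    (hHB : H.mat.map φ = B * Bᴴ) (z : ℂ) :
    theta H z = ∑' k, cexp (-(-2 * Real.pi * I * z) * ‖realEquiv hB (intVec k)‖ ^ 2) := by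
  rw [theta, ← coord.tsum_eq]
  refine tsum_congr fun v => ?_
  rw [← Complex.ofReal_pow, norm_realEquiv_coord_sq hB hHB]
  push_cast
  congr 1; ring

lemma re_neg_two_pi (z : ℂ) : (-2 * Real.pi * I * z).re = 2 * Real.pi * z.im := by
  simp

lemma summable_theta (H : Herm n) {z : ℂ} (hz : 0 < z.im) :
    Summable fun v : Fin n → E => cexp (2 * Real.pi * I * z * q H.mat v) := by
  obtain ⟨B, hHB, hB⟩ := exists_eq_mul_conjTranspose H.pd
  have h1 := coord.summable_iff.2
    (summable_gaussian (realEquiv hB) (a := 2 * Real.pi * z.im) (by positivity))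
  refine Summable.of_norm (h1.congr fun v => ?_)
  rw [Function.comp_apply, norm_realEquiv_coord_sq hB hHB, Complex.norm_exp]
  congr 1
  simp

lemma fricke_eq (z : ℂ) : -1 / (3 * z) = ((1 / 3 : ℝ) : ℂ) * -z⁻¹ := by
  push_cast; rw [div_eq_mul_inv, mul_inv]; ring

lemma fricke_im (z : ℂ) : (-1 / (3 * z)).im = z.im / (3 * normSq z) := by
  rw [fricke_eq, Complex.im_ofReal_mul, Complex.neg_im, Complex.inv_im]
  field_simp

lemma fricke_im_pos {z : ℂ} (hz : 0 < z.im) : 0 < (-1 / (3 * z)).im := by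
  have : 0 < normSq z := normSq_pos.2 (by rintro rfl; simp at hz)
  rw [fricke_im]; positivity

lemma theta_fricke_aux (H : Herm n) : ∃ c : ℝ, ∀ z : ℂ, 0 < z.im →
    theta H z = c * (Real.pi / (-2 * Real.pi * I * z)) ^ n * theta H (-1 / (3 * z)) := by
  obtain ⟨B, hHB, hB⟩ := exists_eq_mul_conjTranspose H.pd
  obtain ⟨c, hc⟩ := gaussian_poisson (realEquiv hB)
  refine ⟨c, fun z hz => ?_⟩
  have hz0 : z ≠ 0 := by rintro rfl; simp at hz
  have him := fricke_im_pos hz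
  let w : (Fin n ⊕ Fin n → ℤ) → EuclideanSpace ℂ (Fin n) := fun k =>
    (2 / φ θ) • (WithLp.toLp 2 ((φ ∘ (dualCoord H).symm k) ᵥ* B) : EuclideanSpace ℂ (Fin n))
  have hwn : ∀ k, cexp (-(Real.pi ^ 2 / (-2 * Real.pi * I * z)) * ‖w k‖ ^ 2) =
      cexp (2 * Real.pi * I * (-1 / (3 * z)) * q H.mat ((dualCoord H).symm k)) := by
    intro k
    have h1 : ‖w k‖ ^ 2 = 4 / 3 * q H.mat ((dualCoord H).symm k) := by
      rw [norm_smul, mul_pow, norm_toLp_sq hHB, norm_div, div_pow, norm_φ_sq]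
      norm_num [nm_eq, θ]
    have h2 : (‖w k‖ : ℂ) ^ 2 = 4 / 3 * q H.mat ((dualCoord H).symm k) := by
      rw [← Complex.ofReal_pow, h1]
      push_cast
      rfl
    rw [h2]
    congr 1
    have hpi : (Real.pi : ℂ) ≠ 0 := by exact_mod_cast Real.pi_ne_zero
    field_simp
    ring_nf
    rw [I_sq]; ring
  have h1 := hc (-2 * Real.pi * I * z) (by rw [re_neg_two_pi]; positivity) w (fun k x => by
    have := inner_dual hB hHB ((dualCoord H).symm k) x
    simpa using this) (by
      simp_rw [hwn]
      exact (dualCoord H).symm.summable_iff.2 (summable_theta H him))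
  rw [theta_eq_gaussian hB hHB, h1]
  simp_rw [hwn]
  rw [theta, ← (dualCoord H).symm.tsum_eq]
  congr 2
  rw [← Module.finrank_mul_finrank ℝ ℂ, Complex.finrank_real_complex, finrank_euclideanSpace,
    ← Complex.cpow_natCast]
  simp

lemma theta_I_mul_pos (H : Herm n) {y : ℝ} (hy : 0 < y) :
    ∃ t : ℝ, 0 < t ∧ theta H (I * y) = t := by
  have h1 : ∀ v : Fin n → E, cexp (2 * Real.pi * I * (I * y) * q H.mat v) =
      (Real.exp (-(2 * Real.pi * y * q H.mat v)) : ℝ) := fun v => by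
    push_cast
    congr 1
    linear_combination (2 * Real.pi * y * q H.mat v : ℂ) * I_sq
  have h2 : Summable fun v : Fin n → E => Real.exp (-(2 * Real.pi * y * q H.mat v)) := by
    have := summable_theta H (z := I * y) (by simpa using hy)
    simp_rw [h1] at this
    exact Complex.summable_ofReal.1 this
  refine ⟨_, h2.tsum_pos (fun v => (Real.exp_pos _).le) 0 (Real.exp_pos _), ?_⟩
  rw [theta, Complex.ofReal_tsum]
  exact tsum_congr h1

/-- The Fricke involution acts on theta series of unimodular lattices. -/
theorem theta_fricke (H : Herm n) {z : ℂ} (hz : 0 < z.im) :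
    theta H (-1 / (3 * z)) = (-I * Real.sqrt 3 * z) ^ n * theta H z := by
  obtain ⟨c, hc⟩ := theta_fricke_aux H
  have hs : ((Real.sqrt 3 : ℝ) : ℂ) * (Real.sqrt 3 : ℝ) = 3 := by
    exact_mod_cast Real.mul_self_sqrt (by norm_num : (0 : ℝ) ≤ 3)
  have hs0 : ((Real.sqrt 3 : ℝ) : ℂ) ≠ 0 := by
    exact_mod_cast (by positivity : Real.sqrt 3 ≠ 0)
  have hpi : (Real.pi : ℂ) ≠ 0 := by exact_mod_cast Real.pi_ne_zero
  have hz0 : z ≠ 0 := by rintro rfl; simp at hz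
  have hc1 : (c : ℂ) * (Real.sqrt 3 / 2) ^ n = 1 := by
    have hy : 0 < 1 / Real.sqrt 3 := by positivity
    obtain ⟨t, ht, htheta⟩ := theta_I_mul_pos H hy
    have h1 := hc (I * (1 / Real.sqrt 3 : ℝ)) (by simp)
    have h2 : -1 / (3 * (I * ((1 / Real.sqrt 3 : ℝ) : ℂ))) = I * (1 / Real.sqrt 3 : ℝ) := by
      push_cast
      field_simp
      linear_combination -3 * I_sq - hs
    have h3 : Real.pi / (-2 * Real.pi * I * (I * ((1 / Real.sqrt 3 : ℝ) : ℂ))) =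
        Real.sqrt 3 / 2 := by
      push_cast
      field_simp
      linear_combination -I_sq
    rw [h2, h3, htheta] at h1
    have ht' : (t : ℂ) ≠ 0 := by exact_mod_cast ht.ne'
    exact mul_right_cancel₀ ht' (by rw [one_mul]; exact h1.symm)
  have h4 : (Real.pi : ℂ) / (-2 * Real.pi * I * z) * (-I * Real.sqrt 3 * z) = Real.sqrt 3 / 2 := by
    field_simp
  rw [hc z hz, ← mul_assoc, mul_comm _ ((c : ℂ) * _), mul_assoc (c : ℂ), ← mul_pow, h4, hc1,
    one_mul]

/-- The `q`-expansion of a theta series. -/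
theorem hasSum_theta (H : Herm n) {z : ℂ} (hz : 0 < z.im) :
    HasSum (fun m : ℕ => (rep H m : ℂ) * cexp (2 * Real.pi * I * z) ^ m) (theta H z) := by
  have h1 := (summable_theta H hz).hasSum
  rw [← (Equiv.sigmaFiberEquiv fun v => (q H.mat v).toNat).hasSum_iff] at h1
  refine h1.sigma fun m => ?_
  have hq : ∀ v : Fin n → E, (q H.mat v).toNat = m ↔ q H.mat v = m := fun v => by
    have := PD.q_nonneg H.pd v
    omega
  let e : {v // (q H.mat v).toNat = m} ≃ Vec H m := Equiv.subtypeEquivRight hq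
  have : Finite {v // (q H.mat v).toNat = m} := Finite.of_equiv _ e.symm
  have := Fintype.ofFinite {v // (q H.mat v).toNat = m}
  have h2 : (rep H m : ℂ) = Fintype.card {v // (q H.mat v).toNat = m} := by
    rw [rep, Fintype.card_congr e]
  have h3 : ∀ v : {v // (q H.mat v).toNat = m},
      cexp (2 * Real.pi * I * z * q H.mat v.1) = cexp (2 * Real.pi * I * z) ^ m := fun v => by
    rw [← Complex.exp_nat_mul]
    rw [(hq v.1).1 v.2]
    congr 1
    push_cast
    ring
  have h4 := hasSum_fintype fun _ : {v // (q H.mat v).toNat = m} => cexp (2 * Real.pi * I * z) ^ m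
  rw [Finset.sum_const, Finset.card_univ, nsmul_eq_mul, ← h2] at h4
  exact h4.congr_fun h3

end Theta

section Fricke

/-- The nome `exp (2πiz)`. -/
def nome (z : ℂ) : ℂ := cexp (2 * Real.pi * I * z)

lemma norm_nome (z : ℂ) : ‖nome z‖ = Real.exp (-(2 * Real.pi * z.im)) := by
  rw [nome, Complex.norm_exp]; simp

lemma norm_nome_lt_one {z : ℂ} (hz : 0 < z.im) : ‖nome z‖ < 1 := by
  rw [norm_nome, Real.exp_lt_one_iff]
  have := Real.pi_pos
  nlinarith [mul_pos this hz]

lemma norm_nome_le_iff {z : ℂ} {y : ℝ} : ‖nome z‖ ≤ Real.exp (-(2 * Real.pi * y)) ↔ y ≤ z.im := by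
  rw [norm_nome, Real.exp_le_exp, neg_le_neg_iff, mul_le_mul_iff_right₀ (by positivity)]

lemma nome_ne_zero (z : ℂ) : nome z ≠ 0 := Complex.exp_ne_zero _

lemma nome_three_mul (z : ℂ) : nome (3 * z) = nome z ^ 3 := by
  rw [nome, nome, ← Complex.exp_nat_mul]
  congr 1; push_cast; ring

lemma exists_nome_eq {x : ℂ} (hx : x ≠ 0) : ∃ z, nome z = x ∧ |z.re| ≤ 1 / 2 := by
  have hpi := Real.pi_pos
  have hpi' : (Real.pi : ℂ) ≠ 0 := by exact_mod_cast hpi.ne'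
  refine ⟨((1 / (2 * Real.pi) : ℝ) : ℂ) * (-I * Complex.log x), ?_, ?_⟩
  · rw [nome, ← Complex.exp_log hx]
    congr 1
    rw [Complex.exp_log hx]
    push_cast
    field_simp
    linear_combination (-Complex.log x) * I_sq
  · rw [Complex.re_ofReal_mul, abs_mul, abs_of_pos (by positivity)]
    have h1 : (-I * Complex.log x).re = x.arg := by simp [Complex.log_im]
    rw [h1, div_mul_eq_mul_div, one_mul, div_le_div_iff₀ (by positivity) (by positivity)]
    have := Complex.abs_arg_le_pi x
    linarith

/-- The product `∏ (1 - x ^ k) ^ 24`. -/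
def discProd (x : ℂ) : ℂ := ∏' k : ℕ, (1 - x ^ (k + 1)) ^ 24

lemma differentiableOn_discProd : DifferentiableOn ℂ discProd (Metric.ball 0 1) :=
  ModularForm.differentiableOn_tprod_one_sub_pow_pow 24

lemma disc_eq (z : UpperHalfPlane) : ModularForm.discriminant z = nome z * discProd (nome z) := by
  have h1 : Function.Periodic.qParam 1 (z : ℂ) = nome z := by
    simp [Function.Periodic.qParam, nome]
  have h2 : ∀ k, ModularForm.eta_q k z = nome z ^ (k + 1) := fun k => by
    rw [ModularForm.eta_q_eq_pow, nome]
  rw [ModularForm.discriminant_eq_q_prod, discProd, h1]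
  simp_rw [h2]

lemma discProd_ne_zero {x : ℂ} (hx : ‖x‖ < 1) : discProd x ≠ 0 := by
  rw [discProd, Multipliable.tprod_pow (ModularForm.multipliable_one_sub_pow hx)]
  refine pow_ne_zero _ (tprod_one_add_ne_zero_of_summable (f := fun k => -x ^ (k + 1)) ?_ ?_)
  · intro k h
    have h1 : x ^ (k + 1) = 1 := by linear_combination -h
    have h2 := congrArg norm h1
    rw [norm_pow, norm_one] at h2
    exact (pow_lt_one₀ (norm_nonneg _) hx k.succ_ne_zero).ne h2
  · simpa using (summable_nat_add_iff 1).mpr (summable_geometric_of_lt_one (norm_nonneg _) hx)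

/-- The discriminant as a function of a complex variable. -/
def disc (z : ℂ) : ℂ := nome z * discProd (nome z)

lemma disc_ne_zero {z : ℂ} (hz : 0 < z.im) : disc z ≠ 0 :=
  mul_ne_zero (nome_ne_zero z) (discProd_ne_zero (norm_nome_lt_one hz))

lemma disc_neg_inv {z : ℂ} (hz : 0 < z.im) : disc (-1 / z) = z ^ 12 * disc z := by
  have hz0 : z ≠ 0 := by rintro rfl; simp at hz
  have h1 := congrFun ModularForm.discriminant_S_invariant ⟨z, hz⟩
  rw [ModularForm.SL_slash_apply, UpperHalfPlane.modular_S_smul, disc_eq, disc_eq] at h1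
  have h2 : -1 / z = (-z)⁻¹ := by rw [neg_div, one_div, inv_neg]
  rw [h2]
  rw [ModularGroup.denom_S] at h1
  change disc (-z)⁻¹ * z ^ (-12 : ℤ) = disc z at h1
  rw [← h1, _root_.zpow_neg]
  norm_cast
  field_simp

/-- `f` is a modular form of weight `n` for the Fricke group of level three, in the trivial
eigenspace, with `q`-expansion `a`. -/
def IsFricke (n : ℕ) (a : PowerSeries ℂ) (f : ℂ → ℂ) : Prop :=
  ∀ z : ℂ, 0 < z.im → HasSum (fun m => a.coeff m * nome z ^ m) (f z) ∧
    f (-1 / (3 * z)) = (-I * Real.sqrt 3 * z) ^ n * f z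

lemma IsFricke.summable_norm {n : ℕ} {a : PowerSeries ℂ} {f : ℂ → ℂ} (h : IsFricke n a f)
    {y : ℝ} (hy : 0 < y) :
    Summable fun m => ‖a.coeff m‖ * Real.exp (-(2 * Real.pi * y)) ^ m := by
  have := (h (I * y) (by simpa using hy)).1.summable.norm
  simpa [norm_mul, norm_pow, norm_nome] using this

lemma normSq_le_of_im_eq {z : ℂ} (hre : |z.re| ≤ 1 / 2) (him : z.im = 7 / 25) :
    normSq z ≤ 821 / 2500 := by
  have := abs_le.1 hre
  rw [normSq_apply, him]
  nlinarith

/-- A Fricke form vanishing to high order has one more vanishing coefficient. -/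
lemma IsFricke.coeff_eq_zero_of_lt {n N : ℕ} {a : PowerSeries ℂ} {f : ℂ → ℂ} (h : IsFricke n a f)
    (ha : ∀ m < N, a.coeff m = 0) (hN : n < 6 * N) : a.coeff N = 0 := by
  have hpi := Real.pi_pos
  set R : ℝ := Real.exp (-(2 * Real.pi * (7 / 25))) with hR
  set R' : ℝ := Real.exp (-(2 * Real.pi * (7 / 50))) with hR'
  have hR0 : 0 < R := Real.exp_pos _
  have hR0' : 0 < R' := Real.exp_pos _
  have hRR : R < R' := Real.exp_lt_exp.2 (by linarith)
  have hR1 : R' < 1 := Real.exp_lt_one_iff.2 (by linarith)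
  set B : ℂ → ℂ := fun x => ∑' m, a.coeff (m + N) * x ^ m with hB
  have hsum : Summable fun m => ‖a.coeff (m + N)‖ * R' ^ m := by
    have h1 := ((summable_nat_add_iff N).2 (h.summable_norm (y := 7 / 50) (by norm_num))).mul_right
      (R' ^ N)⁻¹
    refine h1.congr fun m => ?_
    rw [← hR', pow_add]
    field_simp
  have hle : ∀ m, ∀ x ∈ Metric.ball (0 : ℂ) R',
      ‖a.coeff (m + N) * x ^ m‖ ≤ ‖a.coeff (m + N)‖ * R' ^ m := fun m x hx => by
    rw [mem_ball_zero_iff] at hx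
    rw [norm_mul, norm_pow]
    gcongr
  have hBd : DifferentiableOn ℂ B (Metric.ball 0 R') :=
    differentiableOn_tsum_of_summable_norm hsum (fun m => by fun_prop) Metric.isOpen_ball hle
  have hfB : ∀ z : ℂ, 0 < z.im → ‖nome z‖ < R' → f z = nome z ^ N * B (nome z) := fun z hz hzR => by
    have h1 := (h z hz).1
    have h2 : Summable fun m => a.coeff (m + N) * nome z ^ m :=
      Summable.of_norm_bounded hsum fun m => hle m _ (by simpa using hzR)
    have h3 := h2.hasSum.mul_left (nome z ^ N)
    rw [← hasSum_nat_add_iff' N, Finset.sum_eq_zero fun i hi => by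
      rw [ha i (Finset.mem_range.1 hi), zero_mul], sub_zero] at h1
    refine h1.unique (h3.congr_fun fun m => ?_)
    ring
  set G : ℂ → ℂ := fun x => B x ^ 4 / (discProd x * discProd (x ^ 3)) ^ N with hG
  have hcube : ∀ {x : ℂ}, ‖x‖ < 1 → ‖x ^ 3‖ < 1 := fun hx => by
    rw [norm_pow]; exact pow_lt_one₀ (norm_nonneg _) hx (by norm_num)
  have hGd : DifferentiableOn ℂ G (Metric.ball 0 R') := by
    have h1 : DifferentiableOn ℂ discProd (Metric.ball 0 R') :=
      differentiableOn_discProd.mono (Metric.ball_subset_ball hR1.le)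
    have h2 : DifferentiableOn ℂ (fun x => discProd (x ^ 3)) (Metric.ball 0 R') :=
      differentiableOn_discProd.comp (by fun_prop) fun x hx => by
        rw [mem_ball_zero_iff] at hx ⊢
        exact hcube (hx.trans hR1)
    refine (hBd.pow 4).div ((h1.mul h2).pow N) fun x hx => ?_
    rw [mem_ball_zero_iff] at hx
    have hx1 := hx.trans hR1
    exact pow_ne_zero _ (mul_ne_zero (discProd_ne_zero hx1) (discProd_ne_zero (hcube hx1)))
  have hGf : ∀ z : ℂ, 0 < z.im → ‖nome z‖ < R' →
      G (nome z) * (disc z * disc (3 * z)) ^ N = f z ^ 4 := fun z hz hzR => by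
    have h1 := discProd_ne_zero (norm_nome_lt_one hz)
    have h2 := discProd_ne_zero (hcube (norm_nome_lt_one hz))
    rw [hfB z hz hzR, hG, disc, disc, nome_three_mul]
    field_simp
    ring
  have hGw : ∀ z : ℂ, 0 < z.im → ‖nome z‖ < R' → ‖nome (-1 / (3 * z))‖ < R' →
      G (nome z) = (9 * z ^ 4) ^ (6 * N - n) * G (nome (-1 / (3 * z))) := fun z hz hzR hwR => by
    have hz0 : z ≠ 0 := by rintro rfl; simp at hz
    have h3z : 0 < (3 * z).im := by simpa using hz
    have h1 := hGf z hz hzR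
    have h2 := hGf _ (fricke_im_pos hz) hwR
    have h3 : disc (-1 / (3 * z)) * disc (3 * (-1 / (3 * z))) =
        (9 * z ^ 4) ^ 6 * (disc z * disc (3 * z)) := by
      have : 3 * (-1 / (3 * z)) = -1 / z := by field_simp
      rw [this, disc_neg_inv hz, disc_neg_inv h3z]
      ring
    have hs : ((Real.sqrt 3 : ℝ) : ℂ) ^ 2 = 3 := by
      exact_mod_cast Real.sq_sqrt (by norm_num : (0 : ℝ) ≤ 3)
    have h4 : f (-1 / (3 * z)) ^ 4 = (9 * z ^ 4) ^ n * f z ^ 4 := by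
      rw [(h z hz).2, mul_pow, ← pow_mul, mul_comm n, pow_mul]
      congr 2
      calc (-I * Real.sqrt 3 * z) ^ 4 = I ^ 4 * ((Real.sqrt 3 : ℂ) ^ 2) ^ 2 * z ^ 4 := by ring
        _ = 9 * z ^ 4 := by rw [hs, I_pow_four]; ring
    rw [h3, h4, ← h1, mul_pow, ← pow_mul] at h2
    have h5 : (disc z * disc (3 * z)) ^ N ≠ 0 :=
      pow_ne_zero _ (mul_ne_zero (disc_ne_zero hz) (disc_ne_zero h3z))
    have h6 : (9 * z ^ 4) ^ n ≠ 0 := pow_ne_zero _ (mul_ne_zero (by norm_num) (pow_ne_zero _ hz0))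
    have h7 : (9 * z ^ 4) ^ (6 * N) = (9 * z ^ 4) ^ n * (9 * z ^ 4) ^ (6 * N - n) := by
      rw [← pow_add]; congr 1; omega
    rw [h7] at h2
    apply mul_left_cancel₀ h6
    apply mul_right_cancel₀ h5
    linear_combination -h2
  obtain ⟨x, hx, hmax⟩ := Complex.exists_mem_frontier_isMaxOn_norm (f := G)
    (U := Metric.ball (0 : ℂ) R) Metric.isBounded_ball ⟨0, by simpa using hR0⟩
    ⟨hGd.mono (Metric.ball_subset_ball hRR.le), hGd.continuousOn.mono
      (Metric.closure_ball_subset_closedBall.trans (Metric.closedBall_subset_ball hRR))⟩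
  rw [closure_ball _ hR0.ne'] at hmax
  rw [frontier_ball _ hR0.ne', mem_sphere_zero_iff_norm] at hx
  have hGx : G x = 0 := by
    obtain ⟨z, rfl, hre⟩ := exists_nome_eq (x := x) (by rintro rfl; simp at hx; linarith)
    have him : z.im = 7 / 25 := by
      rw [norm_nome, hR, Real.exp_eq_exp] at hx
      have h1 : (2 * Real.pi) * z.im = (2 * Real.pi) * (7 / 25) := by linarith
      exact mul_left_cancel₀ (by positivity) h1
    have hz : 0 < z.im := by rw [him]; norm_num
    have hns := normSq_le_of_im_eq hre him
    have hns0 : 0 < normSq z := normSq_pos.2 (by rintro rfl; simp at hz)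
    have hw : ‖nome (-1 / (3 * z))‖ ≤ R := by
      rw [hR, norm_nome_le_iff, fricke_im, him, le_div_iff₀ (by positivity)]
      linarith
    have h1 := congrArg norm (hGw z hz (hx.trans_lt hRR) (hw.trans_lt hRR))
    have h2 : ‖G (nome (-1 / (3 * z)))‖ ≤ ‖G (nome z)‖ :=
      hmax (by simpa using hw)
    have h3 : ‖9 * z ^ 4‖ < 1 := by
      rw [norm_mul, norm_pow, show ‖z‖ ^ 4 = (‖z‖ ^ 2) ^ 2 by ring, ← normSq_eq_norm_sq]
      norm_num
      nlinarith
    rw [norm_mul, norm_pow] at h1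
    have h4 : ‖9 * z ^ 4‖ ^ (6 * N - n) < 1 := pow_lt_one₀ (norm_nonneg _) h3 (by omega)
    by_contra h5
    have h6 : 0 < ‖G (nome z)‖ := norm_pos_iff.2 h5
    nlinarith [pow_nonneg (norm_nonneg (9 * z ^ 4)) (6 * N - n)]
  have hG0 : G 0 = 0 := by
    have h1 : ‖G 0‖ ≤ ‖G x‖ := hmax (by simpa using hR0.le)
    rw [hGx, norm_zero] at h1
    exact norm_le_zero_iff.1 h1
  have hB0 : B 0 = a.coeff N := by
    rw [hB]
    simp only
    rw [tsum_eq_single 0 fun m hm => by rw [zero_pow hm, mul_zero]]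
    simp
  rw [hG] at hG0
  simp only at hG0
  rcases div_eq_zero_iff.1 hG0 with h1 | h1
  · rw [← hB0]; exact pow_eq_zero_iff (by norm_num) |>.1 h1
  · exact absurd h1 (pow_ne_zero _ (mul_ne_zero (discProd_ne_zero (by simp))
      (discProd_ne_zero (by simp))))

/-- A Fricke form is determined by its first coefficients. -/
theorem IsFricke.eq_zero {n N : ℕ} {a : PowerSeries ℂ} {f : ℂ → ℂ} (h : IsFricke n a f)
    (ha : ∀ m < N, a.coeff m = 0) (hN : n < 6 * N) : a = 0 := by
  ext m
  rw [map_zero]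
  induction m using Nat.strong_induction_on with
  | _ m ih =>
    by_cases hm : m < N
    · exact ha m hm
    · exact h.coeff_eq_zero_of_lt ih (by omega)

end Fricke

section FrickeForms

lemma IsFricke.add {n : ℕ} {a b : PowerSeries ℂ} {f g : ℂ → ℂ} (hf : IsFricke n a f)
    (hg : IsFricke n b g) : IsFricke n (a + b) fun z => f z + g z := fun z hz => by
  refine ⟨?_, by beta_reduce; rw [(hf z hz).2, (hg z hz).2, mul_add]⟩
  simpa [add_mul] using (hf z hz).1.add (hg z hz).1

lemma IsFricke.smul {n : ℕ} {a : PowerSeries ℂ} {f : ℂ → ℂ} (hf : IsFricke n a f) (c : ℂ) :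
    IsFricke n (c • a) fun z => c * f z := fun z hz => by
  refine ⟨?_, by beta_reduce; rw [(hf z hz).2]; ring⟩
  simpa [mul_assoc] using (hf z hz).1.mul_left c

lemma IsFricke.sum {n : ℕ} {ι : Type*} {s : Finset ι} {a : ι → PowerSeries ℂ} {f : ι → ℂ → ℂ}
    (hf : ∀ i ∈ s, IsFricke n (a i) (f i)) :
    IsFricke n (∑ i ∈ s, a i) fun z => ∑ i ∈ s, f i z := fun z hz => by
  refine ⟨?_, ?_⟩
  · simpa [Finset.sum_mul] using hasSum_sum fun i hi => (hf i hi z hz).1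
  · rw [Finset.mul_sum]
    exact Finset.sum_congr rfl fun i hi => (hf i hi z hz).2

lemma IsFricke.one : IsFricke 0 1 fun _ => 1 := fun z _ => by
  refine ⟨?_, by simp⟩
  have := hasSum_single (f := fun m => (1 : PowerSeries ℂ).coeff m * nome z ^ m) 0 fun m hm => by
    simp [PowerSeries.coeff_one, hm]
  simpa using this

lemma IsFricke.mul {n m : ℕ} {a b : PowerSeries ℂ} {f g : ℂ → ℂ} (hf : IsFricke n a f)
    (hg : IsFricke m b g) : IsFricke (n + m) (a * b) fun z => f z * g z := fun z hz => by
  refine ⟨?_, by beta_reduce; rw [(hf z hz).2, (hg z hz).2]; ring⟩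
  have h1 := (hf z hz).1
  have h2 := (hg z hz).1
  have h3 := (summable_norm_sum_mul_antidiagonal_of_summable_norm h1.summable.norm
    h2.summable.norm).of_norm.hasSum
  rw [← tsum_mul_tsum_eq_tsum_sum_antidiagonal_of_summable_norm h1.summable.norm h2.summable.norm,
    h1.tsum_eq, h2.tsum_eq] at h3
  refine h3.congr_fun fun k => ?_
  rw [PowerSeries.coeff_mul, Finset.sum_mul]
  refine Finset.sum_congr rfl fun x hx => ?_
  rw [← Finset.HasAntidiagonal.mem_antidiagonal.1 hx]
  ring

lemma IsFricke.pow {n : ℕ} {a : PowerSeries ℂ} {f : ℂ → ℂ} (hf : IsFricke n a f) (k : ℕ) :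
    IsFricke (k * n) (a ^ k) fun z => f z ^ k := by
  induction k with
  | zero => simpa using IsFricke.one
  | succ k ih =>
    have := ih.mul hf
    simpa [pow_succ, add_mul] using this

/-- The theta series of a lattice as a power series. -/
def thetaSeries {n : ℕ} (H : Herm n) : PowerSeries ℂ := PowerSeries.mk fun m => (rep H m : ℂ)

lemma isFricke_theta {n : ℕ} (H : Herm n) : IsFricke n (thetaSeries H) (theta H) := fun z hz => by
  refine ⟨?_, theta_fricke H hz⟩
  simpa [thetaSeries, nome] using hasSum_theta H hz

/-- The power series of averages of representation numbers. -/
def avgSeries (n : ℕ) : PowerSeries ℂ :=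
  PowerSeries.mk fun m => ((avg n fun H => (rep H m : ℚ) : ℚ) : ℂ)

lemma isFricke_avgSeries (n : ℕ) : ∃ f, IsFricke n (avgSeries n) f := by
  have h1 := IsFricke.sum (s := Finset.univ) fun (c : Cls n) _ =>
    (isFricke_theta c.rep).smul (1 / (aut c.rep : ℂ))
  suffices h2 : avgSeries n = ∑ c : Cls n, (1 / (aut c.rep : ℂ)) • thetaSeries c.rep by
    rw [h2]; exact ⟨_, h1⟩
  ext m
  simp only [avgSeries, avg, thetaSeries, PowerSeries.coeff_mk, map_sum, PowerSeries.coeff_smul]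
  push_cast
  refine Finset.sum_congr rfl fun c _ => ?_
  rw [smul_eq_mul]; ring

/-- The function of the normalised Eisenstein series of weight six. -/
def eisSix (z : ℂ) : ℂ := ModularForm.E (k := 6) (by norm_num) (UpperHalfPlane.ofComplex z)

/-- The `q`-expansion of the normalised Eisenstein series of weight six. -/
def eisSixCoeff (m : ℕ) : ℤ := if m = 0 then 1 else -504 * ArithmeticFunction.sigma 5 m

lemma hasSum_eisSix {z : ℂ} (hz : 0 < z.im) :
    HasSum (fun m => (eisSixCoeff m : ℂ) * nome z ^ m) (eisSix z) := by
  have h1 := UpperHalfPlane.hasSum_qExpansion (f := ModularForm.E (k := 6) (by norm_num)) one_pos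
    (SlashInvariantFormClass.periodic_comp_ofComplex _ one_mem_strictPeriods_SL)
    (ModularFormClass.holo _) (ModularFormClass.bdd_at_infty _) ⟨z, hz⟩
  rw [eisSix, UpperHalfPlane.ofComplex_apply_of_im_pos hz]
  refine h1.congr_fun fun m => ?_
  rw [EisensteinSeries.E_qExpansion_coeff _ ⟨3, rfl⟩, eisSixCoeff,
    show bernoulli 6 = 1 / 42 by decide +kernel, nome, smul_eq_mul]
  congr 1
  · split_ifs <;> norm_num
  · simp [Function.Periodic.qParam]

open scoped ModularForm in
lemma eisSix_neg_inv {z : ℂ} (hz : 0 < z.im) : eisSix (-1 / z) = z ^ 6 * eisSix z := by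
  have hz0 : z ≠ 0 := by rintro rfl; simp at hz
  have h1 := congrFun (SlashInvariantForm.slash_action_eqn
    (ModularForm.E (k := 6) (by norm_num)) _ ⟨ModularGroup.S, rfl⟩) ⟨z, hz⟩
  change ((ModularForm.E (k := 6) (by norm_num) : UpperHalfPlane → ℂ) ∣[(6 : ℤ)]
    ModularGroup.S) _ = _ at h1
  rw [ModularForm.SL_slash_apply, UpperHalfPlane.modular_S_smul, ModularGroup.denom_S] at h1
  have h2 : 0 < ((-z)⁻¹).im := by
    rw [inv_neg, Complex.neg_im, Complex.inv_im]
    have : 0 < normSq z := normSq_pos.2 hz0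
    field_simp
    simpa
  have h3 : -1 / z = (-z)⁻¹ := by rw [neg_div, one_div, inv_neg]
  rw [h3, eisSix, eisSix, UpperHalfPlane.ofComplex_apply_of_im_pos hz,
    UpperHalfPlane.ofComplex_apply_of_im_pos h2]
  refine Eq.trans ?_ (congrArg (z ^ 6 * ·) h1)
  change _ = z ^ 6 * (_ * z ^ (-6 : ℤ))
  rw [_root_.zpow_neg]
  norm_cast
  field_simp

end FrickeForms

section Coefficients

/-- The difference `27 E₆(3z) - E₆(z)` as a power series. -/
def eisDiff : PowerSeries ℂ := PowerSeries.mk fun m =>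
  27 * ((if 3 ∣ m then eisSixCoeff (m / 3) else 0 : ℤ) : ℂ) - eisSixCoeff m

lemma isFricke_eisDiff : IsFricke 6 eisDiff fun z => 27 * eisSix (3 * z) - eisSix z :=
    fun z hz => by
  have h3z : 0 < (3 * z).im := by simpa using hz
  have hz0 : z ≠ 0 := by rintro rfl; simp at hz
  refine ⟨?_, ?_⟩
  · have h1 := hasSum_eisSix h3z
    have h2 : HasSum (fun m : ℕ =>
        ((if 3 ∣ m then eisSixCoeff (m / 3) else 0 : ℤ) : ℂ) * nome z ^ m)
        (eisSix (3 * z)) := by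
      rw [← Function.Injective.hasSum_iff (g := fun m : ℕ => 3 * m) fun a b h => by
        simpa using h]
      · refine h1.congr_fun fun m => ?_
        simp [nome_three_mul, pow_mul]
      · intro m hm
        rw [if_neg fun ⟨k, hk⟩ => hm ⟨k, hk.symm⟩]
        simp
    simpa [eisDiff, sub_mul, mul_assoc] using (h2.mul_left 27).sub (hasSum_eisSix hz)
  · beta_reduce
    have h1 : 3 * (-1 / (3 * z)) = -1 / z := by field_simp
    have hs : ((Real.sqrt 3 : ℝ) : ℂ) ^ 2 = 3 := by
      exact_mod_cast Real.sq_sqrt (by norm_num : (0 : ℝ) ≤ 3)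
    have h2 : (-I * Real.sqrt 3 * z) ^ 6 = -27 * z ^ 6 := by
      calc (-I * Real.sqrt 3 * z) ^ 6 = (I ^ 2) ^ 3 * ((Real.sqrt 3 : ℂ) ^ 2) ^ 3 * z ^ 6 := by ring
        _ = -27 * z ^ 6 := by rw [hs, I_sq]; ring
    rw [h1, eisSix_neg_inv hz, eisSix_neg_inv h3z, h2]
    ring

/-- The standard lattice of rank one. -/
def unitHerm : Herm 1 where
  mat := 1
  det_eq := det_one
  pd := by
    rw [PD, Matrix.map_one _ (map_zero _) (map_one _)]
    exact Matrix.PosDef.one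

lemma q_unitHerm (x : Fin 1 → E) : q unitHerm.mat x = nm (x 0) := by
  rw [q, h, unitHerm, one_mulVec, dotProduct]
  simp [nm_eq]
  ring

lemma rep_unitHerm {m : ℤ} (hm : m ≤ 6) : rep unitHerm m =
    ((Finset.Icc (-2) 2 ×ˢ Finset.Icc (-2) 2 : Finset (ℤ × ℤ)).filter
      fun p => p.1 ^ 2 - p.1 * p.2 + p.2 ^ 2 = m).card := by
  rw [rep, ← Fintype.card_coe]
  refine Fintype.card_congr
    ⟨fun x => ⟨((x.1 0).re, (x.1 0).im), ?_⟩, fun p => ⟨fun _ => ⟨p.1.1, p.1.2⟩, ?_⟩, ?_, ?_⟩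
  · have h1 := x.2
    rw [q_unitHerm, nm_eq] at h1
    simp only [Finset.mem_filter, Finset.mem_product, Finset.mem_Icc]
    refine ⟨⟨⟨?_, ?_⟩, ⟨?_, ?_⟩⟩, h1⟩ <;>
      nlinarith [sq_nonneg (2 * (x.1 0).re - (x.1 0).im), sq_nonneg (2 * (x.1 0).im - (x.1 0).re)]
  · have h1 := (Finset.mem_filter.1 p.2).2
    rw [q_unitHerm, nm_eq]
    exact h1
  · intro x
    ext i
    · rw [Subsingleton.elim i 0]
    · rw [Subsingleton.elim i 0]
  · intro p
    rfl

/-- The first seven coefficients of `a` are the entries of `l`. -/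
def HasCoeffs (a : PowerSeries ℂ) (l : List ℤ) : Prop :=
  ∀ m < 7, a.coeff m = ((l.getD m 0 : ℤ) : ℂ)

/-- Truncated product of coefficient lists. -/
def conv (l l' : List ℤ) : List ℤ := (List.range 7).map fun m =>
  ((List.range (m + 1)).map fun i => l.getD i 0 * l'.getD (m - i) 0).sum

/-- Truncated powers of coefficient lists. -/
def convPow (l : List ℤ) : ℕ → List ℤ
  | 0 => [1]
  | k + 1 => conv (convPow l k) l

lemma HasCoeffs.mul {a b : PowerSeries ℂ} {l l' : List ℤ} (ha : HasCoeffs a l)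
    (hb : HasCoeffs b l') : HasCoeffs (a * b) (conv l l') := fun m hm => by
  have h1 : (conv l l').getD m 0 =
      ((List.range (m + 1)).map fun i => l.getD i 0 * l'.getD (m - i) 0).sum := by
    simp [conv, List.getD_eq_getElem?_getD, hm]
  have h2 : ((List.range (m + 1)).map fun i => l.getD i 0 * l'.getD (m - i) 0).sum =
      ∑ i ∈ Finset.range (m + 1), l.getD i 0 * l'.getD (m - i) 0 := rfl
  rw [h1, h2, PowerSeries.coeff_mul,
    Finset.Nat.sum_antidiagonal_eq_sum_range_succ_mk]
  push_cast
  refine Finset.sum_congr rfl fun i hi => ?_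
  have := Finset.mem_range.1 hi
  rw [ha i (by omega), hb (m - i) (by omega)]

lemma HasCoeffs.pow {a : PowerSeries ℂ} {l : List ℤ} (ha : HasCoeffs a l) (k : ℕ) :
    HasCoeffs (a ^ k) (convPow l k) := by
  induction k with
  | zero =>
    intro m hm
    rw [pow_zero, convPow, PowerSeries.coeff_one]
    interval_cases m <;> simp
  | succ k ih => rw [pow_succ]; exact ih.mul ha

/-- Coefficients of the theta series of the standard lattice of rank one. -/
def unitCoeffs : List ℤ := [1, 6, 0, 6, 6, 0, 0]

/-- Coefficients of the cusp form of weight six. -/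
def cuspCoeffs : List ℤ := [0, 1, -6, 9, 4, 6, -54]

lemma hasCoeffs_unit : HasCoeffs (thetaSeries unitHerm) unitCoeffs := fun m hm => by
  rw [thetaSeries, PowerSeries.coeff_mk, rep_unitHerm (by omega)]
  norm_cast
  interval_cases m <;> decide +kernel

/-- The cusp form of weight six. -/
def cuspSeries : PowerSeries ℂ :=
  (1 / 432 : ℂ) • ((26 : ℂ) • thetaSeries unitHerm ^ 6 + (-1 : ℂ) • eisDiff)

lemma hasCoeffs_cusp : HasCoeffs cuspSeries cuspCoeffs := fun m hm => by
  have h1 := hasCoeffs_unit.pow 6 m hm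
  have h2 : 26 * (convPow unitCoeffs 6).getD m 0 -
      (27 * (if 3 ∣ m then eisSixCoeff (m / 3) else 0) - eisSixCoeff m) =
      432 * cuspCoeffs.getD m 0 := by
    interval_cases m <;> decide +kernel
  have h3 := congrArg (Int.cast : ℤ → ℂ) h2
  push_cast at h3
  simp only [cuspSeries, eisDiff, PowerSeries.coeff_smul, map_add, h1,
    PowerSeries.coeff_mk, smul_eq_mul]
  push_cast
  linear_combination (1 / 432) * h3

lemma isFricke_unit : IsFricke 1 (thetaSeries unitHerm) (theta unitHerm) := isFricke_theta _

lemma isFricke_cusp : ∃ f, IsFricke 6 cuspSeries f :=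
  ⟨_, (((isFricke_unit.pow 6).smul 26).add (isFricke_eisDiff.smul (-1))).smul (1 / 432)⟩

end Coefficients

section Mass

lemma rep_zero {n : ℕ} (H : Herm n) : rep H 0 = 1 := by
  rw [rep, Fintype.card_eq_one_iff]
  refine ⟨⟨0, q_zero _⟩, fun x => Subtype.ext ?_⟩
  by_contra hx
  exact (PD.q_pos H.pd hx).ne' x.2

lemma convPow_unit_zero : ∀ n < 18, (convPow unitCoeffs n).getD 0 0 = 1 := by decide +kernel

lemma conv_cusp_low : ∀ n < 18, (conv (convPow unitCoeffs n) cuspCoeffs).getD 0 0 = 0 ∧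
    (conv (convPow unitCoeffs n) cuspCoeffs).getD 1 0 = 1 := by decide +kernel

lemma conv_cusp_sq_low : ∀ n < 18,
    (conv (convPow unitCoeffs n) (conv cuspCoeffs cuspCoeffs)).getD 0 0 = 0 ∧
    (conv (convPow unitCoeffs n) (conv cuspCoeffs cuspCoeffs)).getD 1 0 = 0 ∧
    (conv (convPow unitCoeffs n) (conv cuspCoeffs cuspCoeffs)).getD 2 0 = 1 := by decide +kernel

/-- Averages of representation numbers in terms of a basis of Fricke forms. -/
lemma avg_rep_expansion {n : ℕ} (hn : n < 18) : ∃ b c : ℚ, (n < 6 → b = 0) ∧ (n < 12 → c = 0) ∧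
    ∀ m : ℕ, m < 7 → avg n (fun H => (rep H m : ℚ)) =
      (avg n fun _ => 1) * (convPow unitCoeffs n).getD m 0 +
      b * (conv (convPow unitCoeffs (n - 6)) cuspCoeffs).getD m 0 +
      c * (conv (convPow unitCoeffs (n - 12)) (conv cuspCoeffs cuspCoeffs)).getD m 0 := by
  set W : ℕ → ℚ := fun m => avg n fun H => (rep H m : ℚ) with hW
  set M : ℚ := avg n fun _ => 1 with hM
  have hW0 : W 0 = M := by simp [hW, hM, rep_zero]
  set A := convPow unitCoeffs n
  set B := conv (convPow unitCoeffs (n - 6)) cuspCoeffs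
  set C := conv (convPow unitCoeffs (n - 12)) (conv cuspCoeffs cuspCoeffs)
  obtain ⟨b, hb⟩ : ∃ b : ℚ, b = if n < 6 then 0 else W 1 - M * A.getD 1 0 := ⟨_, rfl⟩
  obtain ⟨c, hc⟩ : ∃ c : ℚ, c = if n < 12 then 0 else W 2 - M * A.getD 2 0 - b * B.getD 2 0 :=
    ⟨_, rfl⟩
  refine ⟨b, c, fun h => by rw [hb, if_pos h], fun h => by rw [hc, if_pos h], ?_⟩
  have hA := convPow_unit_zero n hn
  have hB := conv_cusp_low (n - 6) (by omega)
  have hC := conv_cusp_sq_low (n - 12) (by omega)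
  set S : PowerSeries ℂ := avgSeries n + (-M : ℂ) • thetaSeries unitHerm ^ n +
    (-b : ℂ) • (thetaSeries unitHerm ^ (n - 6) * cuspSeries) +
    (-c : ℂ) • (thetaSeries unitHerm ^ (n - 12) * cuspSeries ^ 2) with hS
  have hcoeff : ∀ m : ℕ, m < 7 → S.coeff m =
      ((W m - M * A.getD m 0 - b * B.getD m 0 - c * C.getD m 0 : ℚ) : ℂ) := fun m hm => by
    have h1 := hasCoeffs_unit.pow n m hm
    have h2 := (hasCoeffs_unit.pow (n - 6)).mul hasCoeffs_cusp m hm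
    have h3 := (hasCoeffs_unit.pow (n - 12)).mul (hasCoeffs_cusp.mul hasCoeffs_cusp) m hm
    rw [← pow_two] at h3
    simp only [hS, map_add, PowerSeries.coeff_smul, h1, h2, h3, smul_eq_mul, avgSeries,
      PowerSeries.coeff_mk]
    push_cast
    ring
  have hzero : S = 0 := by
    obtain ⟨f, hf⟩ := isFricke_avgSeries n
    obtain ⟨g, hg⟩ := isFricke_cusp
    have hp := fun k : ℕ => (by simpa only [mul_one] using isFricke_unit.pow k :
      IsFricke k (thetaSeries unitHerm ^ k) _)
    have h1 := hf.add ((hp n).smul (-M : ℂ))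
    have h2 := ((hp (n - 6)).mul hg).smul (-b : ℂ)
    have h3 := ((hp (n - 12)).mul (hg.pow 2)).smul (-c : ℂ)
    rcases lt_or_ge n 6 with hn6 | hn6
    · have hb0 : b = 0 := by rw [hb, if_pos hn6]
      have hc0 : c = 0 := by rw [hc, if_pos (by omega)]
      have hS1 : S = avgSeries n + (-M : ℂ) • thetaSeries unitHerm ^ n := by
        simp [hS, hb0, hc0]
      refine (hS1 ▸ h1).eq_zero (N := 1) (fun m hm => ?_) (by omega)
      obtain rfl : m = 0 := by omega
      rw [hcoeff 0 (by omega), hb0, hc0, hA, hW0]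
      simp
    rw [show n - 6 + 6 = n by omega] at h2
    have hb1 : b = W 1 - M * A.getD 1 0 := by rw [hb, if_neg (by omega)]
    rcases lt_or_ge n 12 with hn12 | hn12
    · have hc0 : c = 0 := by rw [hc, if_pos hn12]
      have hS1 : S = avgSeries n + (-M : ℂ) • thetaSeries unitHerm ^ n +
          (-b : ℂ) • (thetaSeries unitHerm ^ (n - 6) * cuspSeries) := by
        simp [hS, hc0]
      refine (hS1 ▸ h1.add h2).eq_zero (N := 2) (fun m hm => ?_) (by omega)
      rw [hcoeff m (by omega), hc0]
      interval_cases m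
      · rw [hA, hB.1, hW0]; simp
      · rw [hB.2, hb1]; simp
    · rw [show n - 12 + 2 * 6 = n by omega] at h3
      refine ((h1.add h2).add h3).eq_zero (N := 3) (fun m hm => ?_) (by omega)
      rw [← hS, hcoeff m (by omega)]
      interval_cases m
      · rw [hA, hB.1, hC.1, hW0]; simp
      · rw [hB.2, hC.2.1, hb1]; simp
      · rw [hC.2.2, hc, if_neg (by omega)]; simp
  intro m hm
  have h1 := hcoeff m hm
  rw [hzero, map_zero] at h1
  have h2 : W m - M * A.getD m 0 - b * B.getD m 0 - c * C.getD m 0 = 0 := by exact_mod_cast h1.symm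
  linarith

lemma avg_rep_one (n : ℕ) : avg (n + 1) (fun H => (rep H 1 : ℚ)) = avg n fun _ => 1 := by
  have := avg_mul_rep_one (n := n) (f := fun _ => 1) fun _ _ _ => rfl
  simpa using this

/-- The trace of `θ ^ n`. -/
def traceTheta (n : ℕ) : ℤ := if Even n then 2 * (-3) ^ (n / 2) else 0

/-- The eigenvalue relating the representation numbers of `3m` and `m`, with `s = -1` for
`m ≡ 1` and `s = 1` for `m ≡ 2` modulo `3`. -/
def eigen (n : ℕ) (s : ℤ) : ℤ :=
  1 + 3 * (((3 ^ n + traceTheta n) / 3).toNat - ((3 ^ n + s * traceTheta (n + 1)) / 9).toNat) / 2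

lemma traceTheta_numerals : ∀ n < 18, 6 ≤ n →
    (3 : E) * ((3 ^ n + traceTheta n) / 3).toNat = 3 ^ n + θ ^ n + (-θ) ^ n ∧
    (9 : E) * ((3 ^ n + (-1) * traceTheta (n + 1)) / 9).toNat =
      3 ^ n - (θ ^ (n + 1) + (-θ) ^ (n + 1)) ∧
    (9 : E) * ((3 ^ n + 1 * traceTheta (n + 1)) / 9).toNat =
      3 ^ n + (θ ^ (n + 1) + (-θ) ^ (n + 1)) ∧
    2 * eigen n (-1) = 2 + 3 * ((3 ^ n + traceTheta n) / 3).toNat -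
      3 * ((3 ^ n + (-1) * traceTheta (n + 1)) / 9).toNat ∧
    2 * eigen n 1 = 2 + 3 * ((3 ^ n + traceTheta n) / 3).toNat -
      3 * ((3 ^ n + 1 * traceTheta (n + 1)) / 9).toNat := by decide +kernel

lemma avg_rep_three {n : ℕ} (hn : n < 18) (hn6 : 6 ≤ n) :
    avg n (fun H => (rep H 3 : ℚ)) = eigen n (-1) * avg n fun H => (rep H 1 : ℚ) := by
  obtain ⟨hZ, hZ', -, he, -⟩ := traceTheta_numerals n hn hn6
  have h1 := avg_rep_three_mul n (m := 1) (by decide) hZ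
    (by rw [hZ', if_pos (by decide)]; ring)
  have h2 := congrArg (Int.cast (R := ℚ)) he
  push_cast at h1 h2
  rw [← h2] at h1
  linarith

lemma avg_rep_six {n : ℕ} (hn : n < 18) (hn6 : 6 ≤ n) :
    avg n (fun H => (rep H 6 : ℚ)) = eigen n 1 * avg n fun H => (rep H 2 : ℚ) := by
  obtain ⟨hZ, -, hZ', -, he⟩ := traceTheta_numerals n hn hn6
  have h1 := avg_rep_three_mul n (m := 2) (by decide) hZ
    (by rw [hZ', if_neg (by decide)])
  have h2 := congrArg (Int.cast (R := ℚ)) he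
  push_cast at h1 h2
  rw [← h2] at h1
  linarith

/-- Numerator and denominator of the ratio of the masses of ranks `n` and `n - 1`. -/
def massRatio (n : ℕ) : ℤ × ℤ :=
  let a := fun i => (convPow unitCoeffs n).getD i 0
  let b := fun i => (conv (convPow unitCoeffs (n - 6)) cuspCoeffs).getD i 0
  let c := fun i => (conv (convPow unitCoeffs (n - 12)) (conv cuspCoeffs cuspCoeffs)).getD i 0
  let s := eigen n (-1)
  let t := eigen n 1
  if n < 6 then (1, a 1) else if n < 12 then (s - b 3, a 3 - a 1 * b 3) else
  ((c 6 - t) * (s - b 3) - c 3 * (t * b 2 - b 6),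
    (c 6 - t) * (a 3 - a 1 * b 3) + c 3 * (t * (a 2 - a 1 * b 2) - (a 6 - a 1 * b 6)))

lemma massRatio_mul_avg {n : ℕ} (hn : n + 1 < 18) :
    ((massRatio (n + 1)).2 : ℚ) * (avg (n + 1) fun _ => 1) =
      (massRatio (n + 1)).1 * avg n fun _ => 1 := by
  obtain ⟨b, c, hb, hc, hW⟩ := avg_rep_expansion hn
  have hB := conv_cusp_low (n + 1 - 6) (by omega)
  have hC := conv_cusp_sq_low (n + 1 - 12) (by omega)
  have h1 := hW 1 (by omega)
  have h2 := hW 2 (by omega)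
  have h3 := hW 3 (by omega)
  have h6 := hW 6 (by omega)
  rw [hB.2, hC.2.1, Nat.cast_one, avg_rep_one] at h1
  rw [hC.2.2] at h2
  simp only [massRatio]
  split_ifs with hn6 hn12
  · rw [hb hn6, hc (by omega)] at h1
    push_cast
    linarith
  · have e3 := avg_rep_three hn (by omega)
    rw [avg_rep_one] at e3
    rw [hc hn12] at h1 h3
    generalize convPow unitCoeffs (n + 1) = A at *
    generalize conv (convPow unitCoeffs (n + 1 - 6)) cuspCoeffs = B at *
    push_cast at h1 h3 ⊢
    rw [e3] at h3
    linear_combination (B.getD 3 0 : ℚ) * h1 - h3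
  · have e3 := avg_rep_three hn (by omega)
    have e6 := avg_rep_six hn (by omega)
    rw [avg_rep_one] at e3
    generalize convPow unitCoeffs (n + 1) = A at *
    generalize conv (convPow unitCoeffs (n + 1 - 6)) cuspCoeffs = B at *
    generalize conv (convPow unitCoeffs (n + 1 - 12)) (conv cuspCoeffs cuspCoeffs) = C at *
    push_cast at h1 h2 h3 h6 ⊢
    rw [e3] at h3
    rw [e6, h2] at h6
    linear_combination ((C.getD 6 0 : ℚ) - eigen (n + 1) 1) * (B.getD 3 0 * h1 - h3) +
      C.getD 3 0 * (h6 - (B.getD 6 0 - eigen (n + 1) 1 * B.getD 2 0) * h1)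

lemma avg_zero : (avg 0 fun _ => 1) = 1 := by
  have haut : ∀ H : Herm 0, aut H = 1 := fun H =>
    Fintype.card_eq_one_iff.2 ⟨Herm.J.refl H, fun U => Herm.J.ext (Subsingleton.elim _ _)⟩
  have hpd : PD (1 : Matrix (Fin 0) (Fin 0) E) := by
    rw [PD, Matrix.map_one _ (map_zero _) (map_one _)]
    exact .one
  have hcls : ∀ c : Cls 0, c = Herm.cls ⟨1, det_one, hpd⟩ := fun c => by
    rw [← c.rep_cls]
    exact congrArg _ (Herm.ext' (Subsingleton.elim _ _))
  have : Fintype.card (Cls 0) = 1 := Fintype.card_eq_one_iff.2 ⟨_, hcls⟩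
  simp [avg, haut, this]

/-- The mass of the unimodular lattices of rank `n`, computed recursively. -/
def mass : ℕ → ℚ
  | 0 => 1
  | n + 1 => (massRatio (n + 1)).1 / (massRatio (n + 1)).2 * mass n

lemma massRatio_ne_zero : ∀ n < 17, (massRatio (n + 1)).2 ≠ 0 := by decide +kernel

lemma avg_one_eq_mass {n : ℕ} (hn : n < 18) : (avg n fun _ => 1) = mass n := by
  induction n with
  | zero => exact avg_zero
  | succ n ih =>
    have h1 := massRatio_mul_avg hn
    have h2 : ((massRatio (n + 1)).2 : ℚ) ≠ 0 := by
      exact_mod_cast massRatio_ne_zero n (by omega)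
    rw [mass, ← ih (by omega)]
    field_simp
    linarith

lemma avg_no_norm_one_fourteen : avg 14 (fun H => if rep H 1 = 0 then 1 else 0) =
    902121810728981 / (2 ^ 24 * 3 ^ 14 * 5 ^ 3 * 7 ^ 2 * 11 * 13) := by
  have h1 : ∑ j ∈ Finset.range 15, (-1) ^ j / (6 ^ j * (j.factorial : ℚ)) * mass (14 - j) =
      902121810728981 / (2 ^ 24 * 3 ^ 14 * 5 ^ 3 * 7 ^ 2 * 11 * 13) := by decide +kernel
  rw [avg_no_norm_one, ← h1]
  exact Finset.sum_congr rfl fun j _ => by rw [avg_one_eq_mass (by omega)]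

end Mass

section Comparison

variable {n : ℕ}

/-- The complex Gram matrix of a lattice. -/
def Herm.gram (H : Herm n) : Matrix (Fin n) (Fin n) ℂ := H.mat.map φ

lemma map_φ_injective : Function.Injective fun U : Matrix (Fin n) (Fin n) E => U.map φ :=
  Matrix.map_injective φ_injective

lemma entriesIn_iff {U : Matrix (Fin n) (Fin n) ℂ} :
    EntriesIn U ↔ ∃ V : Matrix (Fin n) (Fin n) E, V.map φ = U := by
  refine ⟨fun hU => ?_, ?_⟩
  · choose V hV using fun i j => (mem_O_iff (U i j)).1 (hU i j)
    exact ⟨Matrix.of V, by ext i j; simp [hV]⟩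
  · rintro ⟨V, rfl⟩ i j
    exact φ_mem _

lemma map_φ_congr (U M : Matrix (Fin n) (Fin n) E) :
    (U * M * Uᴴ).map φ = U.map φ * M.map φ * (U.map φ)ᴴ := by
  rw [Matrix.map_mul, Matrix.map_mul, map_φ_conjTranspose]

lemma inGL_map_φ {U : Matrix (Fin n) (Fin n) E} (hU : IsUnit U.det) : InGL (U.map φ) := by
  refine ⟨entriesIn_iff.2 ⟨U, rfl⟩, U⁻¹.map φ, entriesIn_iff.2 ⟨_, rfl⟩, ?_, ?_⟩
  · rw [← Matrix.map_mul, mul_nonsing_inv _ hU, Matrix.map_one _ (map_zero _) (map_one _)]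
  · rw [← Matrix.map_mul, nonsing_inv_mul _ hU, Matrix.map_one _ (map_zero _) (map_one _)]

/-- Isometries of lattices in terms of complex Gram matrices. -/
lemma exists_isometry_iff {H H' : Herm n} (U : Matrix (Fin n) (Fin n) ℂ) :
    InGL U ∧ U * H.gram * Uᴴ = H'.gram ↔ ∃ V : H.J H', V.val.map φ = U := by
  constructor
  · rintro ⟨⟨hU, -⟩, he⟩
    obtain ⟨V, rfl⟩ := entriesIn_iff.1 hU
    exact ⟨⟨V, map_φ_injective ((map_φ_congr V H.mat).trans he)⟩, rfl⟩
  · rintro ⟨V, rfl⟩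
    exact ⟨inGL_map_φ V.isUnit, by rw [Herm.gram, ← map_φ_congr, V.eq, Herm.gram]⟩

lemma latIsometric_iff {H H' : Herm n} : LatIsometric H.gram H'.gram ↔ H.cls = H'.cls := by
  rw [Herm.cls_eq]
  constructor
  · rintro ⟨U, hU, he⟩
    obtain ⟨V, -⟩ := (exists_isometry_iff U).1 ⟨hU, he.symm⟩
    exact ⟨V⟩
  · rintro ⟨V⟩
    obtain ⟨hU, he⟩ := (exists_isometry_iff (V.val.map φ)).2 ⟨V, rfl⟩
    exact ⟨_, hU, he.symm⟩

lemma autCard_gram (H : Herm n) : autCard H.gram = aut H := by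
  rw [autCard, aut, ← Nat.card_eq_fintype_card]
  refine (Nat.card_congr (Equiv.ofBijective
    (fun V : H.J H => ⟨V.val.map φ, (exists_isometry_iff _).2 ⟨V, rfl⟩⟩) ⟨?_, ?_⟩)).symm
  · exact fun V V' hV => Herm.J.ext (map_φ_injective (congrArg Subtype.val hV))
  · rintro ⟨U, hU⟩
    obtain ⟨V, hV⟩ := (exists_isometry_iff U).1 hU
    exact ⟨V, Subtype.ext hV⟩

lemma isUnimodular_gram (H : Herm n) : IsUnimodular H.gram :=
  ⟨⟨entriesIn_iff.2 ⟨_, rfl⟩, H.pd.1, H.pd⟩, by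
    rw [Herm.gram, ← RingHom.mapMatrix_apply, ← RingHom.map_det, H.det_eq, map_one]⟩

lemma IsUnimodular.exists_gram {M : Matrix (Fin n) (Fin n) ℂ} (hM : IsUnimodular M) :
    ∃ H : Herm n, H.gram = M := by
  obtain ⟨⟨hM1, -, hM2⟩, hM3⟩ := hM
  obtain ⟨V, rfl⟩ := entriesIn_iff.1 hM1
  refine ⟨⟨V, φ_injective ?_, hM2⟩, rfl⟩
  rw [RingHom.map_det, RingHom.mapMatrix_apply, hM3, map_one]

lemma normOneFree_gram {H : Herm n} : NormOneFree H.gram ↔ rep H 1 = 0 := by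
  have hn : ∀ x : Fin n → E, latNorm H.gram (star (φ ∘ x)) = (q H.mat x : ℂ) := fun x => by
    rw [latNorm, star_star, Herm.gram, ← φ_h, h_self H.isHermitian, map_intCast]
  rw [rep, Fintype.card_eq_zero_iff]
  constructor
  · refine fun hH => ⟨fun x => hH (star (φ ∘ x.1)) (fun i => ?_) ?_⟩
    · rw [Pi.star_apply, Function.comp_apply, ← φ_star]
      exact φ_mem _
    · rw [hn, x.2, Int.cast_one]
  · intro hH x hx h1
    choose y hy using fun i => (mem_O_iff (x i)).1 (hx i)
    have hxy : x = star (φ ∘ star y) := by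
      ext i
      simp [φ_star, hy]
    rw [hxy, hn] at h1
    exact hH.false ⟨star y, by exact_mod_cast h1⟩

end Comparison

end EisLat

/-- The set of isometry classes of unimodular hermitian `𝓞`-lattices of rank 14 with
no vector of norm 1 is finite, and its mass `Y₁₄` equals
`902121810728981 / (2²⁴·3¹⁴·5³·7²·11·13)`. -/
theorem stmt_14 :
    ∃ (k : ℕ) (L : Fin k → Matrix (Fin 14) (Fin 14) ℂ),
      (∀ a, IsUnimodular (L a) ∧ NormOneFree (L a)) ∧
      (∀ a b, LatIsometric (L a) (L b) → a = b) ∧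
      (∀ H : Matrix (Fin 14) (Fin 14) ℂ, IsUnimodular H → NormOneFree H →
        ∃ a, LatIsometric H (L a)) ∧
      ∑ a, (1 : ℚ) / (autCard (L a) : ℚ) =
        902121810728981 / (2 ^ 24 * 3 ^ 14 * 5 ^ 3 * 7 ^ 2 * 11 * 13) := by
  let e := (Fintype.equivFin {c : EisLat.Cls 14 // EisLat.rep c.rep 1 = 0}).symm
  refine ⟨_, fun a => (e a).1.rep.gram, fun a => ⟨EisLat.isUnimodular_gram _,
    EisLat.normOneFree_gram.2 (e a).2⟩,
    fun a b hab => ?_, fun M hM hM1 => ?_, ?_⟩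
  · rw [EisLat.latIsometric_iff, EisLat.Cls.rep_cls, EisLat.Cls.rep_cls] at hab
    exact e.injective (Subtype.ext hab)
  · obtain ⟨H, rfl⟩ := EisLat.IsUnimodular.exists_gram hM
    have hc : H.cls.rep.cls = H.cls := EisLat.Cls.rep_cls _
    obtain ⟨U⟩ := EisLat.Herm.cls_eq.1 hc
    refine ⟨e.symm ⟨H.cls, (EisLat.rep_congr U 1).trans (EisLat.normOneFree_gram.1 hM1)⟩, ?_⟩
    beta_reduce
    rw [e.apply_symm_apply, EisLat.latIsometric_iff, hc]
  · simp_rw [EisLat.autCard_gram]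
    rw [e.sum_comp fun c => (1 : ℚ) / EisLat.aut c.1.rep, ← EisLat.avg_no_norm_one_fourteen,
      EisLat.avg,
      ← Finset.sum_subtype (Finset.univ.filter fun c : EisLat.Cls 14 =>
        EisLat.rep c.rep 1 = 0) (by simp)
        fun c => (1 : ℚ) / EisLat.aut c.rep, Finset.sum_filter]
    refine Finset.sum_congr rfl fun c _ => ?_
    split_ifs <;> simp
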